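/- For r ≤ min(n,m), the graded Frobenius image of C[x_{n×m}]/I_{n,m,r} is Σ_{d=0}^{min(m,n)} q^d · {Σ_{μ⊢d}(s_μ·h_{n−d}) ⊗ (s_μ·h_{m−d})}_{λ_1 ≤ n+m−d−r}. -/

import Mathlib

open scoped BigOperators

/-- An integer partition, recorded by its (finitely supported, weakly
decreasing) sequence of parts `λ_1 = part 0, λ_2 = part 1, …`. -/
structure Ptn where
  part : ℕ →₀ ℕ
  antitone' : ∀ i, part (i + 1) ≤ part i

/-- The size `|λ|` of a partition: the sum of its parts. -/
def Ptn.size (l : Ptn) : ℕ := l.part.sum fun _ v => v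

/-- `(row, col)` is a (bijective) filling of the Young diagram of `λ ⊢ n` by
the `n` letters: the map `k ↦ (row k, col k)` is a bijection from `Fin n` onto
the set of cells `{(i, j) : j < λ_{i+1}}` of the diagram of `λ`. -/
def IsFilling {n : ℕ} (l : Ptn) (row col : Fin n → ℕ) : Prop :=
  Function.Injective (fun k => (row k, col k)) ∧
  ∀ i j : ℕ, (∃ k, row k = i ∧ col k = j) ↔ j < l.part i

/-- The row symmetrizer `a_T = Σ_{w preserving the rows of T} w` of a filling. -/
noncomputable def rowSymmetrizer {n : ℕ} (row : Fin n → ℕ) :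
    MonoidAlgebra ℂ (Equiv.Perm (Fin n)) :=
  ∑ w ∈ Finset.univ.filter
      (fun w : Equiv.Perm (Fin n) => ∀ k, row (w k) = row k),
    MonoidAlgebra.of ℂ (Equiv.Perm (Fin n)) w

/-- The (signed) column symmetrizer `b_T = Σ_{w preserving the columns of T}
sign(w)·w` of a filling. -/
noncomputable def colSymmetrizer {n : ℕ} (col : Fin n → ℕ) :
    MonoidAlgebra ℂ (Equiv.Perm (Fin n)) :=
  ∑ w ∈ Finset.univ.filter
      (fun w : Equiv.Perm (Fin n) => ∀ k, col (w k) = col k),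
    ((Equiv.Perm.sign w : ℤ) : ℂ) • MonoidAlgebra.of ℂ (Equiv.Perm (Fin n)) w

/-- The Young symmetrizer `c_T = a_T · b_T`. -/
noncomputable def youngSymmetrizer {n : ℕ} (row col : Fin n → ℕ) :
    MonoidAlgebra ℂ (Equiv.Perm (Fin n)) :=
  rowSymmetrizer row * colSymmetrizer col

/-- The irreducible `S_n`-module `V^λ`, realized inside the group algebra
`ℂ[S_n]` as the left ideal generated by the Young symmetrizer of a filling of
shape `λ`. -/
noncomputable def spechtModule {n : ℕ} (row col : Fin n → ℕ) :
    Submodule ℂ (MonoidAlgebra ℂ (Equiv.Perm (Fin n))) :=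
  Submodule.span ℂ
    {y | ∃ x : MonoidAlgebra ℂ (Equiv.Perm (Fin n)),
      y = x * youngSymmetrizer row col}

open scoped TensorProduct DirectSum
open MvPolynomial

set_option synthInstance.maxHeartbeats 1000000
set_option maxHeartbeats 1000000

/-- `IsPieri μ k λ`: `λ` is obtained from `μ` by adding a horizontal strip of
size `k` (no such `λ` when `k < 0`); equivalently `s_λ` occurs in `s_μ · h_k`. -/
def IsPieri (m : Ptn) (k : ℤ) (l : Ptn) : Prop :=
  (l.size : ℤ) = m.size + k ∧ (∀ i, m.part i ≤ l.part i) ∧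
    ∀ i, l.part (i + 1) ≤ m.part i

/-- The Specht left ideal is stable under left multiplication. -/
lemma mul_mem_specht {n : ℕ} (row col : Fin n → ℕ)
    (a : MonoidAlgebra ℂ (Equiv.Perm (Fin n)))
    {v : MonoidAlgebra ℂ (Equiv.Perm (Fin n))} (hv : v ∈ spechtModule row col) :
    a * v ∈ spechtModule row col := by
  induction hv using Submodule.span_induction with
  | mem y hy =>
      obtain ⟨x, rfl⟩ := hy
      exact Submodule.subset_span ⟨a * x, (mul_assoc _ _ _).symm⟩
  | zero => rw [mul_zero]; exact (spechtModule row col).zero_mem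
  | add y z _ _ hy hz => rw [mul_add]; exact (spechtModule row col).add_mem hy hz
  | smul c y _ hy => rw [mul_smul_comm]; exact (spechtModule row col).smul_mem c hy

/-- The action of `g ∈ S_n` on `V^λ` (left multiplication in `ℂ[S_n]`). -/
noncomputable def spechtAct {n : ℕ} (row col : Fin n → ℕ)
    (g : Equiv.Perm (Fin n)) :
    spechtModule row col →ₗ[ℂ] spechtModule row col :=
  LinearMap.restrict
    (LinearMap.mulLeft ℂ (MonoidAlgebra.of ℂ (Equiv.Perm (Fin n)) g))
    (fun _ hv => mul_mem_specht row col _ hv)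

/-- The ideal `I_{n,m,r}`: generated by products of two variables in a common
row, products of two variables in a common column, products of `n−r+1` distinct
row sums, and products of `m−r+1` distinct column sums. -/
noncomputable def idealInmr (n m r : ℕ) : Ideal (MvPolynomial (Fin n × Fin m) ℂ) :=
  Ideal.span
    ({f | ∃ (i : Fin n) (j j' : Fin m), f = X (i, j) * X (i, j')} ∪
     {f | ∃ (i i' : Fin n) (j : Fin m), f = X (i, j) * X (i', j)} ∪
     {f | ∃ is : Fin (n - r + 1) → Fin n, Function.Injective is ∧
            f = ∏ k, (∑ j, X (is k, j))} ∪
     {f | ∃ js : Fin (m - r + 1) → Fin m, Function.Injective js ∧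
            f = ∏ k, (∑ i, X (i, js k))})

/-- The degree-`d` homogeneous component of `ℂ[x_{n×m}]/I_{n,m,r}`. -/
noncomputable def gradedPiece (n m r d : ℕ) :
    Submodule ℂ (MvPolynomial (Fin n × Fin m) ℂ ⧸ idealInmr n m r) :=
  Submodule.map (Ideal.Quotient.mkₐ ℂ (idealInmr n m r)).toLinearMap
    (homogeneousSubmodule (Fin n × Fin m) ℂ d)

/-- The multiplicity of `V^λ ⊗ V^ρ` in degree `d`, i.e. the coefficient of
`s_λ ⊗ s_ρ` in `{Σ_{μ⊢d} (s_μ·h_{n−d}) ⊗ (s_μ·h_{m−d})}_{λ_1 ≤ n+m−d−r}`. -/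
noncomputable def gradedMult (n m r d : ℕ) (l1 l2 : Ptn) : ℕ :=
  if l1.part 0 + d + r ≤ n + m ∧ l2.part 0 + d + r ≤ n + m then
    Nat.card {mu : Ptn // mu.size = d ∧
      IsPieri mu ((n : ℤ) - d) l1 ∧ IsPieri mu ((m : ℤ) - d) l2}
  else 0


namespace GF

/-! ### Group algebra basics -/

/-- The basis element of the group algebra. -/
noncomputable def dl {G : Type} [Group G] (g : G) : MonoidAlgebra ℂ G := MonoidAlgebra.of ℂ G g

section basics
variable {G : Type} [Group G]

lemma dl_mul (g h : G) : dl (g * h) = dl g * dl h := by simp [dl]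
lemma dl_one : dl (1 : G) = 1 := by simp [dl, MonoidAlgebra.one_def]

lemma coeff_dl_mul (g h : G) (x : MonoidAlgebra ℂ G) :
    (dl g * x).coeff h = x.coeff (g⁻¹ * h) := by
  simp [dl, MonoidAlgebra.of_apply, MonoidAlgebra.coeff_single_mul_apply]

lemma coeff_mul_dl (g h : G) (x : MonoidAlgebra ℂ G) :
    (x * dl g).coeff h = x.coeff (h * g⁻¹) := by
  simp [dl, MonoidAlgebra.of_apply, MonoidAlgebra.coeff_mul_single_apply]

lemma coeff_dl [DecidableEq G] (g h : G) : (dl g).coeff h = if g = h then 1 else 0 := by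
  simp [dl, MonoidAlgebra.of_apply, Finsupp.single_apply]

lemma ga_ind {P : MonoidAlgebra ℂ G → Prop} (x : MonoidAlgebra ℂ G) (h1 : ∀ g, P (dl g))
    (h2 : ∀ x y, P x → P y → P (x + y)) (h3 : ∀ (c : ℂ) x, P x → P (c • x)) : P x :=
  MonoidAlgebra.induction_on x h1 h2 h3

lemma ga_lin_ext {N : Type*} [AddCommGroup N] [Module ℂ N] {f f' : MonoidAlgebra ℂ G →ₗ[ℂ] N}
    (h : ∀ g, f (dl g) = f' (dl g)) : f = f' := by
  ext x
  simpa [dl, MonoidAlgebra.of_apply] using h x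

lemma ga_sum [Fintype G] (x : MonoidAlgebra ℂ G) : x = ∑ g, x.coeff g • dl g := by
  classical
  ext h
  simp [coeff_dl]

lemma coeff_one_mul_comm (x y : MonoidAlgebra ℂ G) : (x * y).coeff 1 = (y * x).coeff 1 := by
  induction x using ga_ind with
  | h1 g => rw [coeff_dl_mul, coeff_mul_dl]; simp
  | h2 a b ha hb => simp [add_mul, mul_add, ha, hb]
  | h3 c a ha => simp [ha]

lemma semiprime [Finite G] (v : MonoidAlgebra ℂ G) (h : ∀ z, v * z * v = 0) : v = 0 := by
  have : NeZero (Nat.card G : ℂ) := ⟨by exact_mod_cast Nat.card_pos.ne'⟩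
  obtain ⟨e, he, hI⟩ := IsSemisimpleRing.ideal_eq_span_idempotent (Ideal.span {v})
  have h1 : v ∈ Ideal.span {e} := hI ▸ Ideal.mem_span_singleton_self v
  have h2 : e ∈ Ideal.span {v} := hI.symm ▸ Ideal.mem_span_singleton_self e
  obtain ⟨x, hx⟩ := Ideal.mem_span_singleton'.1 h1
  obtain ⟨y, hy⟩ := Ideal.mem_span_singleton'.1 h2
  have h3 : v * e = v := by rw [← hx, mul_assoc, he]
  rw [← h3, ← hy, ← mul_assoc]; exact h y

/-- The anti-involution `g ↦ g⁻¹`. -/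
noncomputable def iotaHom : MonoidAlgebra ℂ G →ₐ[ℂ] (MonoidAlgebra ℂ G)ᵐᵒᵖ :=
  MonoidAlgebra.lift ℂ _ G
    { toFun := fun g => MulOpposite.op (dl g⁻¹)
      map_one' := by simp [dl_one]
      map_mul' := fun g h => by simp [dl_mul] }

noncomputable def iota : MonoidAlgebra ℂ G →ₗ[ℂ] MonoidAlgebra ℂ G :=
  (MulOpposite.opLinearEquiv ℂ).symm.toLinearMap ∘ₗ iotaHom.toLinearMap

lemma iota_dl (g : G) : iota (dl g) = dl g⁻¹ := by
  simp only [iota, LinearMap.comp_apply, AlgHom.toLinearMap_apply]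
  rw [iotaHom, dl, MonoidAlgebra.lift_of]; rfl

lemma iota_mul (x y : MonoidAlgebra ℂ G) : iota (x * y) = iota y * iota x := by
  simp [iota]

lemma iota_iota (x : MonoidAlgebra ℂ G) : iota (iota x) = x := by
  induction x using ga_ind with
  | h1 g => simp [iota_dl]
  | h2 a b ha hb => simp [ha, hb]
  | h3 c a ha => simp [ha]

lemma coeff_iota (x : MonoidAlgebra ℂ G) (g : G) : (iota x).coeff g = x.coeff g⁻¹ := by
  classical
  induction x using ga_ind with
  | h1 h => rw [iota_dl]; simp only [coeff_dl, inv_eq_iff_eq_inv]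
  | h2 a b ha hb => simp [ha, hb]
  | h3 c a ha => simp [ha]

end basics

/-! ### Row and column symmetrizers -/

section sym
variable {n : ℕ}

lemma row_dl_mul {row : Fin n → ℕ} {w : Equiv.Perm (Fin n)} (hw : ∀ k, row (w k) = row k) :
    dl w * rowSymmetrizer row = rowSymmetrizer row := by
  classical
  unfold rowSymmetrizer
  rw [Finset.mul_sum]
  refine Finset.sum_bij' (fun g _ => w * g) (fun g _ => w⁻¹ * g) ?_ ?_ ?_ ?_ ?_
  · intro g hg; simp only [Finset.mem_filter, Finset.mem_univ, true_and] at hg ⊢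
    intro k; simp [hw, hg]
  · intro g hg; simp only [Finset.mem_filter, Finset.mem_univ, true_and] at hg ⊢
    intro k; rw [← hg k, ← hw]; simp
  · intros; simp
  · intros; simp
  · intro g _; simp [dl]

lemma col_dl_mul {col : Fin n → ℕ} {w : Equiv.Perm (Fin n)} (hw : ∀ k, col (w k) = col k) :
    dl w * colSymmetrizer col = ((Equiv.Perm.sign w : ℤ) : ℂ) • colSymmetrizer col := by
  classical
  unfold colSymmetrizer
  rw [Finset.mul_sum, Finset.smul_sum]
  refine Finset.sum_bij' (fun g _ => w * g) (fun g _ => w⁻¹ * g) ?_ ?_ ?_ ?_ ?_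
  · intro g hg; simp only [Finset.mem_filter, Finset.mem_univ, true_and] at hg ⊢
    intro k; simp [hw, hg]
  · intro g hg; simp only [Finset.mem_filter, Finset.mem_univ, true_and] at hg ⊢
    intro k; rw [← hg k, ← hw]; simp
  · intros; simp
  · intros; simp
  · intro g _
    have h : ((Equiv.Perm.sign w : ℤ) : ℂ) * ((Equiv.Perm.sign w : ℤ) : ℂ) = 1 := by
      rcases Int.units_eq_one_or (Equiv.Perm.sign w) with h | h <;> simp [h]
    have h' : ((Equiv.Perm.sign (w * g) : ℤ) : ℂ) =
        ((Equiv.Perm.sign w : ℤ) : ℂ) * ((Equiv.Perm.sign g : ℤ) : ℂ) := by simp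
    rw [h', dl, map_mul, mul_smul_comm, smul_smul, ← mul_assoc, h, one_mul]

lemma iota_row (row : Fin n → ℕ) : iota (rowSymmetrizer row) = rowSymmetrizer row := by
  classical
  unfold rowSymmetrizer
  rw [map_sum]
  refine Finset.sum_bij' (fun g _ => g⁻¹) (fun g _ => g⁻¹) ?_ ?_ ?_ ?_ ?_
  · intro g hg; simp only [Finset.mem_filter, Finset.mem_univ, true_and] at hg ⊢
    intro k; rw [← hg]; simp
  · intro g hg; simp only [Finset.mem_filter, Finset.mem_univ, true_and] at hg ⊢
    intro k; rw [← hg]; simp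
  · intros; simp
  · intros; simp
  · intro g _; exact iota_dl g

lemma iota_col (col : Fin n → ℕ) : iota (colSymmetrizer col) = colSymmetrizer col := by
  classical
  unfold colSymmetrizer
  rw [map_sum]
  refine Finset.sum_bij' (fun g _ => g⁻¹) (fun g _ => g⁻¹) ?_ ?_ ?_ ?_ ?_
  · intro g hg; simp only [Finset.mem_filter, Finset.mem_univ, true_and] at hg ⊢
    intro k; rw [← hg]; simp
  · intro g hg; simp only [Finset.mem_filter, Finset.mem_univ, true_and] at hg ⊢
    intro k; rw [← hg]; simp
  · intros; simp
  · intros; simp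
  · intro g _
    rw [map_smul]
    simp only [Equiv.Perm.sign_inv]
    exact congrArg _ (iota_dl g)

lemma row_mul_dl {row : Fin n → ℕ} {w : Equiv.Perm (Fin n)} (hw : ∀ k, row (w k) = row k) :
    rowSymmetrizer row * dl w = rowSymmetrizer row := by
  have hw' : ∀ k, row (w⁻¹ k) = row k := fun k => by rw [← hw]; simp
  have := congrArg iota (row_dl_mul hw')
  simpa [iota_mul, iota_row, iota_dl] using this

lemma col_mul_dl {col : Fin n → ℕ} {w : Equiv.Perm (Fin n)} (hw : ∀ k, col (w k) = col k) :
    colSymmetrizer col * dl w = ((Equiv.Perm.sign w : ℤ) : ℂ) • colSymmetrizer col := by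
  have hw' : ∀ k, col (w⁻¹ k) = col k := fun k => by rw [← hw]; simp
  have := congrArg iota (col_dl_mul hw')
  simpa [iota_mul, iota_col, iota_dl] using this

lemma swap_pres {f : Fin n → ℕ} {x y : Fin n} (h : f x = f y) (k : Fin n) :
    f (Equiv.swap x y k) = f k := by
  rcases eq_or_ne k x with rfl | h1
  · simp [h]
  rcases eq_or_ne k y with rfl | h2
  · simp [h]
  rw [Equiv.swap_apply_of_ne_of_ne h1 h2]

/-- If some pair lies in a common row and a common (translated) column the product vanishes. -/
lemma row_dl_col_eq_zero {row col : Fin n → ℕ} {g : Equiv.Perm (Fin n)}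
    (h : ¬ Function.Injective (fun x => (row x, col (g⁻¹ x)))) :
    rowSymmetrizer row * dl g * colSymmetrizer col = 0 := by
  simp only [Function.Injective, not_forall] at h
  obtain ⟨x, y, hxy, hne⟩ := h
  simp only [Prod.mk.injEq] at hxy
  have h1 := row_mul_dl (swap_pres hxy.1)
  have h2 := col_dl_mul (swap_pres hxy.2)
  have h3 : Equiv.swap x y * g = g * Equiv.swap (g⁻¹ x) (g⁻¹ y) := by
    rw [Equiv.mul_swap_eq_swap_mul]; simp
  have hne' : g⁻¹ x ≠ g⁻¹ y := fun h => hne (g⁻¹.injective h)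
  have : rowSymmetrizer row * dl g * colSymmetrizer col =
      -(rowSymmetrizer row * dl g * colSymmetrizer col) := by
    conv_lhs => rw [← h1, mul_assoc (rowSymmetrizer row), ← dl_mul, h3, dl_mul, mul_assoc,
      mul_assoc, h2, Equiv.Perm.sign_swap hne']
    simp [mul_assoc]
  have h4 : (2 : ℂ) • (rowSymmetrizer row * dl g * colSymmetrizer col) = 0 := by
    rw [two_smul]; nth_rewrite 1 [this]; simp
  exact (smul_eq_zero.1 h4).resolve_left two_ne_zero

end sym
end GF

namespace GF

/-! ### von Neumann's lemma -/

lemma Ptn_anti (l : Ptn) {i j : ℕ} (h : i ≤ j) : l.part j ≤ l.part i :=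
  antitone_nat_of_succ_le (f := fun i => l.part i) l.antitone' h

lemma Ptn_ext {l l' : Ptn} (h : ∀ i, l.part i = l'.part i) : l = l' := by
  cases l; cases l'; congr; ext i; exact h i

section vn
variable {n : ℕ}

lemma filling_perm {l : Ptn} {row col : Fin n → ℕ} (h : IsFilling l row col)
    (g : Equiv.Perm (Fin n)) : IsFilling l (fun x => row (g x)) (fun x => col (g x)) := by
  refine ⟨fun x y hxy => g.injective (h.1 hxy), fun i j => ?_⟩
  rw [← h.2 i j]
  constructor
  · rintro ⟨k, h1, h2⟩; exact ⟨g k, h1, h2⟩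
  · rintro ⟨k, h1, h2⟩; exact ⟨g⁻¹ k, by simpa using h1, by simpa using h2⟩

lemma filling_lt {l : Ptn} {row col : Fin n → ℕ} (h : IsFilling l row col) (x : Fin n) :
    col x < l.part (row x) := (h.2 _ _).1 ⟨x, rfl, rfl⟩

lemma count_le_col {l : Ptn} {row r' c : Fin n → ℕ} (h : IsFilling l r' c)
    (hinj : Function.Injective (fun x => (row x, c x))) (k j : ℕ) :
    (Finset.univ.filter (fun x => row x < k ∧ c x = j)).card ≤
    (Finset.univ.filter (fun x => r' x < k ∧ c x = j)).card := by
  classical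
  by_cases hall : ∀ x, c x = j → r' x < k
  · apply Finset.card_le_card
    intro x hx
    simp only [Finset.mem_filter, Finset.mem_univ, true_and] at hx ⊢
    exact ⟨hall x hx.2, hx.2⟩
  · push Not at hall
    obtain ⟨x, hx, hk⟩ := hall
    have h1 : (Finset.univ.filter (fun x => row x < k ∧ c x = j)).card ≤ k := by
      rw [← Finset.card_range k]
      apply Finset.card_le_card_of_injOn row
      · intro y hy; simp at hy ⊢; exact hy.1
      · intro y hy z hz hyz
        simp at hy hz
        exact hinj (by simp [hyz, hy.2, hz.2])
    refine h1.trans ?_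
    have h2 : Finset.range k ⊆ (Finset.univ.filter (fun x => r' x < k ∧ c x = j)).image r' := by
      intro i hi
      simp only [Finset.mem_range] at hi
      have h3 : j < l.part i := by
        have := filling_lt h x
        rw [hx] at this
        exact this.trans_le (Ptn_anti l (hi.le.trans hk))
      obtain ⟨y, hy1, hy2⟩ := (h.2 i j).2 h3
      simp only [Finset.mem_image, Finset.mem_filter, Finset.mem_univ, true_and]
      exact ⟨y, ⟨hy1 ▸ hi, hy2⟩, hy1⟩
    calc k = (Finset.range k).card := by simp
      _ ≤ _ := Finset.card_le_card h2
      _ ≤ _ := Finset.card_image_le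

lemma count_fiber (row c : Fin n → ℕ) (k : ℕ) :
    (Finset.univ.filter (fun x => row x < k)).card =
    ∑ j ∈ Finset.univ.image c, (Finset.univ.filter (fun x => row x < k ∧ c x = j)).card := by
  classical
  rw [Finset.card_eq_sum_card_fiberwise (f := c) (t := Finset.univ.image c)]
  · apply Finset.sum_congr rfl; intro j _; rw [Finset.filter_filter]
  · intro x _; simp

lemma count_le {l : Ptn} {row r' c : Fin n → ℕ} (h : IsFilling l r' c)
    (hinj : Function.Injective (fun x => (row x, c x))) (k : ℕ) :
    (Finset.univ.filter (fun x => row x < k)).card ≤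
    (Finset.univ.filter (fun x => r' x < k)).card := by
  rw [count_fiber row c, count_fiber r' c]
  exact Finset.sum_le_sum fun j _ => count_le_col h hinj k j

lemma count_perm (row : Fin n → ℕ) (g : Equiv.Perm (Fin n)) (k : ℕ) :
    (Finset.univ.filter (fun x => row (g x) < k)).card =
    (Finset.univ.filter (fun x => row x < k)).card := by
  apply Finset.card_bij (fun x _ => g x)
  · intro x hx; simpa using hx
  · intro x _ y _ h; exact g.injective h
  · intro y hy; exact ⟨g⁻¹ y, by simpa using hy, by simp⟩

lemma part_eq_count {l : Ptn} {row col : Fin n → ℕ} (h : IsFilling l row col) (i : ℕ) :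
    l.part i = (Finset.univ.filter (fun x => row x = i)).card := by
  classical
  rw [← Finset.card_range (l.part i)]
  symm
  apply Finset.card_bij (fun x _ => col x)
  · intro x hx
    simp at hx
    simpa [← hx] using filling_lt h x
  · intro x hx y hy hxy
    simp at hx hy
    exact h.1 (by simp [hx, hy, hxy])
  · intro j hj
    obtain ⟨x, h1, h2⟩ := (h.2 i j).2 (by simpa using hj)
    exact ⟨x, by simpa using h1, h2⟩

lemma count_succ (row : Fin n → ℕ) (i : ℕ) :
    (Finset.univ.filter (fun x => row x < i + 1)).card =
    (Finset.univ.filter (fun x => row x < i)).card +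
      (Finset.univ.filter (fun x => row x = i)).card := by
  classical
  rw [← Finset.card_union_of_disjoint]
  · congr 1; ext x; simp; omega
  · rw [Finset.disjoint_filter]; intro x _ h1; omega

lemma ptn_eq_of_count {l l' : Ptn} {row col row' col' : Fin n → ℕ} (h : IsFilling l row col)
    (h' : IsFilling l' row' col')
    (hc : ∀ k, (Finset.univ.filter (fun x => row x < k)).card =
      (Finset.univ.filter (fun x => row' x < k)).card) : l = l' := by
  apply Ptn_ext
  intro i
  have h1 := count_succ row i
  have h2 := count_succ row' i
  rw [part_eq_count h, part_eq_count h']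
  have := hc i; have := hc (i+1)
  omega

lemma factor {l : Ptn} {row col : Fin n → ℕ} (h : IsFilling l row col) (g : Equiv.Perm (Fin n))
    (hinj : Function.Injective (fun x => (row x, col (g⁻¹ x)))) :
    ∃ r c : Equiv.Perm (Fin n), (∀ k, row (r k) = row k) ∧ (∀ k, col (c k) = col k) ∧
      g = r * c := by
  classical
  have h' := filling_perm h g⁻¹
  have hlt : ∀ x, col (g⁻¹ x) < l.part (row x) := by
    intro x
    by_contra hcon
    push Not at hcon
    set k := row x with hk
    set j := col (g⁻¹ x) with hj
    have e1 := count_fiber row (fun x => col (g⁻¹ x)) k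
    have e2 := count_fiber (fun x => row (g⁻¹ x)) (fun x => col (g⁻¹ x)) k
    rw [count_perm row g⁻¹ k] at e2
    have e3 := (Finset.sum_eq_sum_iff_of_le
      (fun j _ => count_le_col h' hinj k j)).1 (e1.symm.trans e2) j (by simp [hj])
    have e4 : (Finset.univ.filter (fun x => row x < k ∧ col (g⁻¹ x) = j)) ⊂
        (Finset.univ.filter (fun x => row (g⁻¹ x) < k ∧ col (g⁻¹ x) = j)) := by
      have hR : ∀ y, col (g⁻¹ y) = j → row (g⁻¹ y) < k := by
        intro y hy
        by_contra hle
        push Not at hle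
        have := filling_lt h' y
        have := Ptn_anti l hle
        omega
      rw [Finset.ssubset_iff_of_subset]
      · exact ⟨x, by simp only [Finset.mem_filter, Finset.mem_univ, true_and]; exact ⟨hR x rfl, rfl⟩,
          by simp [hk]⟩
      · intro y hy
        simp only [Finset.mem_filter, Finset.mem_univ, true_and] at hy ⊢
        exact ⟨hR y hy.2, hy.2⟩
    exact (Finset.card_lt_card e4).ne e3
  choose r hr1 hr2 using fun x => (h.2 (row x) (col (g⁻¹ x))).2 (hlt x)
  have rinj : Function.Injective r := by
    intro x y hxy
    apply hinj
    simp only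
    rw [← hr1 x, ← hr2 x, ← hr1 y, ← hr2 y, hxy]
  let R : Equiv.Perm (Fin n) := Equiv.ofBijective r (Finite.injective_iff_bijective.1 rinj)
  have hR : ∀ x, R x = r x := fun x => rfl
  refine ⟨R⁻¹, R * g, ?_, ?_, by simp⟩
  · intro k
    rw [← hr1, ← hR]; simp
  · intro k
    simp [hR, hr2]

lemma young_coeff_one {l : Ptn} {row col : Fin n → ℕ} (h : IsFilling l row col) :
    (youngSymmetrizer row col).coeff 1 = 1 := by
  classical
  unfold youngSymmetrizer rowSymmetrizer colSymmetrizer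
  rw [Finset.sum_mul, MonoidAlgebra.coeff_sum, Finsupp.finsetSum_apply]
  rw [Finset.sum_eq_single 1]
  · rw [Finset.mul_sum, MonoidAlgebra.coeff_sum, Finsupp.finsetSum_apply]
    rw [Finset.sum_eq_single 1]
    · simp [MonoidAlgebra.one_def]
    · intro c _ hc
      simp [hc]
    · simp
  · intro r hr hne
    rw [Finset.mul_sum, MonoidAlgebra.coeff_sum, Finsupp.finsetSum_apply]
    apply Finset.sum_eq_zero
    intro c hc
    simp only [Finset.mem_filter, Finset.mem_univ, true_and] at hr hc
    rw [mul_smul_comm, ← map_mul]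
    by_cases hrc : r * c = 1
    · exfalso; apply hne
      have : r = c⁻¹ := eq_inv_of_mul_eq_one_left hrc
      ext1 x
      apply h.1
      have h2 : col (r x) = col x := by rw [this, ← hc]; simp
      simp [hr, h2]
    · simp [Finsupp.single_apply, hrc]
  · simp

lemma determined {l : Ptn} {row col : Fin n → ℕ} (h : IsFilling l row col)
    (g : Equiv.Perm (Fin n)) : ∃ s : ℂ, ∀ X : MonoidAlgebra ℂ (Equiv.Perm (Fin n)),
    (∀ w : Equiv.Perm (Fin n), (∀ k, row (w k) = row k) → dl w * X = X) →
    (∀ w : Equiv.Perm (Fin n), (∀ k, col (w k) = col k) →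
      X * dl w = ((Equiv.Perm.sign w : ℤ) : ℂ) • X) → X.coeff g = s * X.coeff 1 := by
  by_cases hinj : Function.Injective (fun x => (row x, col (g⁻¹ x)))
  · obtain ⟨r, c, hr, hc, rfl⟩ := factor h g hinj
    refine ⟨((Equiv.Perm.sign c : ℤ) : ℂ), fun X h1 h2 => ?_⟩
    have e1 := congrArg (fun Y => MonoidAlgebra.coeff Y (r * c)) (h1 r hr)
    have e2 := congrArg (fun Y => MonoidAlgebra.coeff Y c) (h2 c hc)
    simp only [coeff_dl_mul, coeff_mul_dl, mul_inv_cancel, inv_mul_cancel_left,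
      MonoidAlgebra.coeff_smul, Finsupp.smul_apply, smul_eq_mul] at e1 e2
    have hs : ((Equiv.Perm.sign c : ℤ) : ℂ) * ((Equiv.Perm.sign c : ℤ) : ℂ) = 1 := by
      rcases Int.units_eq_one_or (Equiv.Perm.sign c) with h | h <;> simp [h]
    rw [← e1, e2, ← mul_assoc, hs, one_mul]
  · refine ⟨0, fun X h1 h2 => ?_⟩
    simp only [Function.Injective, not_forall] at hinj
    obtain ⟨x, y, hxy, hne⟩ := hinj
    simp only [Prod.mk.injEq] at hxy
    have h3 : Equiv.swap x y * g = g * Equiv.swap (g⁻¹ x) (g⁻¹ y) := by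
      rw [Equiv.mul_swap_eq_swap_mul]; simp
    have hne' : g⁻¹ x ≠ g⁻¹ y := fun h => hne (g⁻¹.injective h)
    have e1 := congrArg (fun Y => MonoidAlgebra.coeff Y g) (h1 _ (swap_pres hxy.1))
    have e2 := congrArg (fun Y => MonoidAlgebra.coeff Y g) (h2 _ (swap_pres hxy.2))
    simp only [coeff_dl_mul, coeff_mul_dl, Equiv.swap_inv, Equiv.Perm.sign_swap hne', ← h3] at e1 e2
    rw [e1] at e2
    simp at e2
    rw [zero_mul]
    exact self_eq_neg.1 e2

end vn
end GF

namespace GF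

/-! ### Young symmetrizers -/
section young
variable {n : ℕ}

local notation "𝔸" n => MonoidAlgebra ℂ (Equiv.Perm (Fin n))

lemma exists_dl_of_ne {G : Type} [Group G] {x y : MonoidAlgebra ℂ G}
    (h : ∀ g, x * dl g * y = 0) (z : MonoidAlgebra ℂ G) : x * z * y = 0 := by
  induction z using ga_ind with
  | h1 g => exact h g
  | h2 a b ha hb => rw [mul_add, add_mul, ha, hb, add_zero]
  | h3 c a ha => rw [mul_smul_comm, smul_mul_assoc, ha, smul_zero]

lemma p_unique {l : Ptn} {row col : Fin n → ℕ} (h : IsFilling l row col)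
    (X : 𝔸 n)
    (h1 : ∀ w : Equiv.Perm (Fin n), (∀ k, row (w k) = row k) → dl w * X = X)
    (h2 : ∀ w : Equiv.Perm (Fin n), (∀ k, col (w k) = col k) →
      X * dl w = ((Equiv.Perm.sign w : ℤ) : ℂ) • X) :
    X = X.coeff 1 • youngSymmetrizer row col := by
  ext g
  obtain ⟨s, hs⟩ := determined h g
  rw [hs X h1 h2, MonoidAlgebra.coeff_smul, Finsupp.smul_apply,
    hs (youngSymmetrizer row col), young_coeff_one h]
  · simp [mul_comm]
  · intro w hw
    rw [youngSymmetrizer, ← mul_assoc, row_dl_mul hw]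
  · intro w hw
    rw [youngSymmetrizer, mul_assoc, col_mul_dl hw, mul_smul_comm]

lemma row_z_col {l : Ptn} {row col : Fin n → ℕ} (h : IsFilling l row col) (z : 𝔸 n) :
    rowSymmetrizer row * z * colSymmetrizer col =
      (rowSymmetrizer row * z * colSymmetrizer col).coeff 1 • youngSymmetrizer row col := by
  apply p_unique h
  · intro w hw
    rw [← mul_assoc, ← mul_assoc, row_dl_mul hw]
  · intro w hw
    rw [mul_assoc, col_mul_dl hw, mul_smul_comm]

lemma p_z_p {l : Ptn} {row col : Fin n → ℕ} (h : IsFilling l row col) (z : 𝔸 n) :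
    youngSymmetrizer row col * z * youngSymmetrizer row col =
      (youngSymmetrizer row col * z * youngSymmetrizer row col).coeff 1 •
        youngSymmetrizer row col := by
  have := row_z_col h (colSymmetrizer col * z * rowSymmetrizer row)
  simpa only [youngSymmetrizer, mul_assoc] using this

lemma row_z_col_zero_of {row col : Fin n → ℕ}
    (h : ∀ g : Equiv.Perm (Fin n), ¬ Function.Injective (fun x => (row x, col (g x)))) (z : 𝔸 n) :
    rowSymmetrizer row * z * colSymmetrizer col = 0 :=
  exists_dl_of_ne (fun g => row_dl_col_eq_zero (h g⁻¹)) z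

lemma col_z_row_zero_of {row col : Fin n → ℕ}
    (h : ∀ g : Equiv.Perm (Fin n), ¬ Function.Injective (fun x => (row x, col (g x)))) (z : 𝔸 n) :
    colSymmetrizer col * z * rowSymmetrizer row = 0 := by
  have := congrArg iota (row_z_col_zero_of h (iota z))
  simpa [iota_mul, iota_iota, iota_row, iota_col, mul_assoc] using this

lemma p_orth {l l' : Ptn} {row col row' col' : Fin n → ℕ} (h : IsFilling l row col)
    (h' : IsFilling l' row' col') (hne : l ≠ l') (z : 𝔸 n) :
    youngSymmetrizer row col * z * youngSymmetrizer row' col' = 0 := by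
  by_cases c1 : ∃ g : Equiv.Perm (Fin n), Function.Injective (fun x => (row x, col' (g x)))
  · by_cases c2 : ∃ g : Equiv.Perm (Fin n), Function.Injective (fun x => (row' x, col (g x)))
    · exfalso
      obtain ⟨g, hg⟩ := c1
      obtain ⟨g', hg'⟩ := c2
      apply hne
      apply ptn_eq_of_count h h'
      intro k
      apply le_antisymm
      · have := count_le (filling_perm h' g) hg k
        rwa [count_perm] at this
      · have := count_le (filling_perm h g') hg' k
        rwa [count_perm] at this
    · push Not at c2
      have := col_z_row_zero_of c2 z
      calc _ = rowSymmetrizer row * (colSymmetrizer col * z * rowSymmetrizer row') *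
            colSymmetrizer col' := by simp only [youngSymmetrizer, mul_assoc]
        _ = 0 := by rw [this]; simp
  · push Not at c1
    have := row_z_col_zero_of c1 (colSymmetrizer col * z * rowSymmetrizer row')
    simpa only [youngSymmetrizer, mul_assoc] using this

lemma p_ne_zero {l : Ptn} {row col : Fin n → ℕ} (h : IsFilling l row col) :
    youngSymmetrizer row col ≠ 0 := by
  intro h0
  have := young_coeff_one h
  rw [h0] at this
  simp at this

/-- The scalar with `p * p = kap • p`. -/
noncomputable def kap (row col : Fin n → ℕ) : ℂ :=
  (youngSymmetrizer row col * youngSymmetrizer row col).coeff 1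

lemma p_sq {l : Ptn} {row col : Fin n → ℕ} (h : IsFilling l row col) :
    youngSymmetrizer row col * youngSymmetrizer row col =
      kap row col • youngSymmetrizer row col := by
  have := p_z_p h 1
  simpa [kap] using this

lemma kap_ne {l : Ptn} {row col : Fin n → ℕ} (h : IsFilling l row col) : kap row col ≠ 0 := by
  intro h0
  apply p_ne_zero h
  apply semiprime
  intro z
  rw [p_z_p h, mul_assoc, coeff_one_mul_comm, mul_assoc, p_sq h, h0]
  simp

/-- The opposite Young symmetrizer. -/
noncomputable def qYoung (row col : Fin n → ℕ) : 𝔸 n := colSymmetrizer col * rowSymmetrizer row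

lemma iota_p (row col : Fin n → ℕ) : iota (youngSymmetrizer row col) = qYoung row col := by
  simp [youngSymmetrizer, qYoung, iota_mul, iota_row, iota_col]

lemma iota_q (row col : Fin n → ℕ) : iota (qYoung row col) = youngSymmetrizer row col := by
  rw [← iota_p, iota_iota]

lemma q_sq {l : Ptn} {row col : Fin n → ℕ} (h : IsFilling l row col) :
    qYoung row col * qYoung row col = kap row col • qYoung row col := by
  rw [← iota_p, ← iota_mul, p_sq h, map_smul]

lemma sum_pzp {l : Ptn} {row col : Fin n → ℕ} (h : IsFilling l row col) :
    ∑ z : Equiv.Perm (Fin n), (youngSymmetrizer row col * dl z * youngSymmetrizer row col).coeff 1 •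
      dl z = kap row col • qYoung row col := by
  have : ∀ z : Equiv.Perm (Fin n),
      (youngSymmetrizer row col * dl z * youngSymmetrizer row col).coeff 1 =
        (kap row col • qYoung row col).coeff z := by
    intro z
    rw [mul_assoc, coeff_one_mul_comm, mul_assoc, p_sq h, coeff_dl_mul, ← iota_p, ← map_smul,
      coeff_iota, mul_one]
  simp only [this]
  rw [← ga_sum]

lemma mem_specht {row col : Fin n → ℕ} {v : 𝔸 n} :
    v ∈ spechtModule row col ↔ ∃ u, v = u * youngSymmetrizer row col := by
  constructor
  · intro hv
    induction hv using Submodule.span_induction with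
    | mem y hy => exact hy
    | zero => exact ⟨0, by simp⟩
    | add y z _ _ hy hz =>
      obtain ⟨a, rfl⟩ := hy; obtain ⟨b, rfl⟩ := hz
      exact ⟨a + b, by rw [add_mul]⟩
    | smul c y _ hy => obtain ⟨a, rfl⟩ := hy; exact ⟨c • a, by rw [smul_mul_assoc]⟩
  · rintro ⟨u, rfl⟩; exact Submodule.subset_span ⟨u, rfl⟩

/-- absorbing a row symmetrizer -/
lemma row_row {r row : Fin n → ℕ} (h : ∀ w : Equiv.Perm (Fin n), (∀ k, r (w k) = r k) →
    ∀ k, row (w k) = row k) : ∃ N : ℕ, N ≠ 0 ∧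
    rowSymmetrizer r * rowSymmetrizer row = (N : ℂ) • rowSymmetrizer row := by
  classical
  refine ⟨(Finset.univ.filter (fun w : Equiv.Perm (Fin n) => ∀ k, r (w k) = r k)).card, ?_, ?_⟩
  · apply Finset.card_ne_zero_of_mem (a := 1); simp
  · conv_lhs => rw [rowSymmetrizer, Finset.sum_mul]
    rw [Finset.sum_congr rfl (g := fun _ => rowSymmetrizer row)]
    · simp [Nat.cast_smul_eq_nsmul]
    · intro w hw
      exact row_dl_mul (h w (by simpa using hw))

lemma col_col (col : Fin n → ℕ) : ∃ N : ℕ, N ≠ 0 ∧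
    colSymmetrizer col * colSymmetrizer col = (N : ℂ) • colSymmetrizer col := by
  classical
  refine ⟨(Finset.univ.filter (fun w : Equiv.Perm (Fin n) => ∀ k, col (w k) = col k)).card, ?_, ?_⟩
  · apply Finset.card_ne_zero_of_mem (a := 1); simp
  · conv_lhs => rw [colSymmetrizer.eq_def col, Finset.sum_mul]
    rw [Finset.sum_congr rfl (g := fun _ => colSymmetrizer col)]
    · simp [Nat.cast_smul_eq_nsmul, colSymmetrizer]
    · intro w hw
      have := col_dl_mul (col := col) (w := w) (by simpa using hw)
      rw [dl, colSymmetrizer] at this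
      rw [smul_mul_assoc, this, smul_smul]
      have hs : ((Equiv.Perm.sign w : ℤ) : ℂ) * ((Equiv.Perm.sign w : ℤ) : ℂ) = 1 := by
        rcases Int.units_eq_one_or (Equiv.Perm.sign w) with h | h <;> simp [h]
      rw [hs, one_smul, colSymmetrizer]

end young

/-! ### Families of quasi-idempotents -/

/-- pairwise inequivalent primitive quasi-idempotents -/
structure IdemFam {G : Type} [Group G] {ι : Type} (p : ι → MonoidAlgebra ℂ G) : Prop where
  orth : ∀ i j z, i ≠ j → p i * z * p j = 0
  prim : ∀ i z, ∃ c : ℂ, p i * z * p i = c • p i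
  sq : ∀ i, ∃ κ : ℂ, κ ≠ 0 ∧ p i * p i = κ • p i

lemma idemFam_young {n : ℕ} (row col : {l : Ptn // l.size = n} → Fin n → ℕ)
    (hf : ∀ l : {l : Ptn // l.size = n}, IsFilling l.1 (row l) (col l)) :
    IdemFam (fun l => youngSymmetrizer (row l) (col l)) where
  orth i j z hij := p_orth (hf i) (hf j) (fun h => hij (Subtype.ext h)) z
  prim i z := ⟨_, p_z_p (hf i) z⟩
  sq i := ⟨_, kap_ne (hf i), p_sq (hf i)⟩

lemma inj_lemma {G : Type} [Group G] [Finite G] {ι K : Type} [Fintype K]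
    {p : ι → MonoidAlgebra ℂ G} (hp : IdemFam p) {B : Type} [Ring B] [Algebra ℂ B]
    (s : MonoidAlgebra ℂ G →ₐ[ℂ] B) (t : K → ι) (x : K → B)
    (hx : ∀ k, ∃ y, x k = s (p (t k)) * y)
    (li : ∀ (i : ι) (c : K → ℂ), (∀ k, t k ≠ i → c k = 0) → ∑ k, c k • x k = 0 → ∀ k, c k = 0)
    (v : K → MonoidAlgebra ℂ G) (hv : ∀ k, ∃ u, v k = u * p (t k))
    (h0 : ∀ k z, s (p (t k) * z) * ∑ k, s (v k) * x k = 0) : ∀ k, v k = 0 := by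
  classical
  intro k0
  have key : ∀ z, p (t k0) * z * v k0 = 0 := by
    intro z
    have h1 : ∀ k, ∃ c : ℂ, p (t k0) * z * v k = c • p (t k0) ∧ (t k ≠ t k0 → c = 0) := by
      intro k
      obtain ⟨u, hu⟩ := hv k
      by_cases hk : t k = t k0
      · obtain ⟨c, hc⟩ := hp.prim (t k0) (z * u)
        exact ⟨c, by rw [hu, hk, ← hc]; simp only [mul_assoc], fun h => absurd hk h⟩
      · refine ⟨0, ?_, fun _ => rfl⟩
        have := hp.orth (t k0) (t k) (z * u) (Ne.symm hk)
        rw [hu, zero_smul, ← this]; simp only [mul_assoc]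
    choose c hc1 hc2 using h1
    obtain ⟨κ, hκ, hsq⟩ := hp.sq (t k0)
    have h2 : ∀ k, s (p (t k0) * z) * (s (v k) * x k) = κ • (c k • x k) := by
      intro k
      rw [← mul_assoc, ← map_mul, hc1, map_smul, smul_mul_assoc]
      by_cases hk : t k = t k0
      · obtain ⟨y, hy⟩ := hx k
        rw [hy, ← mul_assoc, hk, ← map_mul, hsq, map_smul, smul_mul_assoc, smul_comm]
      · rw [hc2 k hk]; simp
    have h3 := h0 k0 z
    rw [Finset.mul_sum, Finset.sum_congr rfl (fun k _ => h2 k), ← Finset.smul_sum] at h3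
    have h4 := (smul_eq_zero.1 h3).resolve_left hκ
    have h5 := li (t k0) c hc2 h4 k0
    rw [hc1, h5, zero_smul]
  apply semiprime
  intro z
  obtain ⟨u, hu⟩ := hv k0
  have := key z
  conv_lhs => rw [show v k0 * z * v k0 = u * (p (t k0) * z * v k0) by
    conv_lhs => rw [mul_assoc]; arg 1; rw [hu]
    simp only [mul_assoc]]
  rw [this, mul_zero]

end GF

namespace GF

/-! ### Embeddings of symmetric groups and the Pieri nonvanishing -/
section emb
variable {n d : ℕ}

local notation "𝔸" n => MonoidAlgebra ℂ (Equiv.Perm (Fin n))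

/-- Extension of permutations along an embedding. -/
noncomputable def vE (σ : Fin d ↪ Fin n) : Equiv.Perm (Fin d) →* Equiv.Perm (Fin n) :=
  Equiv.Perm.viaEmbeddingHom σ

lemma vE_apply (σ : Fin d ↪ Fin n) (g : Equiv.Perm (Fin d)) (k : Fin d) :
    vE σ g (σ k) = σ (g k) := Equiv.Perm.viaEmbedding_apply _ _ _

lemma vE_apply_of (σ : Fin d ↪ Fin n) (g : Equiv.Perm (Fin d)) {x : Fin n}
    (hx : x ∉ Set.range σ) : vE σ g x = x := Equiv.Perm.viaEmbedding_apply_of_notMem _ _ _ hx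

lemma vE_sign (σ : Fin d ↪ Fin n) (g : Equiv.Perm (Fin d)) :
    Equiv.Perm.sign (vE σ g) = Equiv.Perm.sign g := by
  rw [vE, Equiv.Perm.viaEmbeddingHom_apply, Equiv.Perm.viaEmbedding]
  convert Equiv.Perm.sign_extendDomain _ _

/-- The induced algebra map. -/
noncomputable def sig (σ : Fin d ↪ Fin n) : (𝔸 d) →ₐ[ℂ] (𝔸 n) :=
  MonoidAlgebra.mapDomainAlgHom ℂ ℂ (vE σ)

lemma sig_dl (σ : Fin d ↪ Fin n) (g : Equiv.Perm (Fin d)) : sig σ (dl g) = dl (vE σ g) := by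
  simp [sig, dl]

/-- The sum of the permutations fixing the image of `σ` pointwise. -/
noncomputable def fixSum (σ : Fin d ↪ Fin n) : 𝔸 n :=
  ∑ w ∈ Finset.univ.filter (fun w : Equiv.Perm (Fin n) => ∀ k, w (σ k) = σ k), dl w

lemma fix_comm {σ : Fin d ↪ Fin n} {w : Equiv.Perm (Fin n)} (hw : ∀ k, w (σ k) = σ k)
    (g : Equiv.Perm (Fin d)) : w * vE σ g = vE σ g * w := by
  ext1 x
  by_cases hx : x ∈ Set.range σ
  · obtain ⟨k, rfl⟩ := hx
    simp [vE_apply, hw]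
  · have : w x ∉ Set.range σ := by
      rintro ⟨k, hk⟩
      rw [← hw k] at hk
      exact hx ⟨k, w.injective hk⟩
    simp [vE_apply_of, hx, this]

lemma fixSum_comm (σ : Fin d ↪ Fin n) (z : 𝔸 d) : fixSum σ * sig σ z = sig σ z * fixSum σ := by
  induction z using ga_ind with
  | h1 g =>
    rw [sig_dl, fixSum, Finset.sum_mul, Finset.mul_sum]
    apply Finset.sum_congr rfl
    intro w hw
    rw [← dl_mul, ← dl_mul, fix_comm (by simpa using hw)]
  | h2 a b ha hb => simp [mul_add, add_mul, ha, hb]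
  | h3 c a ha => simp [ha]

lemma fixSum_dl {σ : Fin d ↪ Fin n} {w : Equiv.Perm (Fin n)} (hw : ∀ k, w (σ k) = σ k) :
    fixSum σ * dl w = fixSum σ := by
  rw [fixSum, Finset.sum_mul]
  refine Finset.sum_bij' (fun g _ => g * w) (fun g _ => g * w⁻¹) ?_ ?_ ?_ ?_ ?_
  · intro g hg; simp at hg ⊢; intro k; rw [hw, hg]
  · intro g hg; simp at hg ⊢; intro k
    have : w.symm (σ k) = σ k := by rw [Equiv.symm_apply_eq, hw]
    rw [this, hg]
  · intro g _; simp
  · intro g _; simp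
  · intro g _; rw [dl_mul]

lemma iota_fixSum (σ : Fin d ↪ Fin n) : iota (fixSum σ) = fixSum σ := by
  have hinv : ∀ w : Equiv.Perm (Fin n), (∀ k, w (σ k) = σ k) → ∀ k, w⁻¹ (σ k) = σ k := by
    intro w hw k; rw [Equiv.Perm.inv_eq_iff_eq, hw]
  rw [fixSum, map_sum]
  refine Finset.sum_bij' (fun g _ => g⁻¹) (fun g _ => g⁻¹) ?_ ?_ ?_ ?_ ?_
  · intro g hg; simp only [Finset.mem_filter, Finset.mem_univ, true_and] at hg ⊢; exact hinv g hg
  · intro g hg; simp only [Finset.mem_filter, Finset.mem_univ, true_and] at hg ⊢; exact hinv g hg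
  · intro g _; simp
  · intro g _; simp
  · intro g _; rw [iota_dl]

lemma iota_sig (σ : Fin d ↪ Fin n) (z : 𝔸 d) : iota (sig σ z) = sig σ (iota z) := by
  induction z using ga_ind with
  | h1 g => rw [sig_dl, iota_dl, iota_dl, sig_dl, map_inv]
  | h2 a b ha hb => simp [ha, hb]
  | h3 c a ha => simp [ha]

variable {l m : Ptn} {row col : Fin n → ℕ} {row' col' : Fin d → ℕ} {σ : Fin d ↪ Fin n}

lemma exists_compat (hl : IsFilling l row col) (hm : IsFilling m row' col')
    (hle : ∀ i, m.part i ≤ l.part i) :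
    ∃ σ : Fin d ↪ Fin n, (∀ k, row (σ k) = row' k) ∧ (∀ k, col (σ k) = col' k) := by
  choose s h1 h2 using fun k => (hl.2 (row' k) (col' k)).2 ((filling_lt hm k).trans_le (hle _))
  exact ⟨⟨s, fun x y hxy => hm.1 (by simp only [← h1, ← h2, hxy])⟩, h1, h2⟩

lemma vE_pres {f : Fin n → ℕ} {f' : Fin d → ℕ} (h : ∀ k, f (σ k) = f' k) {g : Equiv.Perm (Fin d)}
    (hg : ∀ k, f' (g k) = f' k) (x : Fin n) : f (vE σ g x) = f x := by
  by_cases hx : x ∈ Set.range σ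
  · obtain ⟨k, rfl⟩ := hx
    rw [vE_apply, h, h, hg]
  · rw [vE_apply_of σ g hx]

lemma sig_row_mul (h : ∀ k, row (σ k) = row' k) : ∃ N : ℕ, N ≠ 0 ∧
    sig σ (rowSymmetrizer row') * rowSymmetrizer row = (N : ℂ) • rowSymmetrizer row := by
  classical
  refine ⟨(Finset.univ.filter (fun w : Equiv.Perm (Fin d) => ∀ k, row' (w k) = row' k)).card, ?_, ?_⟩
  · apply Finset.card_ne_zero_of_mem (a := 1); simp
  · conv_lhs => rw [rowSymmetrizer.eq_def row', map_sum, Finset.sum_mul]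
    rw [Finset.sum_congr rfl (g := fun _ => rowSymmetrizer row)]
    · simp [Nat.cast_smul_eq_nsmul]
    · intro w hw
      have := sig_dl σ w
      rw [dl] at this
      rw [this]
      exact row_dl_mul (vE_pres h (by simpa using hw))

lemma col_mul_sig (h : ∀ k, col (σ k) = col' k) : ∃ N : ℕ, N ≠ 0 ∧
    colSymmetrizer col * sig σ (colSymmetrizer col') = (N : ℂ) • colSymmetrizer col := by
  classical
  refine ⟨(Finset.univ.filter (fun w : Equiv.Perm (Fin d) => ∀ k, col' (w k) = col' k)).card, ?_, ?_⟩
  · apply Finset.card_ne_zero_of_mem (a := 1); simp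
  · conv_lhs => rw [colSymmetrizer.eq_def col', map_sum, Finset.mul_sum]
    rw [Finset.sum_congr rfl (g := fun _ => colSymmetrizer col)]
    · simp [Nat.cast_smul_eq_nsmul]
    · intro w hw
      have := sig_dl σ w
      rw [dl] at this
      rw [map_smul, this, mul_smul_comm, col_mul_dl (vE_pres h (by simpa using hw)), smul_smul,
        vE_sign]
      have hs : ((Equiv.Perm.sign w : ℤ) : ℂ) * ((Equiv.Perm.sign w : ℤ) : ℂ) = 1 := by
        rcases Int.units_eq_one_or (Equiv.Perm.sign w) with h | h <;> simp [h]
      rw [hs, one_smul]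

lemma strip_unique (hl : IsFilling l row col) (hm : IsFilling m row' col')
    (hs : ∀ i, l.part (i + 1) ≤ m.part i)
    (h1 : ∀ k, row (σ k) = row' k) (h2 : ∀ k, col (σ k) = col' k)
    {x y : Fin n} (hx : x ∉ Set.range σ) (hy : y ∉ Set.range σ) (hxy : col x = col y) : x = y := by
  have key : ∀ x y : Fin n, x ∉ Set.range σ → col x = col y → ¬ row x < row y := by
    intro x y hx hxy hlt
    apply hx
    have h3 : col x < m.part (row x) := by
      rw [hxy]
      exact (filling_lt hl y).trans_le ((Ptn_anti l hlt).trans (hs _))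
    obtain ⟨k, hk1, hk2⟩ := (hm.2 _ _).2 h3
    exact ⟨k, hl.1 (by simp [h1, h2, hk1, hk2])⟩
  have := key x y hx hxy
  have := key y x hy hxy.symm
  exact hl.1 (by simp only [Prod.mk.injEq]; exact ⟨by omega, hxy⟩)

lemma trip_eq_one (hl : IsFilling l row col) (hm : IsFilling m row' col')
    (hs : ∀ i, l.part (i + 1) ≤ m.part i)
    (h1 : ∀ k, row (σ k) = row' k) (h2 : ∀ k, col (σ k) = col' k)
    {s p q : Equiv.Perm (Fin n)} (hfs : ∀ k, s (σ k) = σ k) (hp : ∀ x, row (p x) = row x)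
    (hq : ∀ x, col (q x) = col x) (hspq : s * p = q) : q = 1 := by
  have key : ∀ x, q x ≠ x → q x ∉ Set.range σ := by
    rintro x hne ⟨k, hk⟩
    apply hne
    have : p x = q x := by
      apply s.injective
      rw [← Equiv.Perm.mul_apply, hspq, ← hk, hfs]
    apply hl.1
    simp only [Prod.mk.injEq]
    exact ⟨by rw [← this, hp], hq x⟩
  ext1 x
  by_contra hne
  have hne' : q (q x) ≠ q x := fun h => hne (q.injective h)
  exact hne' (strip_unique hl hm hs h1 h2 (key _ hne') (key _ hne) (hq _))

lemma fix_p_coeff (hl : IsFilling l row col) (hm : IsFilling m row' col')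
    (hs : ∀ i, l.part (i + 1) ≤ m.part i)
    (h1 : ∀ k, row (σ k) = row' k) (h2 : ∀ k, col (σ k) = col' k) :
    (fixSum σ * youngSymmetrizer row col).coeff 1 ≠ 0 := by
  classical
  have e1 : (fixSum σ * youngSymmetrizer row col).coeff 1 =
      (fixSum σ * rowSymmetrizer row).coeff 1 := by
    rw [youngSymmetrizer, ← mul_assoc, colSymmetrizer, Finset.mul_sum, MonoidAlgebra.coeff_sum,
      Finsupp.finsetSum_apply, Finset.sum_eq_single 1]
    · have := mul_one (fixSum σ * rowSymmetrizer row)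
      rw [← dl_one, dl] at this
      simp
    · intro q hq hne
      simp only [Finset.mem_filter, Finset.mem_univ, true_and] at hq
      rw [mul_smul_comm, MonoidAlgebra.coeff_smul, Finsupp.smul_apply]
      have e2 := coeff_mul_dl q 1 (fixSum σ * rowSymmetrizer row)
      rw [dl] at e2
      rw [e2]
      have : (fixSum σ * rowSymmetrizer row).coeff (1 * q⁻¹) = 0 := by
        rw [fixSum, rowSymmetrizer, Finset.sum_mul, MonoidAlgebra.coeff_sum,
          Finsupp.finsetSum_apply]
        apply Finset.sum_eq_zero
        intro s hs'
        rw [Finset.mul_sum, MonoidAlgebra.coeff_sum, Finsupp.finsetSum_apply]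
        apply Finset.sum_eq_zero
        intro p hp
        simp only [Finset.mem_filter, Finset.mem_univ, true_and] at hs' hp
        rw [← dl, ← dl_mul, coeff_dl, if_neg]
        intro hspq
        have hq' : ∀ x, col (q⁻¹ x) = col x := fun x => by
          rw [← hq]; simp
        have := trip_eq_one hl hm hs h1 h2 hs' hp hq' (by rw [hspq, one_mul])
        exact hne (inv_eq_one.1 this)
      rw [this, smul_zero]
    · simp
  rw [e1]
  have e3 : (fixSum σ * rowSymmetrizer row).coeff 1 =
      ((∑ s ∈ Finset.univ.filter (fun w : Equiv.Perm (Fin n) => ∀ k, w (σ k) = σ k),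
        ∑ p ∈ Finset.univ.filter (fun w : Equiv.Perm (Fin n) => ∀ k, row (w k) = row k),
          if s * p = 1 then 1 else 0 : ℕ) : ℂ) := by
    rw [fixSum, rowSymmetrizer, Finset.sum_mul, MonoidAlgebra.coeff_sum,
          Finsupp.finsetSum_apply]
    push_cast
    apply Finset.sum_congr rfl
    intro s _
    rw [Finset.mul_sum, MonoidAlgebra.coeff_sum, Finsupp.finsetSum_apply]
    apply Finset.sum_congr rfl
    intro p _
    rw [← dl, ← dl_mul, coeff_dl]
  rw [e3, Nat.cast_ne_zero]
  apply ne_of_gt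
  apply Finset.sum_pos' (fun _ _ => Nat.zero_le _)
  refine ⟨1, by simp, ?_⟩
  apply Finset.sum_pos' (fun _ _ => Nat.zero_le _)
  exact ⟨1, by simp, by simp⟩

lemma q_fix_p_ne (hl : IsFilling l row col) (hm : IsFilling m row' col')
    (hs : ∀ i, l.part (i + 1) ≤ m.part i)
    (h1 : ∀ k, row (σ k) = row' k) (h2 : ∀ k, col (σ k) = col' k) :
    sig σ (qYoung row' col') * fixSum σ * youngSymmetrizer row col ≠ 0 := by
  intro h0
  obtain ⟨N, hN, hrow⟩ := sig_row_mul h1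
  obtain ⟨M, hM, hcol⟩ := col_mul_sig h2
  have e1 : sig σ (qYoung row' col') * fixSum σ * youngSymmetrizer row col =
      (N : ℂ) • (sig σ (colSymmetrizer col') * (fixSum σ * youngSymmetrizer row col)) := by
    rw [qYoung, map_mul, mul_assoc (sig σ _), ← fixSum_comm, youngSymmetrizer]
    simp only [mul_assoc]
    rw [← mul_assoc (sig σ (rowSymmetrizer row')), hrow]
    simp
  rw [e1] at h0
  have h3 := (smul_eq_zero.1 h0).resolve_left (by exact_mod_cast hN)
  have h4 : (sig σ (colSymmetrizer col') * (fixSum σ * youngSymmetrizer row col)).coeff 1 =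
      (M : ℂ) * (fixSum σ * youngSymmetrizer row col).coeff 1 := by
    rw [coeff_one_mul_comm, youngSymmetrizer]
    simp only [mul_assoc]
    rw [hcol]
    simp
  rw [h3] at h4
  have := fix_p_coeff hl hm hs h1 h2
  have hM' : (M : ℂ) ≠ 0 := by exact_mod_cast hM
  exact mul_ne_zero hM' this (by simpa using h4.symm)

lemma L2a_aux (hl : IsFilling l row col) (hm : IsFilling m row' col')
    (hs : ∀ i, l.part (i + 1) ≤ m.part i)
    (h1 : ∀ k, row (σ k) = row' k) (h2 : ∀ k, col (σ k) = col' k) :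
    ∃ y, sig σ (youngSymmetrizer row' col') * y * youngSymmetrizer row col ≠ 0 := by
  refine ⟨sig σ (rowSymmetrizer row') * fixSum σ, fun h0 => ?_⟩
  apply q_fix_p_ne hl hm hs h1 h2
  have h3 : kap row' col' • (sig σ (qYoung row' col') * fixSum σ * youngSymmetrizer row col) = 0 := by
    rw [← smul_mul_assoc, ← smul_mul_assoc, ← map_smul, ← q_sq hm]
    have : sig σ (qYoung row' col' * qYoung row' col') = sig σ (colSymmetrizer col') *
      (sig σ (youngSymmetrizer row' col') * sig σ (rowSymmetrizer row')) := by
      rw [← map_mul, ← map_mul]; simp only [qYoung, youngSymmetrizer, mul_assoc]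
    rw [this]
    simp only [mul_assoc] at h0 ⊢
    rw [h0, mul_zero]
  exact (smul_eq_zero.1 h3).resolve_left (kap_ne hm)

lemma L2b_aux (hl : IsFilling l row col) (hm : IsFilling m row' col')
    (hs : ∀ i, l.part (i + 1) ≤ m.part i)
    (h1 : ∀ k, row (σ k) = row' k) (h2 : ∀ k, col (σ k) = col' k) :
    ∃ y, youngSymmetrizer row col * y * fixSum σ * sig σ (youngSymmetrizer row' col') ≠ 0 := by
  refine ⟨rowSymmetrizer row, fun h0 => ?_⟩
  apply q_fix_p_ne hl hm hs h1 h2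
  have h3 : kap row col • (qYoung row col * fixSum σ * sig σ (youngSymmetrizer row' col')) = 0 := by
    rw [← smul_mul_assoc, ← smul_mul_assoc, ← q_sq hl]
    have : qYoung row col * qYoung row col = colSymmetrizer col *
      (youngSymmetrizer row col * rowSymmetrizer row) := by
      simp only [qYoung, youngSymmetrizer, mul_assoc]
    rw [this]
    simp only [mul_assoc] at h0 ⊢
    rw [h0, mul_zero]
  have h4 := (smul_eq_zero.1 h3).resolve_left (kap_ne hl)
  have h5 := congrArg iota h4
  simpa [iota_mul, iota_fixSum, iota_sig, iota_p, iota_q, mul_assoc] using h5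

lemma L2c_aux (hm : IsFilling m row' col') {B : 𝔸 n}
    (h : B * fixSum σ * sig σ (youngSymmetrizer row' col') ≠ 0) :
    B * sig σ (rowSymmetrizer row') * fixSum σ * sig σ (qYoung row' col') ≠ 0 := by
  intro h0
  apply h
  have h3 : kap row' col' • (B * fixSum σ * sig σ (youngSymmetrizer row' col')) = 0 := by
    rw [← mul_smul_comm, ← map_smul, ← p_sq hm]
    have : youngSymmetrizer row' col' * youngSymmetrizer row' col' =
      rowSymmetrizer row' * (qYoung row' col' * colSymmetrizer col') := by
      simp only [qYoung, youngSymmetrizer, mul_assoc]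
    rw [this, map_mul, map_mul, mul_assoc B, ← mul_assoc (fixSum σ), fixSum_comm]
    simp only [← mul_assoc] at h0 ⊢
    rw [h0, zero_mul]
  exact (smul_eq_zero.1 h3).resolve_left (kap_ne hm)

/-- transport between embeddings -/
lemma exists_perm_emb (σ τ : Fin d ↪ Fin n) : ∃ w : Equiv.Perm (Fin n), ∀ k, w (σ k) = τ k := by
  classical
  let e : {x // x ∈ Set.range σ} ≃ {x // x ∈ Set.range τ} :=
    (Equiv.ofInjective σ σ.injective).symm.trans (Equiv.ofInjective τ τ.injective)
  refine ⟨e.extendSubtype, fun k => ?_⟩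
  rw [Equiv.extendSubtype_apply_of_mem _ _ ⟨k, rfl⟩]
  have : (⟨σ k, ⟨k, rfl⟩⟩ : {x // x ∈ Set.range σ}) = Equiv.ofInjective σ σ.injective k := rfl
  rw [this]
  simp [e]

lemma dl_mul_inv {G : Type} [Group G] (w : G) : dl w * dl w⁻¹ = 1 := by
  rw [← dl_mul, mul_inv_cancel, dl_one]
lemma dl_inv_mul {G : Type} [Group G] (w : G) : dl w⁻¹ * dl w = 1 := by
  rw [← dl_mul, inv_mul_cancel, dl_one]

lemma sig_conj {σ τ : Fin d ↪ Fin n} {w : Equiv.Perm (Fin n)} (h : ∀ k, w (σ k) = τ k) (z : 𝔸 d) :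
    sig τ z = dl w * sig σ z * dl w⁻¹ := by
  induction z using ga_ind with
  | h1 g =>
    rw [sig_dl, sig_dl, ← dl_mul, ← dl_mul]
    congr 1
    rw [eq_mul_inv_iff_mul_eq]
    ext1 x
    by_cases hx : x ∈ Set.range σ
    · obtain ⟨k, rfl⟩ := hx
      simp [h, vE_apply]
    · have : w x ∉ Set.range τ := by
        rintro ⟨k, hk⟩
        rw [← h k] at hk
        exact hx ⟨k, w.injective hk⟩
      simp [vE_apply_of, hx, this]
  | h2 a b ha hb => simp [ha, hb, mul_add, add_mul]
  | h3 c a ha => simp [ha]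

lemma fixSum_conj {σ τ : Fin d ↪ Fin n} {w : Equiv.Perm (Fin n)} (h : ∀ k, w (σ k) = τ k) :
    fixSum τ = dl w * fixSum σ * dl w⁻¹ := by
  rw [fixSum, fixSum, Finset.mul_sum, Finset.sum_mul]
  have h' : ∀ k, w.symm (τ k) = σ k := fun k => by rw [Equiv.symm_apply_eq, h]
  refine Finset.sum_bij' (fun g _ => w⁻¹ * g * w) (fun g _ => w * g * w⁻¹) ?_ ?_ ?_ ?_ ?_
  · intro g hg; simp only [Finset.mem_filter, Finset.mem_univ, true_and] at hg ⊢
    intro k; simp [h, hg, h']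
  · intro g hg; simp only [Finset.mem_filter, Finset.mem_univ, true_and] at hg ⊢
    intro k; simp [h, hg, h']
  · intro g _; simp [mul_assoc]
  · intro g _; simp [mul_assoc]
  · intro g _; rw [← dl_mul, ← dl_mul]; simp [mul_assoc]

lemma L2a (σ : Fin d ↪ Fin n) (hl : IsFilling l row col) (hm : IsFilling m row' col')
    (hs : ∀ i, l.part (i + 1) ≤ m.part i) (hle : ∀ i, m.part i ≤ l.part i) :
    ∃ y, sig σ (youngSymmetrizer row' col') * y * youngSymmetrizer row col ≠ 0 := by
  obtain ⟨τ, h1, h2⟩ := exists_compat hl hm hle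
  obtain ⟨w, hw⟩ := exists_perm_emb σ τ
  obtain ⟨y, hy⟩ := L2a_aux hl hm hs h1 h2
  refine ⟨dl w⁻¹ * y, fun h0 => hy ?_⟩
  rw [sig_conj hw]
  simp only [mul_assoc] at h0 ⊢
  rw [h0, mul_zero]

lemma L2b (σ : Fin d ↪ Fin n) (hl : IsFilling l row col) (hm : IsFilling m row' col')
    (hs : ∀ i, l.part (i + 1) ≤ m.part i) (hle : ∀ i, m.part i ≤ l.part i) :
    ∃ y, youngSymmetrizer row col * y * fixSum σ * sig σ (youngSymmetrizer row' col') ≠ 0 := by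
  obtain ⟨τ, h1, h2⟩ := exists_compat hl hm hle
  obtain ⟨w, hw⟩ := exists_perm_emb σ τ
  obtain ⟨y, hy⟩ := L2b_aux hl hm hs h1 h2
  refine ⟨y * dl w, fun h0 => hy ?_⟩
  rw [sig_conj hw, fixSum_conj hw]
  have : youngSymmetrizer row col * y * (dl w * fixSum σ * dl w⁻¹) *
      (dl w * sig σ (youngSymmetrizer row' col') * dl w⁻¹) =
      (youngSymmetrizer row col * (y * dl w) * fixSum σ * sig σ (youngSymmetrizer row' col')) *
        dl w⁻¹ := by
    simp only [mul_assoc]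
    rw [← mul_assoc (dl w⁻¹), dl_inv_mul, one_mul]
  rw [this, h0, zero_mul]

lemma L2c (σ : Fin d ↪ Fin n) (hl : IsFilling l row col) (hm : IsFilling m row' col')
    (hs : ∀ i, l.part (i + 1) ≤ m.part i) (hle : ∀ i, m.part i ≤ l.part i) :
    ∃ y, youngSymmetrizer row col * y * fixSum σ * sig σ (qYoung row' col') ≠ 0 := by
  obtain ⟨y, hy⟩ := L2b σ hl hm hs hle
  exact ⟨y * sig σ (rowSymmetrizer row'), by
    have := L2c_aux hm hy
    simpa only [mul_assoc] using this⟩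

end emb
end GF

namespace GF

/-! ### Combinatorics of partitions -/

/-- horizontal strip relation -/
def hs (m l : Ptn) : Prop := ∀ i, m.part i ≤ l.part i ∧ l.part (i + 1) ≤ m.part i

lemma pieri_iff {m l : Ptn} {n d : ℕ} (hm : m.size = d) (hl : l.size = n) :
    IsPieri m ((n : ℤ) - d) l ↔ hs m l := by
  unfold IsPieri hs
  rw [hm, hl]
  constructor
  · rintro ⟨-, h1, h2⟩ i; exact ⟨h1 i, h2 i⟩
  · intro h; exact ⟨by ring, fun i => (h i).1, fun i => (h i).2⟩

lemma size_eq_sum (l : Ptn) {N : ℕ} (hN : ∀ i, N ≤ i → l.part i = 0) :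
    l.size = ∑ i ∈ Finset.range N, l.part i := by
  unfold Ptn.size
  apply Finsupp.sum_of_support_subset _ _ _ (by simp)
  intro i hi
  simp only [Finsupp.mem_support_iff] at hi
  simp only [Finset.mem_range]
  by_contra h
  exact hi (hN i (by omega))

lemma exists_bound (l : Ptn) : ∃ N, ∀ i, N ≤ i → l.part i = 0 := by
  obtain ⟨N, hN⟩ := l.part.support.exists_nat_subset_range
  refine ⟨N, fun i hi => ?_⟩
  by_contra h
  have := hN (Finsupp.mem_support_iff.2 h)
  simp at this; omega

lemma part_le_size (l : Ptn) (i : ℕ) : l.part i ≤ l.size := by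
  obtain ⟨N, hN⟩ := exists_bound l
  by_cases h : N ≤ i
  · rw [hN i h]; omega
  · rw [size_eq_sum l hN]
    exact Finset.single_le_sum (f := fun i => l.part i) (fun _ _ => Nat.zero_le _) (by simp; omega)

lemma part_eq_zero (l : Ptn) {i : ℕ} (h : l.size ≤ i) : l.part i = 0 := by
  by_contra h0
  obtain ⟨N, hN⟩ := exists_bound l
  have hi : i < N := by by_contra h'; exact h0 (hN i (by omega))
  have h1 : ∑ j ∈ Finset.range (i + 1), 1 ≤ ∑ j ∈ Finset.range (i + 1), l.part j := by
    apply Finset.sum_le_sum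
    intro j hj
    have := Ptn_anti l (i := j) (j := i) (by simp at hj; omega)
    omega
  have h2 : ∑ j ∈ Finset.range (i + 1), l.part j ≤ ∑ j ∈ Finset.range N, l.part j := by
    apply Finset.sum_le_sum_of_subset
    intro j hj; simp at hj ⊢; omega
  rw [← size_eq_sum l hN] at h2
  simp at h1
  omega

/-- partitions of `n` -/
abbrev TP (n : ℕ) := {l : Ptn // l.size = n}

instance TP_finite (n : ℕ) : Finite (TP n) := by
  apply Finite.of_injective (β := Fin n → Fin (n + 1))
    (fun l i => ⟨l.1.part i, by have := part_le_size l.1 i; have := l.2; omega⟩)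
  intro l l' h
  apply Subtype.ext
  apply Ptn_ext
  intro i
  by_cases hi : i < n
  · have := congrFun h ⟨i, hi⟩
    simpa using this
  · rw [part_eq_zero l.1 (by have := l.2; omega), part_eq_zero l'.1 (by have := l'.2; omega)]

noncomputable instance TP_fintype (n : ℕ) : Fintype (TP n) := Fintype.ofFinite _

/-- Build a partition from a function. -/
noncomputable def mkPtn (f : ℕ → ℕ) (N : ℕ) (hN : ∀ i, N ≤ i → f i = 0)
    (ha : ∀ i, f (i + 1) ≤ f i) : Ptn where
  part := Finsupp.onFinset (Finset.range N) f (fun i hi => by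
    simp; by_contra h; exact hi (hN i (by omega)))
  antitone' := ha

@[simp] lemma mkPtn_part (f : ℕ → ℕ) (N : ℕ) (hN : ∀ i, N ≤ i → f i = 0)
    (ha : ∀ i, f (i + 1) ≤ f i) (i : ℕ) : (mkPtn f N hN ha).part i = f i := rfl

lemma size_rel (l k u v : Ptn)
    (h : ∀ i, k.part i + l.part (i + 1) = max (u.part (i + 1)) (v.part (i + 1)) +
      min (u.part i) (v.part i)) :
    k.size + l.size + max (u.part 0) (v.part 0) = l.part 0 + u.size + v.size := by
  obtain ⟨N1, h1⟩ := exists_bound l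
  obtain ⟨N2, h2⟩ := exists_bound k
  obtain ⟨N3, h3⟩ := exists_bound u
  obtain ⟨N4, h4⟩ := exists_bound v
  set N := N1 + N2 + N3 + N4 with hN
  rw [size_eq_sum l (N := N + 1) (fun i hi => h1 i (by omega)),
    size_eq_sum k (N := N) (fun i hi => h2 i (by omega)),
    size_eq_sum u (N := N) (fun i hi => h3 i (by omega)),
    size_eq_sum v (N := N) (fun i hi => h4 i (by omega)), Finset.sum_range_succ']
  have e1 : ∑ i ∈ Finset.range N, k.part i + ∑ i ∈ Finset.range N, l.part (i + 1) =
      ∑ i ∈ Finset.range N, max (u.part (i + 1)) (v.part (i + 1)) +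
      ∑ i ∈ Finset.range N, min (u.part i) (v.part i) := by
    rw [← Finset.sum_add_distrib, ← Finset.sum_add_distrib]
    exact Finset.sum_congr rfl fun i _ => h i
  have e2 : ∑ i ∈ Finset.range N, max (u.part (i + 1)) (v.part (i + 1)) +
      max (u.part 0) (v.part 0) = ∑ i ∈ Finset.range N, max (u.part i) (v.part i) := by
    rw [← Finset.sum_range_succ' (fun i => max (u.part i) (v.part i)), Finset.sum_range_succ,
      h3 N (by omega), h4 N (by omega)]
    simp
  have e3 : ∑ i ∈ Finset.range N, max (u.part i) (v.part i) +
      ∑ i ∈ Finset.range N, min (u.part i) (v.part i) =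
      ∑ i ∈ Finset.range N, u.part i + ∑ i ∈ Finset.range N, v.part i := by
    rw [← Finset.sum_add_distrib, ← Finset.sum_add_distrib]
    exact Finset.sum_congr rfl fun i _ => by omega
  omega

lemma hs_size_le {m l : Ptn} (h : hs m l) : m.size ≤ l.size := by
  obtain ⟨N1, h1⟩ := exists_bound l
  rw [size_eq_sum l h1, size_eq_sum m (N := N1) (fun i hi => by
    have := (h i).1; rw [h1 i hi] at this; omega)]
  exact Finset.sum_le_sum fun i _ => (h i).1

lemma hs_eq {m l : Ptn} (h : hs m l) (he : l.size ≤ m.size) : m = l := by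
  obtain ⟨N1, h1⟩ := exists_bound l
  rw [size_eq_sum l h1, size_eq_sum m (N := N1) (fun i hi => by
    have := (h i).1; rw [h1 i hi] at this; omega)] at he
  apply Ptn_ext
  intro i
  by_cases hi : N1 ≤ i
  · have := (h i).1; rw [h1 i hi] at this ⊢; omega
  · have := (Finset.sum_eq_sum_iff_of_le (s := Finset.range N1)
      (f := fun i => m.part i) (g := fun i => l.part i) (fun i _ => (h i).1)).1
      (le_antisymm (Finset.sum_le_sum fun i _ => (h i).1) he) i (by simp; omega)
    exact this

/-- toggling bijection -/
noncomputable def toggle (u v : Ptn) :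
    {l : Ptn // l.size = u.size + 1 ∧ hs u l ∧ hs v l} ≃
    {k : Ptn // (k.size + 1 = v.size ∨ k.size = v.size) ∧ hs k u ∧ hs k v} where
  toFun l := ⟨mkPtn (fun i => max (u.part (i + 1)) (v.part (i + 1)) +
      min (u.part i) (v.part i) - l.1.part (i + 1)) (u.size + v.size)
      (fun i hi => by
        rw [part_eq_zero u (i := i) (by omega), part_eq_zero v (i := i) (by omega),
          part_eq_zero u (i := i + 1) (by omega), part_eq_zero v (i := i + 1) (by omega)]; simp)
      (fun i => by
        have h1 := l.2.2.1 (i + 1); have h2 := l.2.2.2 (i + 1)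
        have h3 := l.2.2.1 i; have h4 := l.2.2.2 i
        have h5 := l.2.2.1 (i + 1 + 1); have h6 := l.2.2.2 (i + 1 + 1)
        have := u.antitone' i; have := v.antitone' i
        have := u.antitone' (i + 1); have := v.antitone' (i + 1)
        omega), by
      have h1 : ∀ i, _ := l.2.2.1
      have h2 : ∀ i, _ := l.2.2.2
      refine ⟨?_, ?_, ?_⟩
      · set k := mkPtn (fun i => max (u.part (i + 1)) (v.part (i + 1)) +
          min (u.part i) (v.part i) - l.1.part (i + 1)) (u.size + v.size) _ _ with hk
        have h3 := size_rel l.1 k u v (fun i => by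
          rw [hk]; simp only [mkPtn_part]
          have := h1 i; have := h2 i
          have := h1 (i + 1); have := h2 (i + 1)
          omega)
        have h4 : hs k v := by
          intro i
          rw [hk]; simp only [mkPtn_part]
          have := h1 i; have := h2 i
          have := h1 (i + 1); have := h2 (i + 1)
          omega
        have := hs_size_le h4
        have := h1 0; have := h2 0; have := l.2.1
        omega
      · intro i
        simp only [mkPtn_part]
        have := h1 i; have := h2 i
        have := h1 (i + 1); have := h2 (i + 1)
        omega
      · intro i
        simp only [mkPtn_part]
        have := h1 i; have := h2 i
        have := h1 (i + 1); have := h2 (i + 1)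
        omega⟩
  invFun k := ⟨mkPtn (fun i => match i with
      | 0 => max (u.part 0) (v.part 0) + (k.1.size + 1 - v.size)
      | i + 1 => max (u.part (i + 1)) (v.part (i + 1)) +
          min (u.part i) (v.part i) - k.1.part i) (u.size + v.size + 1)
      (fun i hi => by
        obtain ⟨j, rfl⟩ : ∃ j, i = j + 1 := ⟨i - 1, by omega⟩
        simp only
        rw [part_eq_zero u (i := j) (by omega), part_eq_zero v (i := j) (by omega),
          part_eq_zero u (i := j + 1) (by omega), part_eq_zero v (i := j + 1) (by omega)]; simp)
      (fun i => by
        have h1 := k.2.2.1 i; have h2 := k.2.2.2 i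
        have := u.antitone' i; have := v.antitone' i
        cases i with
        | zero => simp only; omega
        | succ i =>
          have h1 := k.2.2.1 i; have h2 := k.2.2.2 i
          simp only; omega), by
      have h1 : ∀ i, _ := k.2.2.1
      have h2 : ∀ i, _ := k.2.2.2
      refine ⟨?_, ?_, ?_⟩
      · set l := mkPtn _ (u.size + v.size + 1) _ _ with hl
        have h3 := size_rel l k.1 u v (fun i => by
          rw [hl]; simp only [mkPtn_part]
          have := h1 i; have := h2 i
          omega)
        have h0 : l.part 0 = max (u.part 0) (v.part 0) + (k.1.size + 1 - v.size) := rfl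
        have := k.2.1
        omega
      · intro i
        simp only [mkPtn_part]
        have := h1 i; have := h2 i
        cases i with
        | zero => simp only; omega
        | succ i =>
          have := h1 i; have := h2 i
          simp only; omega
      · intro i
        simp only [mkPtn_part]
        have := h1 i; have := h2 i
        cases i with
        | zero => simp only; omega
        | succ i =>
          have := h1 i; have := h2 i
          simp only; omega⟩
  left_inv l := by
    apply Subtype.ext
    apply Ptn_ext
    have h1 : ∀ i, _ := l.2.2.1
    have h2 : ∀ i, _ := l.2.2.2
    intro i
    cases i with
    | zero =>
      simp only [mkPtn_part]
      set k := mkPtn (fun i => max (u.part (i + 1)) (v.part (i + 1)) +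
          min (u.part i) (v.part i) - l.1.part (i + 1)) (u.size + v.size) _ _ with hk
      have h3 := size_rel l.1 k u v (fun i => by
          rw [hk]; simp only [mkPtn_part]
          have := h1 i; have := h2 i
          have := h1 (i + 1); have := h2 (i + 1)
          omega)
      have := h1 0; have := h2 0; have := l.2.1
      omega
    | succ i =>
      simp only [mkPtn_part]
      have := h1 i; have := h2 i
      have := h1 (i + 1); have := h2 (i + 1)
      omega
  right_inv k := by
    apply Subtype.ext
    apply Ptn_ext
    intro i
    simp only [mkPtn_part]
    have h1 := k.2.2.1 i; have h2 := k.2.2.2 i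
    omega

open scoped Classical in
/-- The number of standard tableaux of shape `l`. -/
noncomputable def gdim : (n : ℕ) → TP n → ℕ
  | 0, _ => 1
  | n + 1, l => ∑ u : TP n, if hs u.1 l.1 then gdim n u else 0

open scoped Classical in
lemma toggle_count {n d : ℕ} (u : TP n) (v : TP (d + 1)) :
    (∑ l : TP (n + 1), if hs u.1 l.1 ∧ hs v.1 l.1 then 1 else 0) =
    (∑ k : TP d, if hs k.1 u.1 ∧ hs k.1 v.1 then 1 else 0) + if hs v.1 u.1 then 1 else 0 := by
  have e1 : (∑ l : TP (n + 1), if hs u.1 l.1 ∧ hs v.1 l.1 then 1 else 0) =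
      Nat.card {l : Ptn // l.size = u.1.size + 1 ∧ hs u.1 l ∧ hs v.1 l} := by
    rw [← Finset.sum_filter, Finset.sum_const, smul_eq_mul, mul_one, ← Fintype.card_subtype,
      ← Nat.card_eq_fintype_card]
    apply Nat.card_congr
    refine (Equiv.subtypeSubtypeEquivSubtypeInter (fun l : Ptn => l.size = n + 1)
      (fun l => hs u.1 l ∧ hs v.1 l)).trans (Equiv.subtypeEquivRight ?_)
    intro x; rw [u.2]
  have e2 : (∑ k : TP d, if hs k.1 u.1 ∧ hs k.1 v.1 then 1 else 0) =
      Nat.card {k : Ptn // k.size + 1 = v.1.size ∧ hs k u.1 ∧ hs k v.1} := by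
    rw [← Finset.sum_filter, Finset.sum_const, smul_eq_mul, mul_one, ← Fintype.card_subtype,
      ← Nat.card_eq_fintype_card]
    apply Nat.card_congr
    refine (Equiv.subtypeSubtypeEquivSubtypeInter (fun l : Ptn => l.size = d)
      (fun l => hs l u.1 ∧ hs l v.1)).trans (Equiv.subtypeEquivRight ?_)
    intro x; rw [v.2, Nat.add_right_cancel_iff]
  rw [e1, e2, Nat.card_congr (toggle u.1 v.1)]
  have hv : hs v.1 v.1 := fun i => ⟨le_rfl, v.1.antitone' i⟩
  have fin1 : Finite {k : Ptn // k.size + 1 = v.1.size ∧ hs k u.1 ∧ hs k v.1} :=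
    Finite.of_injective (β := TP d) (fun k => ⟨k.1, by have := k.2.1; have := v.2; omega⟩)
      (fun a b h => Subtype.ext (by simpa using h))
  have fin2 : Finite {k : Ptn // k.size = v.1.size ∧ hs k u.1 ∧ hs k v.1} :=
    Finite.of_injective (β := TP (d + 1)) (fun k => ⟨k.1, by have := k.2.1; have := v.2; omega⟩)
      (fun a b h => Subtype.ext (by simpa using h))
  have e3 : Nat.card {k : Ptn // (k.size + 1 = v.1.size ∨ k.size = v.1.size) ∧
      hs k u.1 ∧ hs k v.1} =
      Nat.card {k : Ptn // k.size + 1 = v.1.size ∧ hs k u.1 ∧ hs k v.1} +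
      Nat.card {k : Ptn // k.size = v.1.size ∧ hs k u.1 ∧ hs k v.1} := by
    rw [← Nat.card_sum]
    apply Nat.card_congr
    refine (Equiv.subtypeEquivRight ?_).trans (subtypeOrEquiv _ _ ?_)
    · intro x; tauto
    · rw [Pi.disjoint_iff]
      intro x
      rw [Prop.disjoint_iff]
      by_contra h
      omega
  rw [e3]
  congr 1
  split_ifs with h
  · rw [Nat.card_eq_one_iff_unique]
    constructor
    · constructor
      intro a b
      apply Subtype.ext
      rw [hs_eq a.2.2.2 a.2.1.ge, hs_eq b.2.2.2 b.2.1.ge]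
    · exact ⟨v.1, rfl, h, hv⟩
  · rw [Nat.card_eq_zero]
    left
    constructor
    rintro ⟨k, h1, h2, h3⟩
    exact h (hs_eq h3 h1.ge ▸ h2)

lemma ptn_zero (u v : TP 0) : u = v := by
  apply Subtype.ext; apply Ptn_ext; intro i
  rw [part_eq_zero u.1 (by have := u.2; omega), part_eq_zero v.1 (by have := v.2; omega)]

noncomputable instance : Inhabited (TP 0) := ⟨⟨mkPtn (fun _ => 0) 0 (by simp) (by simp), by
  rw [size_eq_sum _ (N := 0)] <;> simp⟩⟩

open scoped Classical in
lemma H0 (n : ℕ) (v : TP 0) : (∑ l : TP n, if hs v.1 l.1 then gdim n l else 0) = 1 := by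
  have hv : ∀ i, v.1.part i = 0 := fun i => part_eq_zero v.1 (by have := v.2; omega)
  have key : ∀ l : TP n, hs v.1 l.1 ↔ ∀ i, l.1.part (i + 1) = 0 := by
    intro l
    constructor
    · intro h i; have := (h i).2; rw [hv] at this; omega
    · intro h i; rw [hv, h]; simp
  simp only [key]
  rw [← Finset.sum_filter]
  -- the unique one-row partition
  let o : (n : ℕ) → TP n := fun n => ⟨mkPtn (fun i => if i = 0 then n else 0) 1
    (fun i hi => if_neg (by omega)) (fun i => by simp), by
      rw [size_eq_sum _ (N := 1)] <;> simp
      omega⟩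
  have ho : ∀ n, ∀ l : TP n, (∀ i, l.1.part (i + 1) = 0) ↔ l = o n := by
    intro n l
    constructor
    · intro h
      apply Subtype.ext; apply Ptn_ext; intro i
      have : l.1.part 0 = n := by
        refine Eq.trans ?_ l.2
        rw [size_eq_sum l.1 (N := 1)]
        · simp
        · intro i hi; obtain ⟨j, rfl⟩ : ∃ j, i = j + 1 := ⟨i - 1, by omega⟩; exact h j
      cases i with
      | zero => simpa [o] using this
      | succ i => simp [o, h]
    · rintro rfl i; simp [o]
  have ho' : ∀ n, gdim n (o n) = 1 := by
    intro n
    induction n with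
    | zero => rfl
    | succ n ih =>
      rw [gdim, Finset.sum_eq_single (o n)]
      · rw [if_pos, ih]
        intro i; simp only [o, mkPtn_part]; split_ifs <;> simp_all
      · intro u _ hu
        rw [if_neg]
        intro h
        apply hu
        rw [← ho]
        intro i
        have := (h (i + 1)).1
        rw [(ho _ _).2 rfl] at this
        omega
      · simp
  have : (Finset.univ.filter fun l : TP n => ∀ i, l.1.part (i + 1) = 0) = {o n} := by
    ext l; simp [ho]
  rw [this, Finset.sum_singleton, ho']

open scoped Classical in
lemma N1 (n d : ℕ) (v : TP d) :
    (∑ l : TP n, if hs v.1 l.1 then gdim n l else 0) = n.choose d * gdim d v := by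
  induction n generalizing d with
  | zero =>
    cases d with
    | zero => rw [H0]; simp [gdim]
    | succ d =>
      rw [Nat.choose_zero_succ, zero_mul]
      apply Finset.sum_eq_zero
      intro l _
      rw [if_neg]
      intro h
      have := hs_size_le h
      have := v.2; have := l.2
      omega
  | succ n ih =>
    cases d with
    | zero => rw [H0]; simp [gdim]
    | succ d =>
      calc (∑ l : TP (n + 1), if hs v.1 l.1 then gdim (n + 1) l else 0)
          = ∑ l : TP (n + 1), ∑ u : TP n,
              gdim n u * (if hs u.1 l.1 ∧ hs v.1 l.1 then 1 else 0) := by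
            apply Finset.sum_congr rfl
            intro l _
            by_cases h : hs v.1 l.1
            · simp [h, gdim]
            · simp [h]
        _ = ∑ u : TP n, gdim n u * ((∑ k : TP d, if hs k.1 u.1 ∧ hs k.1 v.1 then 1 else 0) +
              if hs v.1 u.1 then 1 else 0) := by
            rw [Finset.sum_comm]
            apply Finset.sum_congr rfl
            intro u _
            rw [← Finset.mul_sum, toggle_count]
        _ = (∑ k : TP d, if hs k.1 v.1 then (∑ u : TP n, if hs k.1 u.1 then gdim n u else 0)
              else 0) + ∑ u : TP n, (if hs v.1 u.1 then gdim n u else 0) := by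
            simp only [mul_add, Finset.sum_add_distrib, Finset.mul_sum]
            congr 1
            · rw [Finset.sum_comm]
              apply Finset.sum_congr rfl
              intro k _
              by_cases h : hs k.1 v.1
              · simp [h]
              · simp [h]
            · simp
        _ = _ := by
            rw [ih]
            simp only [ih]
            rw [Nat.choose_succ_succ, add_mul]
            congr 1
            rw [gdim, Finset.mul_sum]
            apply Finset.sum_congr rfl
            intro k _
            split_ifs <;> simp

lemma N2 (d : ℕ) : ∑ u : TP d, gdim d u ^ 2 = d.factorial := by
  classical
  induction d with
  | zero =>
    have : (Finset.univ : Finset (TP 0)) = {default} := by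
      ext x; simp [ptn_zero x default]
    rw [this]; simp [gdim]
  | succ d ih =>
    calc ∑ l : TP (d + 1), gdim (d + 1) l ^ 2
        = ∑ l : TP (d + 1), ∑ u : TP d, gdim d u * (if hs u.1 l.1 then gdim (d + 1) l else 0) := by
          apply Finset.sum_congr rfl
          intro l _
          rw [pow_two]
          conv_lhs => rw [gdim.eq_2]
          rw [Finset.sum_mul]
          apply Finset.sum_congr rfl
          intro u _
          split_ifs
          · rw [gdim]
          · simp
      _ = ∑ u : TP d, gdim d u * ((d + 1) * gdim d u) := by
          rw [Finset.sum_comm]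
          apply Finset.sum_congr rfl
          intro u _
          rw [← Finset.mul_sum, N1]
          simp
      _ = _ := by
          rw [Nat.factorial_succ, ← ih, Finset.mul_sum]
          apply Finset.sum_congr rfl
          intro u _
          ring

open scoped Classical in
lemma N3 (n m d : ℕ) :
    ∑ l : TP n, ∑ k : TP m, (∑ u : TP d, if hs u.1 l.1 ∧ hs u.1 k.1 then gdim n l * gdim m k else 0) =
      n.choose d * m.choose d * d.factorial := by
  calc _ = ∑ u : TP d, (∑ l : TP n, if hs u.1 l.1 then gdim n l else 0) *
        (∑ k : TP m, if hs u.1 k.1 then gdim m k else 0) := by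
        simp only [Finset.sum_mul_sum]
        rw [Finset.sum_comm]
        conv_rhs => rw [Finset.sum_comm]
        conv_lhs => rw [Finset.sum_comm]
        apply Finset.sum_congr rfl
        intro l _
        rw [Finset.sum_comm]
        apply Finset.sum_congr rfl
        intro u _
        apply Finset.sum_congr rfl
        intro k _
        by_cases h1 : hs u.1 l.1 <;> by_cases h2 : hs u.1 k.1 <;> simp [h1, h2]
    _ = _ := by
        simp only [N1]
        rw [← N2, Finset.mul_sum]
        apply Finset.sum_congr rfl
        intro u _
        ring

/-- existence of fillings -/
lemma exists_filling {n : ℕ} (l : TP n) : ∃ row col : Fin n → ℕ, IsFilling l.1 row col := by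
  obtain ⟨N, hN⟩ := exists_bound l.1
  have hc : Fintype.card (Σ i : Fin N, Fin (l.1.part i)) = n := by
    rw [Fintype.card_sigma]
    simp only [Fintype.card_fin]
    rw [Fin.sum_univ_eq_sum_range (fun i => l.1.part i), ← size_eq_sum l.1 hN, l.2]
  let e := (Fintype.equivFinOfCardEq hc).symm
  refine ⟨fun k => (e k).1, fun k => (e k).2, ?_, ?_⟩
  · intro x y hxy
    apply e.injective
    simp only [Prod.mk.injEq] at hxy
    have h1 : (e x).1 = (e y).1 := Fin.ext hxy.1
    rcases hx : e x with ⟨i, j⟩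
    rcases hy : e y with ⟨i', j'⟩
    rw [hx, hy] at hxy h1
    simp only at hxy h1
    subst h1
    have := Fin.ext hxy.2
    rw [this]
  · intro i j
    constructor
    · rintro ⟨k, rfl, rfl⟩; exact (e k).2.2
    · intro h
      have hi : i < N := by
        by_contra h'
        rw [hN i (by omega)] at h; omega
      refine ⟨e.symm ⟨⟨i, hi⟩, ⟨j, h⟩⟩, ?_, ?_⟩
      · simp
      · beta_reduce; rw [Equiv.apply_symm_apply]

end GF

namespace GF

/-! ### Dimension bound from branching -/

instance ga_fd {G : Type} [Finite G] : FiniteDimensional ℂ (MonoidAlgebra ℂ G) :=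
  Module.Finite.equiv (MonoidAlgebra.coeffLinearEquiv ℂ).symm

lemma gdim_le (n : ℕ) (l : TP n) (row col : Fin n → ℕ) (h : IsFilling l.1 row col) :
    gdim n l ≤ Module.finrank ℂ (spechtModule row col) := by
  classical
  induction n with
  | zero =>
    rw [gdim]
    apply Module.finrank_pos_iff.2
    refine ⟨⟨⟨youngSymmetrizer row col, mem_specht.2 ⟨1, by simp⟩⟩, 0, ?_⟩⟩
    intro h0
    exact p_ne_zero h (congrArg Subtype.val h0)
  | succ n ih =>
    choose rw' cl' hf using fun u : TP n => exists_filling u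
    let σ : Fin n ↪ Fin (n + 1) := Fin.castSuccEmb
    let K := {u : TP n // hs u.1 l.1}
    have hy : ∀ u : K, ∃ y, sig σ (youngSymmetrizer (rw' u.1) (cl' u.1)) * y *
        youngSymmetrizer row col ≠ 0 := fun u =>
      L2a σ h (hf u.1) (fun i => (u.2 i).2) (fun i => (u.2 i).1)
    choose y hy using hy
    let x : K → MonoidAlgebra ℂ (Equiv.Perm (Fin (n + 1))) := fun u =>
      sig σ (youngSymmetrizer (rw' u.1) (cl' u.1)) * y u * youngSymmetrizer row col
    let Ψ0 : (∀ u : K, spechtModule (rw' u.1) (cl' u.1)) →ₗ[ℂ]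
        MonoidAlgebra ℂ (Equiv.Perm (Fin (n + 1))) :=
      ∑ u : K, (LinearMap.mulRight ℂ (x u)) ∘ₗ (sig σ).toLinearMap ∘ₗ
        (spechtModule (rw' u.1) (cl' u.1)).subtype ∘ₗ LinearMap.proj u
    have hΨ0 : ∀ v, Ψ0 v = ∑ u : K, sig σ (v u).1 * x u := by
      intro v; simp [Ψ0]
    let Ψ : (∀ u : K, spechtModule (rw' u.1) (cl' u.1)) →ₗ[ℂ] spechtModule row col :=
      Ψ0.codRestrict _ (fun v => by
        rw [hΨ0]
        apply Submodule.sum_mem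
        intro u _
        apply mul_mem_specht
        exact mem_specht.2 ⟨_, rfl⟩)
    have hinj : Function.Injective Ψ := by
      rw [← LinearMap.ker_eq_bot, LinearMap.ker_eq_bot']
      intro v hv
      have hv' : ∑ u : K, sig σ (v u).1 * x u = 0 := by
        rw [← hΨ0]; exact congrArg Subtype.val hv
      have := inj_lemma (idemFam_young rw' cl' hf) (sig σ) (fun k : K => k.1) x
        (fun k => ⟨y k * youngSymmetrizer row col, by simp only [x, mul_assoc]⟩)
        (by
          intro i c hc hs0 k
          by_cases hk : k.1 = i
          · rw [Finset.sum_eq_single k] at hs0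
            · exact (smul_eq_zero.1 hs0).resolve_right (hy k)
            · intro k' _ hk'
              rw [hc k', zero_smul]
              intro h'; exact hk' (Subtype.ext (h'.trans hk.symm))
            · simp
          · exact hc k hk)
        (fun u => (v u).1) (fun k => mem_specht.1 (v k).2)
        (fun k z => by rw [hv', mul_zero])
      ext u : 1
      exact Subtype.ext (this u)
    have h1 := LinearMap.finrank_le_finrank_of_injective hinj
    rw [Module.finrank_pi_fintype] at h1
    refine le_trans ?_ h1
    rw [gdim, ← Finset.sum_filter, Finset.sum_subtype (p := fun u : TP n => hs u.1 l.1)]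
    · exact Finset.sum_le_sum fun u _ => ih u.1 _ _ (hf u.1)
    · simp

end GF

namespace GF

/-! ### The group algebra of a product -/
section prod
variable {G H : Type} [Group G] [Group H]

/-- first inclusion -/
noncomputable def i1 : MonoidAlgebra ℂ G →ₐ[ℂ] MonoidAlgebra ℂ (G × H) :=
  MonoidAlgebra.mapDomainAlgHom ℂ ℂ (MonoidHom.inl G H)
/-- second inclusion -/
noncomputable def i2 : MonoidAlgebra ℂ H →ₐ[ℂ] MonoidAlgebra ℂ (G × H) :=
  MonoidAlgebra.mapDomainAlgHom ℂ ℂ (MonoidHom.inr G H)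

lemma i1_dl (g : G) : i1 (H := H) (dl g) = dl (g, 1) := by simp [i1, dl]
lemma i2_dl (h : H) : i2 (G := G) (dl h) = dl (1, h) := by simp [i2, dl]

lemma i1_i2_comm (x : MonoidAlgebra ℂ G) (y : MonoidAlgebra ℂ H) : i1 x * i2 y = i2 y * i1 x := by
  induction x using ga_ind with
  | h1 g =>
    induction y using ga_ind with
    | h1 h => rw [i1_dl, i2_dl, ← dl_mul, ← dl_mul]; simp
    | h2 a b ha hb => simp [mul_add, add_mul, ha, hb]
    | h3 c a ha => simp [ha]
  | h2 a b ha hb => simp [mul_add, add_mul, ha, hb]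
  | h3 c a ha => simp [ha]

/-- outer tensor product of group algebra elements -/
noncomputable def tn (x : MonoidAlgebra ℂ G) (y : MonoidAlgebra ℂ H) : MonoidAlgebra ℂ (G × H) :=
  i1 x * i2 y

lemma tn_dl (g : G) (h : H) : tn (dl g) (dl h) = dl (g, h) := by
  rw [tn, i1_dl, i2_dl, ← dl_mul]; simp

lemma tn_mul (x x' : MonoidAlgebra ℂ G) (y y' : MonoidAlgebra ℂ H) :
    tn x y * tn x' y' = tn (x * x') (y * y') := by
  simp only [tn, map_mul]
  rw [mul_assoc, ← mul_assoc (i2 y), ← i1_i2_comm x' y]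
  simp only [mul_assoc]

lemma tn_smul_left (c : ℂ) (x : MonoidAlgebra ℂ G) (y : MonoidAlgebra ℂ H) :
    tn (c • x) y = c • tn x y := by simp [tn]
lemma tn_smul_right (c : ℂ) (x : MonoidAlgebra ℂ G) (y : MonoidAlgebra ℂ H) :
    tn x (c • y) = c • tn x y := by simp [tn]
lemma tn_zero_left (y : MonoidAlgebra ℂ H) : tn (0 : MonoidAlgebra ℂ G) y = 0 := by simp [tn]
lemma tn_zero_right (x : MonoidAlgebra ℂ G) : tn x (0 : MonoidAlgebra ℂ H) = 0 := by simp [tn]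
lemma tn_sum_right {κ : Type} (s : Finset κ) (x : MonoidAlgebra ℂ G) (f : κ → MonoidAlgebra ℂ H) :
    tn x (∑ k ∈ s, f k) = ∑ k ∈ s, tn x (f k) := by simp [tn, Finset.mul_sum]

lemma coeff_tn (x : MonoidAlgebra ℂ G) (y : MonoidAlgebra ℂ H) (g : G) (h : H) :
    (tn x y).coeff (g, h) = x.coeff g * y.coeff h := by
  classical
  induction x using ga_ind with
  | h1 g' =>
    induction y using ga_ind with
    | h1 h' =>
      rw [tn_dl, coeff_dl, coeff_dl, coeff_dl]
      by_cases e1 : g' = g <;> by_cases e2 : h' = h <;> simp [e1, e2]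
    | h2 a b ha hb => 
      simp only [tn] at *
      simp [mul_add, ha, hb]
    | h3 c a ha => rw [tn_smul_right]; simp [ha]; ring
  | h2 a b ha hb =>
    simp only [tn] at *
    simp [add_mul, ha, hb]
  | h3 c a ha => rw [tn_smul_left]; simp [ha]; ring

lemma ga_ne_zero {K : Type} [Group K] {x : MonoidAlgebra ℂ K} (h : x ≠ 0) : ∃ g, x.coeff g ≠ 0 := by
  by_contra hc
  push Not at hc
  exact h (by ext g; simp [hc])

lemma tn_ne_zero {x : MonoidAlgebra ℂ G} {y : MonoidAlgebra ℂ H} (hx : x ≠ 0) (hy : y ≠ 0) :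
    tn x y ≠ 0 := by
  obtain ⟨g, hg⟩ := ga_ne_zero hx
  obtain ⟨h, hh⟩ := ga_ne_zero hy
  intro h0
  have := coeff_tn x y g h
  rw [h0] at this
  exact mul_ne_zero hg hh (by simpa using this.symm)

lemma idemFam_tn {ι ι' : Type} {p : ι → MonoidAlgebra ℂ G} {p' : ι' → MonoidAlgebra ℂ H}
    (hp : IdemFam p) (hp' : IdemFam p') :
    IdemFam (fun i : ι × ι' => tn (p i.1) (p' i.2)) where
  orth i j z hij := by
    apply exists_dl_of_ne
    rintro ⟨g, h⟩
    rw [← tn_dl, tn_mul, tn_mul]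
    by_cases h1 : i.1 = j.1
    · have h2 : i.2 ≠ j.2 := fun h2 => hij (Prod.ext h1 h2)
      rw [hp'.orth _ _ _ h2, tn_zero_right]
    · rw [hp.orth _ _ _ h1, tn_zero_left]
  prim i z := by
    induction z using ga_ind with
    | h1 g =>
      obtain ⟨g, h⟩ := g
      obtain ⟨c, hc⟩ := hp.prim i.1 (dl g)
      obtain ⟨c', hc'⟩ := hp'.prim i.2 (dl h)
      exact ⟨c * c', by rw [← tn_dl, tn_mul, tn_mul, hc, hc', tn_smul_left, tn_smul_right, smul_smul]⟩
    | h2 a b ha hb =>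
      obtain ⟨c, hc⟩ := ha; obtain ⟨c', hc'⟩ := hb
      exact ⟨c + c', by rw [mul_add, add_mul, hc, hc', add_smul]⟩
    | h3 c a ha =>
      obtain ⟨c', hc'⟩ := ha
      exact ⟨c * c', by rw [mul_smul_comm, smul_mul_assoc, hc', smul_smul]⟩
  sq i := by
    obtain ⟨c, h0, hc⟩ := hp.sq i.1
    obtain ⟨c', h0', hc'⟩ := hp'.sq i.2
    exact ⟨c * c', mul_ne_zero h0 h0', by
      rw [tn_mul, hc, hc', tn_smul_left, tn_smul_right, smul_smul]⟩

/-- linear map from the tensor product -/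
noncomputable def tnL : MonoidAlgebra ℂ G ⊗[ℂ] MonoidAlgebra ℂ H →ₗ[ℂ] MonoidAlgebra ℂ (G × H) :=
  (MonoidAlgebra.tensorEquiv (M := G) (N := H) ℂ).toLinearMap

lemma tnL_tmul (x : MonoidAlgebra ℂ G) (y : MonoidAlgebra ℂ H) : tnL (x ⊗ₜ y) = tn x y := by
  induction x using ga_ind with
  | h1 g' =>
    induction y using ga_ind with
    | h1 h' => rw [tn_dl]; simp [tnL, dl]
    | h2 a b ha hb => 
      simp only [tn] at *
      simp [mul_add, ha, hb, TensorProduct.tmul_add]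
    | h3 c a ha => rw [tn_smul_right]; simp [ha]
  | h2 a b ha hb =>
    simp only [tn] at *
    simp [add_mul, ha, hb, TensorProduct.add_tmul]
  | h3 c a ha => rw [tn_smul_left, ← TensorProduct.smul_tmul']; simp [ha]

end prod

section tens
variable {n m : ℕ} (row col : Fin n → ℕ) (row' col' : Fin m → ℕ)

/-- The inclusion of a tensor product of Specht modules in the group algebra. -/
noncomputable def tnV : spechtModule row col ⊗[ℂ] spechtModule row' col' →ₗ[ℂ]
    MonoidAlgebra ℂ (Equiv.Perm (Fin n) × Equiv.Perm (Fin m)) :=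
  tnL ∘ₗ TensorProduct.map (spechtModule row col).subtype (spechtModule row' col').subtype

lemma tnV_tmul (v : spechtModule row col) (w : spechtModule row' col') :
    tnV row col row' col' (v ⊗ₜ w) = tn v.1 w.1 := by
  simp [tnV, tnL_tmul]

lemma tnV_inj : Function.Injective (tnV row col row' col') := by
  rw [tnV, LinearMap.coe_comp]
  apply Function.Injective.comp
  · exact (MonoidAlgebra.tensorEquiv ℂ).injective
  · exact Module.Flat.tensorProduct_mapIncl_injective_of_left _ _

lemma tnV_mem (t : spechtModule row col ⊗[ℂ] spechtModule row' col') :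
    ∃ u, tnV row col row' col' t =
      u * tn (youngSymmetrizer row col) (youngSymmetrizer row' col') := by
  induction t using TensorProduct.induction_on with
  | zero => exact ⟨0, by simp⟩
  | tmul v w =>
    obtain ⟨a, ha⟩ := mem_specht.1 v.2
    obtain ⟨b, hb⟩ := mem_specht.1 w.2
    exact ⟨tn a b, by rw [tnV_tmul, ha, hb, tn_mul]⟩
  | add x y hx hy =>
    obtain ⟨a, ha⟩ := hx
    obtain ⟨b, hb⟩ := hy
    exact ⟨a + b, by rw [map_add, ha, hb, add_mul]⟩

lemma tnV_act (g : Equiv.Perm (Fin n)) (h : Equiv.Perm (Fin m))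
    (t : spechtModule row col ⊗[ℂ] spechtModule row' col') :
    tnV row col row' col' (TensorProduct.map (spechtAct row col g) (spechtAct row' col' h) t) =
      dl (g, h) * tnV row col row' col' t := by
  induction t using TensorProduct.induction_on with
  | zero => simp
  | tmul v w =>
    rw [TensorProduct.map_tmul, tnV_tmul, tnV_tmul, ← tn_dl, tn_mul]
    rfl
  | add x y hx hy => rw [map_add, map_add, hx, hy, map_add, mul_add]

end tens

/-! ### The vectors attached to a partition of `d` -/
section xvec
variable {n m d : ℕ}

/-- The diagonal averaging of `a ⊗ b`. -/
noncomputable def xv (σ : Fin d ↪ Fin n) (τ : Fin d ↪ Fin m)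
    (a : MonoidAlgebra ℂ (Equiv.Perm (Fin n))) (b : MonoidAlgebra ℂ (Equiv.Perm (Fin m))) :
    MonoidAlgebra ℂ (Equiv.Perm (Fin n) × Equiv.Perm (Fin m)) :=
  ∑ z : Equiv.Perm (Fin d), tn (a * sig σ (dl z)) (b * sig τ (dl z))

lemma xv_left (σ : Fin d ↪ Fin n) (τ : Fin d ↪ Fin m)
    (p a : MonoidAlgebra ℂ (Equiv.Perm (Fin n))) (q b : MonoidAlgebra ℂ (Equiv.Perm (Fin m))) :
    xv σ τ (p * a) (q * b) = tn p q * xv σ τ a b := by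
  simp only [xv, Finset.mul_sum, tn_mul, mul_assoc]

lemma emb_decomp (σ : Fin d ↪ Fin n) {g : Equiv.Perm (Fin n)} {z : Equiv.Perm (Fin d)}
    (h : ∀ k, g (σ k) = σ (z k)) : ∃ w : Equiv.Perm (Fin n), (∀ k, w (σ k) = σ k) ∧
      g = vE σ z * w := by
  refine ⟨(vE σ z)⁻¹ * g, fun k => ?_, by simp⟩
  rw [Equiv.Perm.mul_apply, h, ← map_inv, vE_apply]
  simp

lemma xv_inv (σ : Fin d ↪ Fin n) (τ : Fin d ↪ Fin m)
    (a s : MonoidAlgebra ℂ (Equiv.Perm (Fin n))) (b t : MonoidAlgebra ℂ (Equiv.Perm (Fin m)))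
    (u v : MonoidAlgebra ℂ (Equiv.Perm (Fin d)))
    (ha : a = s * fixSum σ * sig σ u) (hb : b = t * fixSum τ * sig τ v)
    {g : Equiv.Perm (Fin n)} {h : Equiv.Perm (Fin m)} {z : Equiv.Perm (Fin d)}
    (hg : ∀ k, g (σ k) = σ (z k)) (hh : ∀ k, h (τ k) = τ (z k)) :
    xv σ τ a b * dl (g, h) = xv σ τ a b := by
  obtain ⟨w, hw, rfl⟩ := emb_decomp σ hg
  obtain ⟨w', hw', rfl⟩ := emb_decomp τ hh
  have ea : ∀ y, a * sig σ y * dl w = a * sig σ y := by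
    intro y
    rw [ha, mul_assoc, mul_assoc, mul_assoc, ← mul_assoc (sig σ u), ← map_mul, ← mul_assoc (fixSum σ),
      fixSum_comm, mul_assoc (sig σ _), fixSum_dl hw, ← fixSum_comm, map_mul]
    simp only [mul_assoc]
  have eb : ∀ y, b * sig τ y * dl w' = b * sig τ y := by
    intro y
    rw [hb, mul_assoc, mul_assoc, mul_assoc, ← mul_assoc (sig τ v), ← map_mul, ← mul_assoc (fixSum τ),
      fixSum_comm, mul_assoc (sig τ _), fixSum_dl hw', ← fixSum_comm, map_mul]
    simp only [mul_assoc]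
  rw [xv, Finset.sum_mul]
  refine Fintype.sum_equiv (Equiv.mulRight z) _ _ ?_
  intro y
  rw [← tn_dl, tn_mul, dl_mul, dl_mul, ← sig_dl, ← sig_dl]
  simp only [Equiv.coe_mulRight]
  rw [← mul_assoc, ← mul_assoc, mul_assoc a, mul_assoc b, ← map_mul, ← map_mul, ea, eb, dl_mul]

lemma xv_orth (σ : Fin d ↪ Fin n) (τ : Fin d ↪ Fin m)
    (s : MonoidAlgebra ℂ (Equiv.Perm (Fin n))) (b : MonoidAlgebra ℂ (Equiv.Perm (Fin m)))
    {u v : Ptn} {row col row' col' : Fin d → ℕ} (hu : IsFilling u row col)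
    (hv : IsFilling v row' col') (hne : u ≠ v) :
    xv σ τ (s * sig σ (youngSymmetrizer row col)) b *
      i1 (sig σ (youngSymmetrizer row' col')) = 0 := by
  rw [xv, Finset.sum_mul]
  apply Finset.sum_eq_zero
  intro z _
  have : i1 (H := Equiv.Perm (Fin m)) (sig σ (youngSymmetrizer row' col')) =
    tn (sig σ (youngSymmetrizer row' col')) 1 := by simp [tn]
  rw [this, tn_mul, mul_assoc, mul_assoc, ← map_mul, ← map_mul, ← mul_assoc, p_orth hu hv hne]
  simp [tn_zero_left]

lemma xv_diag (σ : Fin d ↪ Fin n) (τ : Fin d ↪ Fin m)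
    (s : MonoidAlgebra ℂ (Equiv.Perm (Fin n))) (t : MonoidAlgebra ℂ (Equiv.Perm (Fin m)))
    {u : Ptn} {row col : Fin d → ℕ} (hu : IsFilling u row col) :
    xv σ τ (s * sig σ (youngSymmetrizer row col)) (t * sig τ (qYoung row col)) *
      i1 (sig σ (youngSymmetrizer row col)) =
    (kap row col * kap row col) •
      tn (s * sig σ (youngSymmetrizer row col)) (t * sig τ (qYoung row col)) := by
  rw [xv, Finset.sum_mul]
  have h1 : i1 (H := Equiv.Perm (Fin m)) (sig σ (youngSymmetrizer row col)) =
    tn (sig σ (youngSymmetrizer row col)) 1 := by simp [tn]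
  have h2 : ∀ z : Equiv.Perm (Fin d),
    tn (s * sig σ (youngSymmetrizer row col) * sig σ (dl z))
      (t * sig τ (qYoung row col) * sig τ (dl z)) * i1 (sig σ (youngSymmetrizer row col)) =
    tn (s * sig σ (youngSymmetrizer row col)) (t * sig τ (qYoung row col) *
      sig τ ((youngSymmetrizer row col * dl z * youngSymmetrizer row col).coeff 1 • dl z)) := by
    intro z
    rw [h1, tn_mul, mul_assoc, mul_assoc, ← map_mul, ← map_mul, ← mul_assoc, p_z_p hu, map_smul,
      mul_smul_comm, tn_smul_left, mul_one, map_smul, mul_smul_comm, tn_smul_right]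
    simp [young_coeff_one hu]
  rw [Finset.sum_congr rfl (fun z _ => h2 z), ← tn_sum_right, ← Finset.mul_sum, ← map_sum,
    sum_pzp hu, map_smul, mul_smul_comm, mul_assoc, ← map_mul, q_sq hu, map_smul, mul_smul_comm,
    smul_smul, tn_smul_right]

end xvec
end GF

namespace GF

/-! ### Rook monomials and the two maps between polynomials and the group algebra -/
section rook
variable {n m d : ℕ}

/-- The group `S_n × S_m`. -/
abbrev Gm (n m : ℕ) := Equiv.Perm (Fin n) × Equiv.Perm (Fin m)

/-- action on variables -/
def act (γ : Gm n m) (p : Fin n × Fin m) : Fin n × Fin m := (γ.1 p.1, γ.2 p.2)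

lemma act_inj (γ : Gm n m) : Function.Injective (act γ) := by
  rintro ⟨a, b⟩ ⟨c, e⟩ h
  simpa [act] using h

lemma act_mul (γ γ' : Gm n m) : act (γ * γ') = act γ ∘ act γ' := rfl

/-- exponent of the rook monomial -/
noncomputable def Ex (σ : Fin d ↪ Fin n) (τ : Fin d ↪ Fin m) (γ : Gm n m) : Fin n × Fin m →₀ ℕ :=
  ∑ k, Finsupp.single (γ.1 (σ k), γ.2 (τ k)) 1

variable (σ : Fin d ↪ Fin n) (τ : Fin d ↪ Fin m)

lemma Ex_mul (γ γ' : Gm n m) : Ex σ τ (γ * γ') = Finsupp.mapDomain (act γ) (Ex σ τ γ') := by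
  unfold Ex
  rw [Finsupp.mapDomain_finsetSum]
  simp [Finsupp.mapDomain_single, act]

lemma Ex_mul_inj (γ h h' : Gm n m) : Ex σ τ (γ * h) = Ex σ τ (γ * h') ↔ Ex σ τ h = Ex σ τ h' := by
  rw [Ex_mul, Ex_mul]
  exact (Finsupp.mapDomain_injective (act_inj γ)).eq_iff

lemma Ex_eq {γ γ' : Gm n m} (h : Ex σ τ γ = Ex σ τ γ') :
    ∃ z : Equiv.Perm (Fin d), ∀ k, γ.1 (σ k) = γ'.1 (σ (z k)) ∧ γ.2 (τ k) = γ'.2 (τ (z k)) := by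
  have h1 : ∀ k, ∃ k', γ.1 (σ k) = γ'.1 (σ k') ∧ γ.2 (τ k) = γ'.2 (τ k') := by
    intro k
    by_contra hc
    push Not at hc
    have e1 : Ex σ τ γ' (γ.1 (σ k), γ.2 (τ k)) = 0 := by
      unfold Ex
      rw [Finsupp.finsetSum_apply]
      apply Finset.sum_eq_zero
      intro k' _
      rw [Finsupp.single_apply, if_neg]
      intro he
      rw [Prod.mk.injEq] at he
      exact hc k' he.1.symm he.2.symm
    rw [← h] at e1
    unfold Ex at e1
    rw [Finsupp.finsetSum_apply] at e1
    have := (Finset.sum_eq_zero_iff.1 e1) k (Finset.mem_univ _)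
    simp at this
  choose z hz using h1
  have hi : Function.Injective z := by
    intro a b hab
    have := (hz a).1
    rw [hab, ← (hz b).1] at this
    simpa using this
  exact ⟨Equiv.ofBijective z (Finite.injective_iff_bijective.1 hi), hz⟩

lemma Ex_degree (γ : Gm n m) : (Ex σ τ γ).degree = d := by
  simp [Ex, map_sum]

lemma Ex_fst (γ : Gm n m) (i : Fin n) : Finsupp.mapDomain Prod.fst (Ex σ τ γ) i ≤ 1 := by
  classical
  unfold Ex
  rw [Finsupp.mapDomain_finsetSum, Finsupp.finsetSum_apply]
  simp only [Finsupp.mapDomain_single, Finsupp.single_apply]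
  rw [Finset.sum_boole]
  simp only [Nat.cast_id]
  rw [Finset.card_le_one]
  intro a ha b hb
  simp only [Finset.mem_filter, Finset.mem_univ, true_and] at ha hb
  rw [← hb] at ha
  simpa using ha

lemma Ex_snd (γ : Gm n m) (i : Fin m) : Finsupp.mapDomain Prod.snd (Ex σ τ γ) i ≤ 1 := by
  classical
  unfold Ex
  rw [Finsupp.mapDomain_finsetSum, Finsupp.finsetSum_apply]
  simp only [Finsupp.mapDomain_single, Finsupp.single_apply]
  rw [Finset.sum_boole]
  simp only [Nat.cast_id]
  rw [Finset.card_le_one]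
  intro a ha b hb
  simp only [Finset.mem_filter, Finset.mem_univ, true_and] at ha hb
  rw [← hb] at ha
  simpa using ha

/-- group algebra to polynomials -/
noncomputable def Th : MonoidAlgebra ℂ (Gm n m) →ₗ[ℂ] MvPolynomial (Fin n × Fin m) ℂ where
  toFun x := ∑ γ, x.coeff γ • monomial (Ex σ τ γ) 1
  map_add' x y := by simp only [MonoidAlgebra.coeff_add, Finsupp.add_apply, add_smul, Finset.sum_add_distrib]
  map_smul' c x := by
    simp only [MonoidAlgebra.coeff_smul, Finsupp.smul_apply, smul_eq_mul, mul_smul, Finset.smul_sum, RingHom.id_apply]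

/-- polynomials to group algebra -/
noncomputable def Ph : MvPolynomial (Fin n × Fin m) ℂ →ₗ[ℂ] MonoidAlgebra ℂ (Gm n m) where
  toFun f := ∑ γ, coeff (Ex σ τ γ) f • dl γ
  map_add' x y := by simp only [coeff_add, add_smul, Finset.sum_add_distrib]
  map_smul' c x := by
    simp only [coeff_smul, smul_eq_mul, mul_smul, Finset.smul_sum, RingHom.id_apply]

lemma Th_dl (γ : Gm n m) : Th σ τ (dl γ) = monomial (Ex σ τ γ) 1 := by
  classical
  simp [Th, coeff_dl]

lemma Ph_apply (f : MvPolynomial (Fin n × Fin m) ℂ) : Ph σ τ f = ∑ γ, coeff (Ex σ τ γ) f • dl γ := rfl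

open scoped Classical in
lemma Ph_Th (x : MonoidAlgebra ℂ (Gm n m)) : Ph σ τ (Th σ τ x) =
    x * ∑ h : Gm n m, (if Ex σ τ h = Ex σ τ 1 then (1 : ℂ) else 0) • dl h := by
  induction x using ga_ind with
  | h1 g =>
    rw [Th_dl, Ph_apply, Finset.mul_sum]
    symm
    refine Fintype.sum_equiv (Equiv.mulLeft g) _ _ ?_
    intro h
    rw [mul_smul_comm, ← dl_mul, Equiv.coe_mulLeft, coeff_monomial]
    congr 1
    have e : Ex σ τ h = Ex σ τ 1 ↔ Ex σ τ g = Ex σ τ (g * h) := by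
      rw [← Ex_mul_inj σ τ g h 1, mul_one, eq_comm]
    exact if_congr e rfl rfl
  | h2 a b ha hb => rw [map_add, map_add, ha, hb, add_mul]
  | h3 c a ha => rw [map_smul, map_smul, ha, smul_mul_assoc]

lemma Ph_Th_inv (x : MonoidAlgebra ℂ (Gm n m))
    (hx : ∀ (h : Gm n m) (z : Equiv.Perm (Fin d)), (∀ k, h.1 (σ k) = σ (z k)) →
      (∀ k, h.2 (τ k) = τ (z k)) → x * dl h = x) :
    ∃ N : ℕ, N ≠ 0 ∧ ∀ v, Ph σ τ (Th σ τ (v * x)) = (N : ℂ) • (v * x) := by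
  classical
  refine ⟨(Finset.univ.filter (fun h : Gm n m => Ex σ τ h = Ex σ τ 1)).card, ?_, ?_⟩
  · apply Finset.card_ne_zero_of_mem (a := 1); simp
  · intro v
    rw [Ph_Th, mul_assoc, Finset.mul_sum]
    have : ∀ h : Gm n m, x * ((if Ex σ τ h = Ex σ τ 1 then (1 : ℂ) else 0) • dl h) =
        (if Ex σ τ h = Ex σ τ 1 then (1 : ℂ) else 0) • x := by
      intro h
      split_ifs with he
      · obtain ⟨z, hz⟩ := Ex_eq σ τ he
        rw [one_smul, one_smul]
        exact hx h z (fun k => (hz k).1) (fun k => (hz k).2)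
      · simp
    rw [Finset.sum_congr rfl (fun h _ => this h), ← Finset.sum_smul, Finset.sum_boole, mul_smul_comm]

lemma Th_act (γ : Gm n m) (x : MonoidAlgebra ℂ (Gm n m)) :
    Th σ τ (dl γ * x) = rename (act γ) (Th σ τ x) := by
  induction x using ga_ind with
  | h1 g => rw [← dl_mul, Th_dl, Th_dl, rename_monomial, Ex_mul]
  | h2 a b ha hb => rw [mul_add, map_add, ha, hb, map_add, map_add]
  | h3 c a ha => rw [mul_smul_comm, map_smul, ha, map_smul, map_smul]

lemma Ph_act (γ : Gm n m) (f : MvPolynomial (Fin n × Fin m) ℂ) :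
    Ph σ τ (rename (act γ) f) = dl γ * Ph σ τ f := by
  rw [Ph_apply, Ph_apply, Finset.mul_sum]
  symm
  refine Fintype.sum_equiv (Equiv.mulLeft γ) _ _ ?_
  intro h
  rw [mul_smul_comm, ← dl_mul, Equiv.coe_mulLeft, Ex_mul, coeff_rename_mapDomain _ (act_inj γ)]

lemma Ph_homog {f : MvPolynomial (Fin n × Fin m) ℂ} {e : ℕ} (hf : f.IsHomogeneous e) (he : e ≠ d) :
    Ph σ τ f = 0 := by
  rw [Ph_apply]
  apply Finset.sum_eq_zero
  intro γ _
  rw [hf.coeff_eq_zero, zero_smul]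
  rw [Ex_degree]
  exact fun h => he h.symm

lemma Th_homog (x : MonoidAlgebra ℂ (Gm n m)) : (Th σ τ x).IsHomogeneous d := by
  induction x using ga_ind with
  | h1 g => rw [Th_dl]; exact isHomogeneous_monomial _ (Ex_degree σ τ g)
  | h2 a b ha hb => rw [map_add]; exact ha.add hb
  | h3 c a ha => rw [map_smul, smul_eq_C_mul]; simpa using (isHomogeneous_C _ c).mul ha

end rook
end GF

namespace GF

/-! ### The ideal is killed by good symmetrizers -/
section kone
variable {n m d : ℕ}

/-- row function whose only nontrivial row is `J` -/
def jr (J : Finset (Fin n)) (x : Fin n) : ℕ := if x ∈ J then 0 else x.1 + 1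

lemma jr_fix {J : Finset (Fin n)} {w : Equiv.Perm (Fin n)} (hw : ∀ k, jr J (w k) = jr J k) {x : Fin n}
    (hx : x ∉ J) : w x = x := by
  have := hw x
  unfold jr at this
  rw [if_neg hx] at this
  split_ifs at this with h
  apply Fin.ext
  omega

lemma jr_mem {J : Finset (Fin n)} {w : Equiv.Perm (Fin n)} (hw : ∀ k, jr J (w k) = jr J k) {x : Fin n}
    (hx : x ∈ J) : w x ∈ J := by
  have := hw x
  unfold jr at this
  rw [if_pos hx] at this
  split_ifs at this with h
  exact h

lemma jr_pres {J : Finset (Fin n)} {w : Equiv.Perm (Fin n)} (h1 : ∀ x, x ∉ J → w x = x) :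
    ∀ k, jr J (w k) = jr J k := by
  intro k
  by_cases hk : k ∈ J
  · have : w k ∈ J := by
      by_contra hc
      have := h1 _ hc
      rw [w.injective this] at hc
      exact hc hk
    simp [jr, hk, this]
  · rw [h1 k hk]

lemma p_z_eJ {l : Ptn} {row col : Fin n → ℕ} (hl : IsFilling l row col) (J : Finset (Fin n))
    (hJ : l.part 0 < J.card) (z : MonoidAlgebra ℂ (Equiv.Perm (Fin n))) :
    youngSymmetrizer row col * z * rowSymmetrizer (jr J) = 0 := by
  have : colSymmetrizer col * z * rowSymmetrizer (jr J) = 0 := by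
    apply col_z_row_zero_of
    intro g hg
    have h2 : J.card ≤ (Finset.range (l.part 0)).card := by
      apply Finset.card_le_card_of_injOn (fun x => col (g x))
      · intro x _
        simp only [Finset.coe_range, Set.mem_Iio]
        exact lt_of_lt_of_le (filling_lt hl (g x)) (Ptn_anti l (Nat.zero_le _))
      · intro x hx y hy hxy
        apply hg
        simp only [Finset.mem_coe] at hx hy
        simp only [jr, hx, hy, if_true]
        exact Prod.ext rfl hxy
    simp at h2
    omega
  rw [youngSymmetrizer, mul_assoc, mul_assoc, ← mul_assoc (colSymmetrizer col), this, mul_zero]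

lemma kill2 {l l' : Ptn} {row col : Fin n → ℕ} {row' col' : Fin m → ℕ}
    (hl' : IsFilling l' row' col') (J : Finset (Fin m)) (hJ : l'.part 0 < J.card)
    (x : MonoidAlgebra ℂ (Gm n m))
    (hx : ∀ w : Equiv.Perm (Fin m), (∀ k, jr J (w k) = jr J k) → dl ((1 : Equiv.Perm (Fin n)), w) * x = x)
    (z : MonoidAlgebra ℂ (Gm n m)) :
    tn (youngSymmetrizer row col) (youngSymmetrizer row' col') * z * x = 0 := by
  classical
  obtain ⟨N, hN, h1⟩ : ∃ N : ℕ, N ≠ 0 ∧ tn 1 (rowSymmetrizer (jr J)) * x = (N : ℂ) • x := by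
    refine ⟨(Finset.univ.filter (fun w : Equiv.Perm (Fin m) => ∀ k, jr J (w k) = jr J k)).card, ?_, ?_⟩
    · apply Finset.card_ne_zero_of_mem (a := 1); simp
    · rw [rowSymmetrizer, tn_sum_right, Finset.sum_mul, Finset.sum_congr rfl (g := fun _ => x)]
      · simp [Nat.cast_smul_eq_nsmul]
      · intro w hw
        have := hx w (Finset.mem_filter.1 hw).2
        rw [← tn_dl, dl_one] at this
        exact this
  have h2 : x = (N : ℂ)⁻¹ • (tn 1 (rowSymmetrizer (jr J)) * x) := by
    rw [h1, smul_smul, inv_mul_cancel₀ (by exact_mod_cast hN), one_smul]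
  have h3 : tn (youngSymmetrizer row col) (youngSymmetrizer row' col') * z *
      tn 1 (rowSymmetrizer (jr J)) = 0 := by
    apply exists_dl_of_ne
    rintro ⟨g, h⟩
    rw [← tn_dl, tn_mul, tn_mul, p_z_eJ hl' J hJ, tn_zero_right]
  rw [h2, mul_smul_comm, ← mul_assoc, h3, zero_mul, smul_zero]

lemma kill1 {l l' : Ptn} {row col : Fin n → ℕ} {row' col' : Fin m → ℕ}
    (hl : IsFilling l row col) (J : Finset (Fin n)) (hJ : l.part 0 < J.card)
    (x : MonoidAlgebra ℂ (Gm n m))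
    (hx : ∀ w : Equiv.Perm (Fin n), (∀ k, jr J (w k) = jr J k) → dl (w, (1 : Equiv.Perm (Fin m))) * x = x)
    (z : MonoidAlgebra ℂ (Gm n m)) :
    tn (youngSymmetrizer row col) (youngSymmetrizer row' col') * z * x = 0 := by
  classical
  obtain ⟨N, hN, h1⟩ : ∃ N : ℕ, N ≠ 0 ∧ tn (rowSymmetrizer (jr J)) 1 * x = (N : ℂ) • x := by
    refine ⟨(Finset.univ.filter (fun w : Equiv.Perm (Fin n) => ∀ k, jr J (w k) = jr J k)).card, ?_, ?_⟩
    · apply Finset.card_ne_zero_of_mem (a := 1); simp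
    · rw [tn, rowSymmetrizer, map_sum, map_one, mul_one, Finset.sum_mul, Finset.sum_congr rfl (g := fun _ => x)]
      · simp [Nat.cast_smul_eq_nsmul]
      · intro w hw
        have := hx w (Finset.mem_filter.1 hw).2
        rw [← i1_dl] at this
        exact this
  have h2 : x = (N : ℂ)⁻¹ • (tn (rowSymmetrizer (jr J)) 1 * x) := by
    rw [h1, smul_smul, inv_mul_cancel₀ (by exact_mod_cast hN), one_smul]
  have h3 : tn (youngSymmetrizer row col) (youngSymmetrizer row' col') * z *
      tn (rowSymmetrizer (jr J)) 1 = 0 := by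
    apply exists_dl_of_ne
    rintro ⟨g, h⟩
    rw [← tn_dl, tn_mul, tn_mul, p_z_eJ hl J hJ, tn_zero_left]
  rw [h2, mul_smul_comm, ← mul_assoc, h3, zero_mul, smul_zero]

lemma mapDomain_fix {α : Type} (s : α →₀ ℕ) (f : α → α) (h : ∀ a ∈ s.support, f a = a) :
    Finsupp.mapDomain f s = s := by
  rw [Finsupp.mapDomain_congr (g := id) h, Finsupp.mapDomain_id]

lemma supp_card_le {α : Type} (s : α →₀ ℕ) : s.support.card ≤ s.degree := by
  rw [Finsupp.degree, Finset.card_eq_sum_ones]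
  apply Finset.sum_le_sum
  intro i hi
  simp at hi
  omega

lemma row_inv {t : ℕ} (is : Fin t → Fin n) (s : Fin n × Fin m →₀ ℕ) (c : ℂ) (w : Equiv.Perm (Fin m))
    (hw : ∀ p ∈ s.support, w p.2 = p.2) :
    rename (act ((1 : Equiv.Perm (Fin n)), w)) (monomial s c * ∏ k, ∑ j, X (is k, j)) =
      monomial s c * ∏ k, ∑ j, X (is k, j) := by
  rw [map_mul, rename_monomial, mapDomain_fix]
  · congr 1
    rw [map_prod]
    apply Finset.prod_congr rfl
    intro k _
    rw [map_sum]
    simp only [rename_X, act, Equiv.Perm.one_apply]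
    exact Equiv.sum_comp w (fun j => (X (is k, j) : MvPolynomial (Fin n × Fin m) ℂ))
  · intro p hp
    simp [act, hw p hp]

lemma col_inv {t : ℕ} (is : Fin t → Fin m) (s : Fin n × Fin m →₀ ℕ) (c : ℂ) (w : Equiv.Perm (Fin n))
    (hw : ∀ p ∈ s.support, w p.1 = p.1) :
    rename (act (w, (1 : Equiv.Perm (Fin m)))) (monomial s c * ∏ k, ∑ j, X (j, is k)) =
      monomial s c * ∏ k, ∑ j, X (j, is k) := by
  rw [map_mul, rename_monomial, mapDomain_fix]
  · congr 1
    rw [map_prod]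
    apply Finset.prod_congr rfl
    intro k _
    rw [map_sum]
    simp only [rename_X, act, Equiv.Perm.one_apply]
    exact Equiv.sum_comp w (fun j => (X (j, is k) : MvPolynomial (Fin n × Fin m) ℂ))
  · intro p hp
    simp [act, hw p hp]

lemma kone {r : ℕ} (hr : r ≤ min n m) (σ : Fin d ↪ Fin n) (τ : Fin d ↪ Fin m)
    {l l' : Ptn} {row col : Fin n → ℕ} {row' col' : Fin m → ℕ}
    (hl : IsFilling l row col) (hl' : IsFilling l' row' col')
    (g1 : l.part 0 + d + r ≤ n + m) (g2 : l'.part 0 + d + r ≤ n + m)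
    (f : MvPolynomial (Fin n × Fin m) ℂ) (hf : f ∈ idealInmr n m r) (z : MonoidAlgebra ℂ (Gm n m)) :
    tn (youngSymmetrizer row col) (youngSymmetrizer row' col') * z * Ph σ τ f = 0 := by
  classical
  have hrn : r ≤ n := le_trans hr (min_le_left _ _)
  have hrm : r ≤ m := le_trans hr (min_le_right _ _)
  suffices H : ∀ a, tn (youngSymmetrizer row col) (youngSymmetrizer row' col') * z * Ph σ τ (a * f) = 0 by
    simpa using H 1
  unfold idealInmr at hf
  induction hf using Submodule.span_induction with
  | zero => intro a; simp
  | add x y _ _ hx hy => intro a; rw [mul_add, map_add, mul_add, hx, hy, add_zero]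
  | smul b x _ hx => intro a; rw [smul_eq_mul, ← mul_assoc]; exact hx _
  | mem x hx =>
    intro a
    induction a using MvPolynomial.induction_on' with
    | add p q hp hq => rw [add_mul, map_add, mul_add, hp, hq, add_zero]
    | monomial s c =>
      have hsm : ∀ (t : ℕ) (g : Fin t → MvPolynomial (Fin n × Fin m) ℂ),
          (∀ k, (g k).IsHomogeneous 1) → (monomial s c * ∏ k, g k).IsHomogeneous (s.degree + t) := by
        intro t g hg
        have := IsHomogeneous.prod Finset.univ g (fun _ => 1) (fun k _ => hg k)
        simp only [Finset.sum_const, Finset.card_univ, Fintype.card_fin, smul_eq_mul, mul_one] at this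
        exact (isHomogeneous_monomial c rfl).mul this
      rcases hx with ((⟨i, j, j', rfl⟩ | ⟨i, i', j, rfl⟩) | ⟨is, hi, rfl⟩) | ⟨js, hi, rfl⟩
      · have : Ph σ τ (monomial s c * (X (i, j) * X (i, j'))) = 0 := by
          rw [Ph_apply]
          apply Finset.sum_eq_zero
          intro γ _
          rw [X, X, monomial_mul, monomial_mul, coeff_monomial, if_neg, zero_smul]
          intro h
          have h1 := Ex_fst σ τ γ i
          rw [← h] at h1
          simp [Finsupp.mapDomain_add, Finsupp.mapDomain_single] at h1
        rw [this, mul_zero]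
      · have : Ph σ τ (monomial s c * (X (i, j) * X (i', j))) = 0 := by
          rw [Ph_apply]
          apply Finset.sum_eq_zero
          intro γ _
          rw [X, X, monomial_mul, monomial_mul, coeff_monomial, if_neg, zero_smul]
          intro h
          have h1 := Ex_snd σ τ γ j
          rw [← h] at h1
          simp [Finsupp.mapDomain_add, Finsupp.mapDomain_single] at h1
        rw [this, mul_zero]
      · by_cases hd : s.degree + (n - r + 1) = d
        · apply kill2 (l := l) hl' ((s.support.image Prod.snd)ᶜ)
          · rw [Finset.card_compl, Fintype.card_fin]
            have h1 := supp_card_le s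
            have h2 := Finset.card_image_le (s := s.support) (f := Prod.snd)
            omega
          · intro w hw
            rw [← Ph_act, row_inv]
            intro p hp
            apply jr_fix hw
            simp only [Finset.mem_compl, not_not]
            exact Finset.mem_image_of_mem _ hp
        · rw [Ph_homog σ τ (hsm _ _ ?_) hd, mul_zero]
          intro k
          exact IsHomogeneous.sum _ _ _ (fun j _ => isHomogeneous_X _ _)
      · by_cases hd : s.degree + (m - r + 1) = d
        · apply kill1 (l' := l') hl ((s.support.image Prod.fst)ᶜ)
          · rw [Finset.card_compl, Fintype.card_fin]
            have h1 := supp_card_le s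
            have h2 := Finset.card_image_le (s := s.support) (f := Prod.fst)
            omega
          · intro w hw
            rw [← Ph_act, col_inv]
            intro p hp
            apply jr_fix hw
            simp only [Finset.mem_compl, not_not]
            exact Finset.mem_image_of_mem _ hp
        · rw [Ph_homog σ τ (hsm _ _ ?_) hd, mul_zero]
          intro k
          exact IsHomogeneous.sum _ _ _ (fun j _ => isHomogeneous_X _ _)

end kone
end GF

namespace GF

/-! ### Symmetrized monomials lie in the ideal -/
section kthree
variable {n m d r : ℕ}

lemma I_row (i : Fin n) (j j' : Fin m) : (X (i, j) * X (i, j') : MvPolynomial (Fin n × Fin m) ℂ) ∈ idealInmr n m r :=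
  Ideal.subset_span (Or.inl (Or.inl (Or.inl ⟨i, j, j', rfl⟩)))

lemma I_col (i i' : Fin n) (j : Fin m) : (X (i, j) * X (i', j) : MvPolynomial (Fin n × Fin m) ℂ) ∈ idealInmr n m r :=
  Ideal.subset_span (Or.inl (Or.inl (Or.inr ⟨i, i', j, rfl⟩)))

lemma I_act (γ : Gm n m) {f : MvPolynomial (Fin n × Fin m) ℂ} (hf : f ∈ idealInmr n m r) :
    rename (act γ) f ∈ idealInmr n m r := by
  unfold idealInmr at hf
  induction hf using Submodule.span_induction with
  | zero => simp
  | add x y _ _ hx hy => rw [map_add]; exact Ideal.add_mem _ hx hy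
  | smul b x _ hx => rw [smul_eq_mul, map_mul]; exact Ideal.mul_mem_left _ _ hx
  | mem x hx =>
    rcases hx with ((⟨i, j, j', rfl⟩ | ⟨i, i', j, rfl⟩) | ⟨is, hi, rfl⟩) | ⟨js, hi, rfl⟩
    · rw [map_mul, rename_X, rename_X]; exact I_row _ _ _
    · rw [map_mul, rename_X, rename_X]; exact I_col _ _ _
    · apply Ideal.subset_span
      refine Or.inl (Or.inr ⟨fun k => γ.1 (is k), γ.1.injective.comp hi, ?_⟩)
      rw [map_prod]
      apply Finset.prod_congr rfl
      intro k _
      rw [map_sum]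
      simp only [rename_X, act]
      exact Equiv.sum_comp γ.2 (fun j => (X (γ.1 (is k), j) : MvPolynomial (Fin n × Fin m) ℂ))
    · apply Ideal.subset_span
      refine Or.inr ⟨fun k => γ.2 (js k), γ.2.injective.comp hi, ?_⟩
      rw [map_prod]
      apply Finset.prod_congr rfl
      intro k _
      rw [map_sum]
      simp only [rename_X, act]
      exact Equiv.sum_comp γ.1 (fun j => (X (j, γ.2 (js k)) : MvPolynomial (Fin n × Fin m) ℂ))

lemma I_swap {f : MvPolynomial (Fin n × Fin m) ℂ} (hf : f ∈ idealInmr n m r) :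
    rename Prod.swap f ∈ idealInmr m n r := by
  unfold idealInmr at hf
  induction hf using Submodule.span_induction with
  | zero => simp
  | add x y _ _ hx hy => rw [map_add]; exact Ideal.add_mem _ hx hy
  | smul b x _ hx => rw [smul_eq_mul, map_mul]; exact Ideal.mul_mem_left _ _ hx
  | mem x hx =>
    rcases hx with ((⟨i, j, j', rfl⟩ | ⟨i, i', j, rfl⟩) | ⟨is, hi, rfl⟩) | ⟨js, hi, rfl⟩
    · rw [map_mul, rename_X, rename_X]; exact I_col _ _ _
    · rw [map_mul, rename_X, rename_X]; exact I_row _ _ _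
    · exact Ideal.subset_span (Or.inr ⟨is, hi, by simp [map_prod, map_sum]⟩)
    · exact Ideal.subset_span (Or.inl (Or.inr ⟨js, hi, by simp [map_prod, map_sum]⟩))

lemma I_noninj {κ : Type} [Fintype κ] (a : κ → Fin n) (b : κ → Fin m)
    (h : ¬ Function.Injective b) :
    (∏ k, X (a k, b k) : MvPolynomial (Fin n × Fin m) ℂ) ∈ idealInmr n m r := by
  classical
  simp only [Function.Injective, not_forall] at h
  obtain ⟨x, y, hxy, hne⟩ := h
  rw [← Finset.mul_prod_erase _ _ (Finset.mem_univ x),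
    ← Finset.mul_prod_erase _ _ (Finset.mem_erase.2 ⟨Ne.symm hne, Finset.mem_univ y⟩), ← mul_assoc]
  apply Ideal.mul_mem_right
  rw [hxy]
  exact I_col _ _ _

lemma I_pigeon {κ : Type} [Fintype κ] (a : κ → Fin n) (T : κ → Finset (Fin m)) (D : Finset (Fin m))
    (hT : ∀ k, T k ⊆ D) (hc : D.card < Fintype.card κ) :
    (∏ k, ∑ j ∈ T k, X (a k, j) : MvPolynomial (Fin n × Fin m) ℂ) ∈ idealInmr n m r := by
  classical
  rw [Finset.prod_univ_sum]
  apply Ideal.sum_mem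
  intro φ hφ
  apply I_noninj
  intro hi
  have : Fintype.card κ ≤ D.card := by
    rw [← Finset.card_univ]
    apply Finset.card_le_card_of_injOn φ _ hi.injOn
    intro k _
    exact hT k (Fintype.mem_piFinset.1 hφ k)
  omega

lemma I_rows (a : Fin d → Fin n) (ha : Function.Injective a) (t : Finset (Fin d))
    (ht : n - r + 1 ≤ t.card) :
    (∏ k ∈ t, ∑ j, X (a k, j) : MvPolynomial (Fin n × Fin m) ℂ) ∈ idealInmr n m r := by
  classical
  obtain ⟨u, hu, hc⟩ := Finset.exists_subset_card_eq ht
  rw [← Finset.prod_sdiff hu]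
  apply Ideal.mul_mem_left
  apply Ideal.subset_span
  refine Or.inl (Or.inr ⟨fun k => a (u.orderEmbOfFin hc k), ha.comp (u.orderEmbOfFin hc).injective, ?_⟩)
  have : u = Finset.univ.map (u.orderEmbOfFin hc).toEmbedding := by
    rw [Finset.map_orderEmbOfFin_univ]
  conv_lhs => rw [this]
  rw [Finset.prod_map]
  rfl

lemma I_q (hr : r ≤ min n m) (a : Fin d → Fin n) (ha : Function.Injective a) (b : Fin d → Fin m)
    (J : Finset (Fin m)) (hJ : n + m < J.card + d + r) :
    (∏ k, ∑ j ∈ (if b k ∈ J then J else {b k}), X (a k, j) : MvPolynomial (Fin n × Fin m) ℂ)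
      ∈ idealInmr n m r := by
  classical
  have hrn : r ≤ n := le_trans hr (min_le_left _ _)
  have hrm : r ≤ m := le_trans hr (min_le_right _ _)
  have e : ∀ k, (∑ j ∈ (if b k ∈ J then J else {b k}), X (a k, j) : MvPolynomial (Fin n × Fin m) ℂ) =
      (if b k ∈ J then 1 else 0) * (∑ j, X (a k, j)) +
      (if b k ∈ J then -1 else 1) * ∑ j ∈ (if b k ∈ J then Jᶜ else {b k}), X (a k, j) := by
    intro k
    split_ifs with h
    · rw [← Finset.sum_add_sum_compl J]; ring
    · ring
  rw [Finset.prod_congr rfl (fun k _ => e k), Finset.prod_add]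
  apply Ideal.sum_mem
  intro t _
  rw [Finset.prod_mul_distrib, Finset.prod_mul_distrib]
  by_cases ht : n - r + 1 ≤ t.card
  · exact Ideal.mul_mem_right _ _ (Ideal.mul_mem_left _ _ (I_rows a ha t ht))
  · apply Ideal.mul_mem_left
    apply Ideal.mul_mem_left
    rw [← Finset.prod_coe_sort]
    apply I_pigeon _ _ Jᶜ
    · intro k
      split_ifs with h
      · exact subset_rfl
      · simpa using h
    · rw [Fintype.card_coe, Finset.card_compl, Fintype.card_fin,
        Finset.card_sdiff_of_subset (Finset.subset_univ t), Finset.card_univ, Fintype.card_fin]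
      have : J.card ≤ m := by simpa using Finset.card_le_univ J
      omega

lemma ext_perm (S : Finset (Fin m)) (f : Fin m → Fin m) (hf : Set.InjOn f S) :
    ∃ w : Equiv.Perm (Fin m), ∀ x ∈ S, w x = f x := by
  classical
  obtain ⟨g, hg⟩ := Finset.exists_equiv_extend_of_card_eq (α := Fin m) (t := (Finset.univ : Finset (Fin m)))
    (by simp) (s := S) (f := f) (Finset.subset_univ _) hf
  refine ⟨g.trans (Equiv.subtypeUnivEquiv (by simp)), fun x hx => ?_⟩
  rw [Equiv.trans_apply]
  exact hg x hx

lemma I_symm (hr : r ≤ min n m) (a : Fin d → Fin n) (ha : Function.Injective a) (b : Fin d → Fin m)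
    (hb : Function.Injective b) (J : Finset (Fin m)) (hJ : n + m < J.card + d + r) :
    (∑ w ∈ Finset.univ.filter (fun w : Equiv.Perm (Fin m) => ∀ k, jr J (w k) = jr J k),
      ∏ k, X (a k, w (b k)) : MvPolynomial (Fin n × Fin m) ℂ) ∈ idealInmr n m r := by
  classical
  set W := Finset.univ.filter (fun w : Equiv.Perm (Fin m) => ∀ k, jr J (w k) = jr J k) with hW
  set T : Fin d → Finset (Fin m) := fun k => if b k ∈ J then J else {b k} with hT
  have h1 : ∑ w ∈ W, rename (act ((1 : Equiv.Perm (Fin n)), w))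
      (∏ k, ∑ j ∈ T k, X (a k, j) : MvPolynomial (Fin n × Fin m) ℂ) ∈ idealInmr n m r :=
    Ideal.sum_mem _ (fun w _ => I_act _ (I_q hr a ha b J hJ))
  rw [Finset.prod_univ_sum] at h1
  simp only [map_sum, map_prod, rename_X, act, Equiv.Perm.one_apply] at h1
  rw [Finset.sum_comm, ← Finset.sum_filter_add_sum_filter_not _ (fun φ : Fin d → Fin m => Function.Injective φ)] at h1
  have h2 : ∑ φ ∈ (Fintype.piFinset T).filter (fun φ : Fin d → Fin m => ¬ Function.Injective φ),
      ∑ w ∈ W, (∏ k, X (a k, w (φ k)) : MvPolynomial (Fin n × Fin m) ℂ) ∈ idealInmr n m r := by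
    apply Ideal.sum_mem
    intro φ hφ
    apply Ideal.sum_mem
    intro w _
    apply I_noninj (b := fun k => w (φ k))
    intro hi
    exact (Finset.mem_filter.1 hφ).2 (Function.Injective.of_comp (f := w) hi)
  have h3 := (Ideal.add_mem_iff_left _ h2).1 h1
  have h4 : ∀ φ ∈ (Fintype.piFinset T).filter (fun φ : Fin d → Fin m => Function.Injective φ),
      ∑ w ∈ W, (∏ k, X (a k, w (φ k)) : MvPolynomial (Fin n × Fin m) ℂ) =
      ∑ w ∈ W, ∏ k, X (a k, w (b k)) := by
    intro φ hφ
    rw [Finset.mem_filter, Fintype.mem_piFinset] at hφ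
    obtain ⟨hφ, hi⟩ := hφ
    have hφ1 : ∀ k, b k ∈ J → φ k ∈ J := fun k hk => by simpa [hT, hk] using hφ k
    have hφ2 : ∀ k, b k ∉ J → φ k = b k := fun k hk => by simpa [hT, hk] using hφ k
    let f : Fin m → Fin m := fun x => if h : ∃ k, b k = x then φ h.choose else x
    have hfb : ∀ k, f (b k) = φ k := by
      intro k
      have h : ∃ k', b k' = b k := ⟨k, rfl⟩
      simp only [f, dif_pos h]
      rw [hb h.choose_spec]
    have hfJ : ∀ x, x ∉ J → f x = x := by
      intro x hx
      by_cases h : ∃ k, b k = x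
      · obtain ⟨k, rfl⟩ := h
        rw [hfb, hφ2 k hx]
      · simp only [f, dif_neg h]
    obtain ⟨w0, hw0⟩ := ext_perm (Jᶜ ∪ Finset.univ.image b) f (by
      intro x hx y hy hxy
      have key : ∀ x ∈ Jᶜ ∪ Finset.univ.image b, x ∉ J ∨ ∃ k, b k = x ∧ x ∈ J := by
        intro x hx
        rw [Finset.mem_union, Finset.mem_compl, Finset.mem_image] at hx
        by_cases hxJ : x ∈ J
        · rcases hx with hx | ⟨k, _, hk⟩
          · exact Or.inl hx
          · exact Or.inr ⟨k, hk, hxJ⟩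
        · exact Or.inl hxJ
      rcases key x hx with hx | ⟨k, rfl, hkx⟩ <;> rcases key y hy with hy | ⟨k', rfl, hky⟩
      · rwa [hfJ x hx, hfJ y hy] at hxy
      · rw [hfJ x hx, hfb] at hxy
        exact absurd (hxy ▸ hφ1 _ hky) hx
      · rw [hfJ y hy, hfb] at hxy
        exact absurd (hxy ▸ hφ1 _ hkx) hy
      · rw [hfb, hfb] at hxy
        rw [hi hxy])
    have hwb : ∀ k, w0 (b k) = φ k := fun k => by
      rw [hw0 _ (Finset.mem_union_right _ (Finset.mem_image_of_mem _ (Finset.mem_univ k))), hfb]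
    have hwJ : ∀ k, jr J (w0 k) = jr J k := by
      apply jr_pres
      intro x hx
      rw [hw0 _ (Finset.mem_union_left _ (Finset.mem_compl.2 hx)), hfJ x hx]
    refine Finset.sum_bij' (fun w _ => w * w0) (fun w _ => w * w0⁻¹) ?_ ?_ ?_ ?_ ?_
    · intro w hw
      rw [hW, Finset.mem_filter] at hw ⊢
      refine ⟨Finset.mem_univ _, fun k => ?_⟩
      rw [Equiv.Perm.mul_apply, hw.2, hwJ]
    · intro w hw
      rw [hW, Finset.mem_filter] at hw ⊢
      refine ⟨Finset.mem_univ _, fun k => ?_⟩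
      rw [Equiv.Perm.mul_apply, hw.2, ← hwJ]
      simp
    · intro w _; simp
    · intro w _; simp
    · intro w _
      simp only [Equiv.Perm.mul_apply, hwb]
  rw [Finset.sum_congr rfl h4, Finset.sum_const, nsmul_eq_mul] at h3
  have hne : ((Fintype.piFinset T).filter (fun φ : Fin d → Fin m => Function.Injective φ)).card ≠ 0 := by
    apply Finset.card_ne_zero_of_mem (a := b)
    rw [Finset.mem_filter, Fintype.mem_piFinset]
    refine ⟨fun k => ?_, hb⟩
    simp only [hT]
    split_ifs with h
    · exact h
    · simp
  set N := ((Fintype.piFinset T).filter (fun φ : Fin d → Fin m => Function.Injective φ)).card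
  have h5 := Ideal.mul_mem_left _ (C ((N : ℂ)⁻¹)) h3
  rw [← mul_assoc] at h5
  have h6 : (C ((N : ℂ)⁻¹) * (N : MvPolynomial (Fin n × Fin m) ℂ)) = 1 := by
    rw [← map_natCast (C : ℂ →+* MvPolynomial (Fin n × Fin m) ℂ), ← map_mul,
      inv_mul_cancel₀ (by exact_mod_cast hne), map_one]
  rwa [h6, one_mul] at h5

lemma I_symm' (hr : r ≤ min n m) (a : Fin d → Fin n) (ha : Function.Injective a) (b : Fin d → Fin m)
    (hb : Function.Injective b) (J : Finset (Fin n)) (hJ : n + m < J.card + d + r) :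
    (∑ w ∈ Finset.univ.filter (fun w : Equiv.Perm (Fin n) => ∀ k, jr J (w k) = jr J k),
      ∏ k, X (w (a k), b k) : MvPolynomial (Fin n × Fin m) ℂ) ∈ idealInmr n m r := by
  have := I_swap (I_symm (r := r) (min_comm n m ▸ hr) b hb a ha J (by omega))
  simpa only [map_sum, map_prod, rename_X, Prod.swap_prod_mk] using this

end kthree
end GF

namespace GF

/-! ### Bad components vanish -/
section bad
variable {n m d r : ℕ} (σ : Fin d ↪ Fin n) (τ : Fin d ↪ Fin m)

lemma monomial_Ex (γ : Gm n m) : (monomial (Ex σ τ γ) (1 : ℂ)) = ∏ k, X (γ.1 (σ k), γ.2 (τ k)) := by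
  rw [Ex, monomial_sum_one]
  rfl

lemma row0_card {l : Ptn} {row col : Fin n → ℕ} (hl : IsFilling l row col) :
    (Finset.univ.filter (fun x => row x = 0)).card = l.part 0 := by
  rw [← Finset.card_range (l.part 0)]
  apply Finset.card_bij (fun x _ => col x)
  · intro x hx
    have := filling_lt hl x
    rw [(Finset.mem_filter.1 hx).2] at this
    simpa using this
  · intro x hx y hy hxy
    apply hl.1
    simp only [(Finset.mem_filter.1 hx).2, (Finset.mem_filter.1 hy).2, hxy]
  · intro j hj
    obtain ⟨k, h1, h2⟩ := (hl.2 0 j).2 (by simpa using hj)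
    exact ⟨k, by simp [h1], h2⟩

lemma eJ_p {l : Ptn} {row col : Fin n → ℕ} (hl : IsFilling l row col) :
    ∃ (J : Finset (Fin n)) (c : ℂ), J.card = l.part 0 ∧
      youngSymmetrizer row col = c • (rowSymmetrizer (jr J) * youngSymmetrizer row col) := by
  obtain ⟨N, hN, h⟩ := row_row (r := jr (Finset.univ.filter (fun x => row x = 0))) (row := row) (by
    intro w hw k
    by_cases hk : k ∈ Finset.univ.filter (fun x => row x = 0)
    · have := jr_mem hw hk
      rw [(Finset.mem_filter.1 hk).2, (Finset.mem_filter.1 this).2]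
    · rw [jr_fix hw hk])
  refine ⟨_, (N : ℂ)⁻¹, row0_card hl, ?_⟩
  rw [youngSymmetrizer, ← mul_assoc, h, smul_mul_assoc, smul_smul,
    inv_mul_cancel₀ (by exact_mod_cast hN), one_smul]

lemma I_smul (c : ℂ) {f : MvPolynomial (Fin n × Fin m) ℂ} (hf : f ∈ idealInmr n m r) :
    c • f ∈ idealInmr n m r := by
  rw [smul_eq_C_mul]; exact Ideal.mul_mem_left _ _ hf

lemma Th_left_mem {y : MonoidAlgebra ℂ (Gm n m)} (hy : Th σ τ y ∈ idealInmr n m r)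
    (u : MonoidAlgebra ℂ (Gm n m)) : Th σ τ (u * y) ∈ idealInmr n m r := by
  induction u using ga_ind with
  | h1 g => rw [Th_act]; exact I_act _ hy
  | h2 a b ha hb => rw [add_mul, map_add]; exact Ideal.add_mem _ ha hb
  | h3 c a ha => rw [smul_mul_assoc, map_smul]; exact I_smul _ ha

lemma bad2_aux (hr : r ≤ min n m) (J : Finset (Fin m)) (hJ : n + m < J.card + d + r)
    (y : MonoidAlgebra ℂ (Gm n m)) :
    Th σ τ (tn 1 (rowSymmetrizer (jr J)) * y) ∈ idealInmr n m r := by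
  classical
  induction y using ga_ind with
  | h1 g =>
    have := I_symm hr (fun k => g.1 (σ k)) (g.1.injective.comp σ.injective) (fun k => g.2 (τ k))
      (g.2.injective.comp τ.injective) J hJ
    rw [rowSymmetrizer, tn_sum_right, Finset.sum_mul, map_sum]
    convert this using 1
    apply Finset.sum_congr (by congr)
    intro w _
    change Th σ τ (tn 1 (dl w) * dl g) = _
    rw [← dl_one, tn_dl, ← dl_mul, Th_dl, monomial_Ex]
    rfl
  | h2 a b ha hb => rw [mul_add, map_add]; exact Ideal.add_mem _ ha hb
  | h3 c a ha => rw [mul_smul_comm, map_smul]; exact I_smul _ ha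

lemma bad1_aux (hr : r ≤ min n m) (J : Finset (Fin n)) (hJ : n + m < J.card + d + r)
    (y : MonoidAlgebra ℂ (Gm n m)) :
    Th σ τ (tn (rowSymmetrizer (jr J)) 1 * y) ∈ idealInmr n m r := by
  classical
  induction y using ga_ind with
  | h1 g =>
    have := I_symm' hr (fun k => g.1 (σ k)) (g.1.injective.comp σ.injective) (fun k => g.2 (τ k))
      (g.2.injective.comp τ.injective) J hJ
    rw [tn, map_one, mul_one, rowSymmetrizer, map_sum, Finset.sum_mul, map_sum]
    convert this using 1
    apply Finset.sum_congr (by congr)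
    intro w _
    change Th σ τ (i1 (dl w) * dl g) = _
    rw [i1_dl, ← dl_mul, Th_dl, monomial_Ex]
    rfl
  | h2 a b ha hb => rw [mul_add, map_add]; exact Ideal.add_mem _ ha hb
  | h3 c a ha => rw [mul_smul_comm, map_smul]; exact I_smul _ ha

lemma bad_mem (hr : r ≤ min n m) {l l' : Ptn} {row col : Fin n → ℕ} {row' col' : Fin m → ℕ}
    (hl : IsFilling l row col) (hl' : IsFilling l' row' col')
    (hb : ¬ (l.part 0 + d + r ≤ n + m ∧ l'.part 0 + d + r ≤ n + m))
    (u x : MonoidAlgebra ℂ (Gm n m)) :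
    Th σ τ (u * tn (youngSymmetrizer row col) (youngSymmetrizer row' col') * x) ∈ idealInmr n m r := by
  rw [mul_assoc]
  apply Th_left_mem
  rw [not_and_or] at hb
  rcases hb with hb | hb
  · obtain ⟨J, c, hJ, e⟩ := eJ_p hl
    have e2 : tn (youngSymmetrizer row col) (youngSymmetrizer row' col') =
        c • (tn (rowSymmetrizer (jr J)) 1 * tn (youngSymmetrizer row col) (youngSymmetrizer row' col')) := by
      rw [tn_mul, one_mul, ← tn_smul_left, ← e]
    rw [e2, smul_mul_assoc, map_smul, mul_assoc]
    exact I_smul _ (bad1_aux σ τ hr J (by omega) _)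
  · obtain ⟨J, c, hJ, e⟩ := eJ_p hl'
    have e2 : tn (youngSymmetrizer row col) (youngSymmetrizer row' col') =
        c • (tn 1 (rowSymmetrizer (jr J)) * tn (youngSymmetrizer row col) (youngSymmetrizer row' col')) := by
      rw [tn_mul, one_mul, ← tn_smul_right, ← e]
    rw [e2, smul_mul_assoc, map_smul, mul_assoc]
    exact I_smul _ (bad2_aux σ τ hr J (by omega) _)

/-! ### Every homogeneous polynomial is, modulo the ideal, in the range of `Th` -/

lemma nonrook_mem (s : Fin n × Fin m →₀ ℕ) {p q : Fin n × Fin m} (hp : p ∈ s.support)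
    (hq : q ∈ s.support) (hne : p ≠ q) (h : p.1 = q.1 ∨ p.2 = q.2) :
    (monomial s (1 : ℂ)) ∈ idealInmr n m r := by
  have e : s = (s - Finsupp.single p 1 - Finsupp.single q 1) + (Finsupp.single p 1 + Finsupp.single q 1) := by
    ext x
    simp only [Finsupp.mem_support_iff] at hp hq
    simp only [Finsupp.add_apply, Finsupp.tsub_apply, Finsupp.single_apply]
    split_ifs with h1 h2 <;> subst_vars <;> first | omega | exact absurd rfl hne
  have e2 : monomial s (1 : ℂ) = monomial (s - Finsupp.single p 1 - Finsupp.single q 1) 1 * (X p * X q) := by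
    rw [X, X, monomial_mul, monomial_mul, ← e]; simp
  rw [e2]
  apply Ideal.mul_mem_left
  obtain ⟨a, b⟩ := p
  obtain ⟨a', b'⟩ := q
  rcases h with h | h
  · simp only at h; subst h; exact I_row _ _ _
  · simp only at h; subst h; exact I_col _ _ _

lemma sq_mem (s : Fin n × Fin m →₀ ℕ) {p : Fin n × Fin m} (hp : 2 ≤ s p) :
    (monomial s (1 : ℂ)) ∈ idealInmr n m r := by
  have e : s = (s - Finsupp.single p 2) + (Finsupp.single p 1 + Finsupp.single p 1) := by
    ext x
    simp only [Finsupp.add_apply, Finsupp.tsub_apply, Finsupp.single_apply]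
    split_ifs with h1
    · subst h1; omega
    · omega
  have e2 : monomial s (1 : ℂ) = monomial (s - Finsupp.single p 2) 1 * (X p * X p) := by
    rw [X, monomial_mul, monomial_mul, ← e]; simp
  rw [e2]
  apply Ideal.mul_mem_left
  exact I_row p.1 p.2 p.2

lemma rook_or (s : Fin n × Fin m →₀ ℕ) (hs : s.degree = d) :
    monomial s (1 : ℂ) ∈ idealInmr n m r ∨
    ∃ (a : Fin d ↪ Fin n) (b : Fin d ↪ Fin m), s = ∑ k, Finsupp.single (a k, b k) 1 := by
  classical
  by_cases h1 : ∃ p, 2 ≤ s p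
  · obtain ⟨p, hp⟩ := h1; exact Or.inl (sq_mem s hp)
  by_cases h2 : ∃ p ∈ s.support, ∃ q ∈ s.support, p ≠ q ∧ (p.1 = q.1 ∨ p.2 = q.2)
  · obtain ⟨p, hp, q, hq, hne, h⟩ := h2
    exact Or.inl (nonrook_mem s hp hq hne h)
  push Not at h1 h2
  right
  have h3 : ∀ p ∈ s.support, s p = 1 := by
    intro p hp
    have := h1 p
    simp at hp
    omega
  have hc : Fintype.card s.support = d := by
    rw [Fintype.card_coe, ← hs, Finsupp.degree, Finset.card_eq_sum_ones]
    exact Finset.sum_congr rfl (fun p hp => (h3 p hp).symm)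
  let e := (Fintype.equivFinOfCardEq hc).symm
  refine ⟨⟨fun k => (e k).1.1, ?_⟩, ⟨fun k => (e k).1.2, ?_⟩, ?_⟩
  · intro x y hxy
    by_contra hne
    exact (h2 _ (e x).2 _ (e y).2 (fun h => hne (e.injective (Subtype.ext h)))).1 hxy
  · intro x y hxy
    by_contra hne
    exact (h2 _ (e x).2 _ (e y).2 (fun h => hne (e.injective (Subtype.ext h)))).2 hxy
  · change s = ∑ k, Finsupp.single (e k).1 1
    rw [Equiv.sum_comp e (fun p => Finsupp.single p.1 1)]
    rw [Finset.sum_coe_sort s.support (fun p => Finsupp.single p 1)]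
    conv_lhs => rw [← Finsupp.sum_single s]
    exact Finset.sum_congr rfl (fun p hp => by rw [h3 p hp])

lemma homog_range (f : MvPolynomial (Fin n × Fin m) ℂ) (hf : f.IsHomogeneous d) :
    ∃ x, f - Th σ τ x ∈ idealInmr n m r := by
  classical
  have h : ∀ s ∈ f.support, ∃ x, monomial s (1 : ℂ) - Th σ τ x ∈ idealInmr n m r := by
    intro s hs
    have hd : s.degree = d := by
      by_contra hc
      exact (mem_support_iff.1 hs) (hf.coeff_eq_zero hc)
    rcases rook_or (r := r) s hd with h | ⟨a, b, h⟩
    · exact ⟨0, by simpa using h⟩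
    · obtain ⟨w, hw⟩ := exists_perm_emb σ a
      obtain ⟨w', hw'⟩ := exists_perm_emb τ b
      refine ⟨dl (w, w'), ?_⟩
      rw [Th_dl, h, Ex]
      simp [hw, hw']
  choose! x hx using h
  refine ⟨∑ s ∈ f.support, coeff s f • x s, ?_⟩
  conv => 
    enter [2, 1]
    rw [f.as_sum]
  rw [map_sum, ← Finset.sum_sub_distrib]
  apply Ideal.sum_mem
  intro s hs
  rw [map_smul]
  have : monomial s (coeff s f) = coeff s f • monomial s (1 : ℂ) := by
    rw [smul_monomial, smul_eq_mul, mul_one]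
  rw [this, ← smul_sub]
  exact I_smul _ (hx s hs)

lemma homog_big (hd : n < d ∨ m < d) (f : MvPolynomial (Fin n × Fin m) ℂ) (hf : f.IsHomogeneous d) :
    f ∈ idealInmr n m r := by
  rw [f.as_sum]
  apply Ideal.sum_mem
  intro s hs
  have hdd : s.degree = d := by
    by_contra hc
    exact (mem_support_iff.1 hs) (hf.coeff_eq_zero hc)
  have : monomial s (coeff s f) = coeff s f • monomial s (1 : ℂ) := by
    rw [smul_monomial, smul_eq_mul, mul_one]
  rw [this]
  apply I_smul
  rcases rook_or (r := r) s hdd with h | ⟨a, b, h⟩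
  · exact h
  · have h1 := Fintype.card_le_of_embedding a
    have h2 := Fintype.card_le_of_embedding b
    simp at h1 h2
    omega

end bad
end GF

namespace GF

/-! ### Assembling the components -/
section asm
variable {n m d : ℕ}

/-- index set of all components -/
abbrev KI (n m d : ℕ) := {t : (TP n × TP m) × TP d // hs t.2.1 t.1.1.1 ∧ hs t.2.1 t.1.2.1}

noncomputable instance KI_fintype : Fintype (KI n m d) := Fintype.ofFinite _

variable (rn cn : TP n → Fin n → ℕ) (rm cm : TP m → Fin m → ℕ)

/-- outer tensor product of Specht modules -/
abbrev VV (t : TP n × TP m) := spechtModule (rn t.1) (cn t.1) ⊗[ℂ] spechtModule (rm t.2) (cm t.2)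

/-- its generator -/
noncomputable def pp (t : TP n × TP m) : MonoidAlgebra ℂ (Gm n m) :=
  tn (youngSymmetrizer (rn t.1) (cn t.1)) (youngSymmetrizer (rm t.2) (cm t.2))

/-- its embedding -/
noncomputable def tv (t : TP n × TP m) : VV rn cn rm cm t →ₗ[ℂ] MonoidAlgebra ℂ (Gm n m) :=
  tnV (rn t.1) (cn t.1) (rm t.2) (cm t.2)

variable (σ : Fin d ↪ Fin n) (τ : Fin d ↪ Fin m)

/-- The requirements on the component vectors. -/
structure Fam (x : KI n m d → MonoidAlgebra ℂ (Gm n m)) : Prop where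
  left : ∀ k, ∃ y, x k = pp rn cn rm cm k.1.1 * y
  inv : ∀ k (h : Gm n m) (z : Equiv.Perm (Fin d)), (∀ i, h.1 (σ i) = σ (z i)) →
      (∀ i, h.2 (τ i) = τ (z i)) → x k * dl h = x k
  sep : ∀ k, ∃ R, x k * R ≠ 0 ∧ ∀ k', k'.1.1 = k.1.1 → k' ≠ k → x k' * R = 0

variable {rn cn rm cm}

lemma exists_fam (hn : ∀ l, IsFilling l.1 (rn l) (cn l)) (hm : ∀ l, IsFilling l.1 (rm l) (cm l)) :
    ∃ x, Fam rn cn rm cm σ τ x := by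
  choose rd cd hd using fun u : TP d => exists_filling u
  have h1 : ∀ k : KI n m d, ∃ y, youngSymmetrizer (rn k.1.1.1) (cn k.1.1.1) * y * fixSum σ *
      sig σ (youngSymmetrizer (rd k.1.2) (cd k.1.2)) ≠ 0 := fun k =>
    L2b σ (hn _) (hd _) (fun i => (k.2.1 i).2) (fun i => (k.2.1 i).1)
  have h2 : ∀ k : KI n m d, ∃ y, youngSymmetrizer (rm k.1.1.2) (cm k.1.1.2) * y * fixSum τ *
      sig τ (qYoung (rd k.1.2) (cd k.1.2)) ≠ 0 := fun k =>
    L2c τ (hm _) (hd _) (fun i => (k.2.2 i).2) (fun i => (k.2.2 i).1)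
  choose y hy using h1
  choose y' hy' using h2
  refine ⟨fun k => xv σ τ (youngSymmetrizer (rn k.1.1.1) (cn k.1.1.1) * y k * fixSum σ *
      sig σ (youngSymmetrizer (rd k.1.2) (cd k.1.2)))
      (youngSymmetrizer (rm k.1.1.2) (cm k.1.1.2) * y' k * fixSum τ *
      sig τ (qYoung (rd k.1.2) (cd k.1.2))), ?_, ?_, ?_⟩
  · intro k
    refine ⟨xv σ τ (y k * fixSum σ * sig σ (youngSymmetrizer (rd k.1.2) (cd k.1.2)))
        (y' k * fixSum τ * sig τ (qYoung (rd k.1.2) (cd k.1.2))), ?_⟩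
    rw [pp, ← xv_left]
    simp only [mul_assoc]
  · intro k h z h1 h2
    exact xv_inv σ τ _ _ _ _ _ _ rfl rfl h1 h2
  · intro k
    refine ⟨i1 (sig σ (youngSymmetrizer (rd k.1.2) (cd k.1.2))), ?_, ?_⟩
    · rw [xv_diag σ τ _ _ (hd _)]
      intro h0
      rw [smul_eq_zero] at h0
      rcases h0 with h0 | h0
      · exact mul_ne_zero (kap_ne (hd _)) (kap_ne (hd _)) h0
      · exact tn_ne_zero (hy k) (hy' k) h0
    · intro k' hk hne
      apply xv_orth σ τ _ _ (hd _) (hd _)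
      intro h
      exact hne (Subtype.ext (Prod.ext hk (Subtype.ext h)))

variable {σ τ}

lemma fam_inj (hn : ∀ l, IsFilling l.1 (rn l) (cn l)) (hm : ∀ l, IsFilling l.1 (rm l) (cm l))
    {x : KI n m d → MonoidAlgebra ℂ (Gm n m)} (hx : Fam rn cn rm cm σ τ x)
    {K : Type} [Fintype K] (κ : K → KI n m d) (hκ : Function.Injective κ)
    (v : ∀ k, VV rn cn rm cm (κ k).1.1)
    (h0 : ∀ k z, pp rn cn rm cm (κ k).1.1 * z *
      Ph σ τ (Th σ τ (∑ k, tv rn cn rm cm _ (v k) * x (κ k))) = 0) : ∀ k, v k = 0 := by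
  classical
  obtain ⟨N, hN, hNe⟩ := Ph_Th_inv σ τ (∑ k, tv rn cn rm cm _ (v k) * x (κ k)) (by
    intro h z h1 h2
    rw [Finset.sum_mul]
    apply Finset.sum_congr rfl
    intro k _
    rw [mul_assoc, hx.inv _ h z h1 h2])
  have := hNe 1
  rw [one_mul] at this
  simp only [this] at h0
  have key := inj_lemma (idemFam_tn (idemFam_young rn cn hn) (idemFam_young rm cm hm)) (AlgHom.id ℂ _)
    (fun k => (κ k).1.1) (fun k => x (κ k)) (fun k => hx.left (κ k)) ?_
    (fun k => tv rn cn rm cm _ (v k)) (fun k => tnV_mem _ _ _ _ (v k)) ?_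
  · intro k
    apply tnV_inj
    rw [map_zero]
    exact key k
  · intro i c hc hs0 k
    by_cases hk : (κ k).1.1 = i
    · obtain ⟨R, hR1, hR2⟩ := hx.sep (κ k)
      have h1 := congrArg (fun z => z * R) hs0
      simp only [Finset.sum_mul, zero_mul] at h1
      rw [Finset.sum_eq_single k] at h1
      · rw [smul_mul_assoc, smul_eq_zero] at h1
        exact h1.resolve_right hR1
      · intro k' _ hne
        by_cases hk' : (κ k').1.1 = i
        · rw [smul_mul_assoc, hR2 (κ k') (hk'.trans hk.symm) (fun h => hne (hκ h)), smul_zero]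
        · rw [hc k' hk', zero_smul, zero_mul]
      · intro h; exact absurd (Finset.mem_univ _) h
    · exact hc k hk
  · intro k z
    have := h0 k z
    rw [mul_smul_comm, smul_eq_zero] at this
    exact this.resolve_left (by exact_mod_cast hN)

open scoped Classical in
lemma finrank_Th_le : Module.finrank ℂ (LinearMap.range (Th σ τ)) ≤ n.choose d * m.choose d * d.factorial := by
  let Q := {A : Finset (Fin n) // A ∈ Finset.powersetCard d Finset.univ} × (Fin d ↪ Fin m)
  let F : Q → MvPolynomial (Fin n × Fin m) ℂ := fun q =>
    monomial (∑ k, Finsupp.single (q.1.1.orderEmbOfFin (Finset.mem_powersetCard.1 q.1.2).2 k, q.2 k) 1) 1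
  have hcard : Fintype.card Q = n.choose d * m.choose d * d.factorial := by
    rw [Fintype.card_prod, Fintype.card_embedding_eq, Fintype.card_coe, Finset.card_powersetCard]
    simp [Nat.descFactorial_eq_factorial_mul_choose]
    ring
  have hle : LinearMap.range (Th σ τ) ≤ Submodule.span ℂ (Set.range F) := by
    rintro _ ⟨x, rfl⟩
    induction x using ga_ind with
    | h1 g =>
      rw [Th_dl]
      apply Submodule.subset_span
      let A : Finset (Fin n) := Finset.univ.image (fun k => g.1 (σ k))
      have hA : A ∈ Finset.powersetCard d Finset.univ := by
        rw [Finset.mem_powersetCard]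
        refine ⟨Finset.subset_univ _, ?_⟩
        exact (Finset.card_image_of_injective _ (g.1.injective.comp σ.injective)).trans (by simp)
      have hAc := (Finset.mem_powersetCard.1 hA).2
      have h1 : ∀ k, ∃ k', A.orderEmbOfFin hAc k = g.1 (σ k') := by
        intro k
        have := Finset.orderEmbOfFin_mem A hAc k
        rw [Finset.mem_image] at this
        obtain ⟨k', _, h⟩ := this
        exact ⟨k', h.symm⟩
      choose z hz using h1
      have hzi : Function.Injective z := by
        intro a b hab
        apply (A.orderEmbOfFin hAc).injective
        rw [hz, hz, hab]
      let e := Equiv.ofBijective z (Finite.injective_iff_bijective.1 hzi)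
      refine ⟨(⟨A, hA⟩, ⟨fun k => g.2 (τ (z k)), g.2.injective.comp (τ.injective.comp hzi)⟩), ?_⟩
      have hE : (∑ k, Finsupp.single (A.orderEmbOfFin hAc k, g.2 (τ (z k))) 1 :
          (Fin n × Fin m) →₀ ℕ) = ∑ k, Finsupp.single (g.1 (σ k), g.2 (τ k)) 1 := by
        rw [← Equiv.sum_comp e (fun k => (Finsupp.single (g.1 (σ k), g.2 (τ k)) 1 :
          (Fin n × Fin m) →₀ ℕ))]
        apply Finset.sum_congr rfl
        intro k _
        rw [hz]
        rfl
      exact congrArg (fun s => monomial s (1 : ℂ)) hE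
    | h2 a b ha hb => rw [map_add]; exact Submodule.add_mem _ ha hb
    | h3 c a ha => rw [map_smul]; exact Submodule.smul_mem _ _ ha
  calc _ ≤ Module.finrank ℂ (Submodule.span ℂ (Set.range F)) := 
        @Submodule.finrank_mono _ _ _ _ _ _ _ _ (FiniteDimensional.span_of_finite ℂ (Set.finite_range F)) hle
    _ ≤ Fintype.card Q := finrank_range_le_card F
    _ = _ := hcard

lemma fam_surj (hn : ∀ l, IsFilling l.1 (rn l) (cn l)) (hm : ∀ l, IsFilling l.1 (rm l) (cm l))
    {x : KI n m d → MonoidAlgebra ℂ (Gm n m)} (hx : Fam rn cn rm cm σ τ x) (y : MonoidAlgebra ℂ (Gm n m)) :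
    ∃ v : ∀ k : KI n m d, VV rn cn rm cm k.1.1,
      Th σ τ (∑ k, tv rn cn rm cm _ (v k) * x k) = Th σ τ y := by
  classical
  let L : (∀ k : KI n m d, VV rn cn rm cm k.1.1) →ₗ[ℂ] MvPolynomial (Fin n × Fin m) ℂ :=
    Th σ τ ∘ₗ ∑ k, (LinearMap.mulRight ℂ (x k)) ∘ₗ tv rn cn rm cm k.1.1 ∘ₗ LinearMap.proj k
  have hL : ∀ v, L v = Th σ τ (∑ k, tv rn cn rm cm _ (v k) * x k) := by
    intro v
    simp [L]
  have hinj : Function.Injective L := by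
    rw [injective_iff_map_eq_zero]
    intro v hv
    funext k
    rw [hL] at hv
    exact fam_inj hn hm hx id Function.injective_id v (by
      intro k z
      simp only [id]
      rw [hv, map_zero, mul_zero]) k
  have hle : LinearMap.range L ≤ LinearMap.range (Th σ τ) := LinearMap.range_comp_le_range _ _
  have hdim : Module.finrank ℂ (LinearMap.range (Th σ τ)) ≤ Module.finrank ℂ (LinearMap.range L) := by
    rw [LinearMap.finrank_range_of_inj hinj, Module.finrank_pi_fintype]
    refine le_trans finrank_Th_le ?_
    rw [← N3]
    calc _ = ∑ t : (TP n × TP m) × TP d, if hs t.2.1 t.1.1.1 ∧ hs t.2.1 t.1.2.1 then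
          gdim n t.1.1 * gdim m t.1.2 else 0 := by
          rw [Fintype.sum_prod_type, Fintype.sum_prod_type]
      _ = ∑ t ∈ Finset.univ.filter (fun t : (TP n × TP m) × TP d => hs t.2.1 t.1.1.1 ∧ hs t.2.1 t.1.2.1),
          gdim n t.1.1 * gdim m t.1.2 := by rw [Finset.sum_filter]
      _ = ∑ k : KI n m d, gdim n k.1.1.1 * gdim m k.1.1.2 := by
          rw [Finset.sum_subtype (p := fun t : (TP n × TP m) × TP d => hs t.2.1 t.1.1.1 ∧ hs t.2.1 t.1.2.1)]
          intro t; simp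
      _ ≤ _ := by
          apply Finset.sum_le_sum
          intro k _
          rw [Module.finrank_tensorProduct]
          exact Nat.mul_le_mul (gdim_le _ _ _ _ (hn _)) (gdim_le _ _ _ _ (hm _))
  have heq := Submodule.eq_of_le_of_finrank_le hle hdim
  have : Th σ τ y ∈ LinearMap.range L := by rw [heq]; exact ⟨y, rfl⟩
  obtain ⟨v, hv⟩ := this
  exact ⟨v, by rw [← hL, hv]⟩

end asm
end GF

namespace GF

/-! ### The final isomorphism -/

lemma mult_idx {n m : ℕ} (r d : ℕ) (l : TP n) (l' : TP m) :
    ∃ f : Fin (gradedMult n m r d l.1 l'.1) → TP d, Function.Injective f ∧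
      ∀ u, (∃ i, f i = u) ↔ ((l.1.part 0 + d + r ≤ n + m ∧ l'.1.part 0 + d + r ≤ n + m) ∧
        hs u.1 l.1 ∧ hs u.1 l'.1) := by
  by_cases hg : l.1.part 0 + d + r ≤ n + m ∧ l'.1.part 0 + d + r ≤ n + m
  · let S := {mu : Ptn // mu.size = d ∧ IsPieri mu ((n : ℤ) - d) l.1 ∧ IsPieri mu ((m : ℤ) - d) l'.1}
    have hc : gradedMult n m r d l.1 l'.1 = Nat.card S := if_pos hg
    rw [hc]
    let ι : S → TP d := fun s => ⟨s.1, s.2.1⟩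
    have hι : Function.Injective ι := fun a b h => Subtype.ext (congrArg (fun z : TP d => z.1) h)
    have : Finite S := Finite.of_injective ι hι
    let e : S ≃ Fin (Nat.card S) := Finite.equivFin S
    refine ⟨fun i => ι (e.symm i), hι.comp e.symm.injective, ?_⟩
    intro u
    constructor
    · rintro ⟨i, rfl⟩
      have h := (e.symm i).2
      exact ⟨hg, (pieri_iff h.1 l.2).1 h.2.1, (pieri_iff h.1 l'.2).1 h.2.2⟩
    · rintro ⟨-, h1, h2⟩
      refine ⟨e ⟨u.1, u.2, (pieri_iff u.2 l.2).2 h1, (pieri_iff u.2 l'.2).2 h2⟩, ?_⟩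
      simp only [Equiv.symm_apply_apply]
      rfl
  · have hc : gradedMult n m r d l.1 l'.1 = 0 := if_neg hg
    rw [hc]
    refine ⟨fun i => i.elim0, fun i => i.elim0, ?_⟩
    intro u
    constructor
    · rintro ⟨i, -⟩; exact i.elim0
    · rintro ⟨h, -⟩; exact absurd h hg

open scoped Classical in
lemma sum_split {K L M : Type*} [Fintype K] [Fintype L] [AddCommMonoid M] (κ : K → L)
    (hκ : Function.Injective κ) (F : L → M) :
    ∃ s : Finset L, (∀ l ∈ s, l ∉ Set.range κ) ∧ ∑ l, F l = ∑ k, F (κ k) + ∑ l ∈ s, F l := by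
  refine ⟨Finset.univ.filter (fun l => l ∉ Set.range κ), fun l hl => (Finset.mem_filter.1 hl).2, ?_⟩
  rw [← Finset.sum_filter_add_sum_filter_not Finset.univ (fun l => l ∈ Set.range κ)]
  congr 1
  rw [← Finset.sum_image (s := Finset.univ) (g := κ) (f := F) hκ.injOn]
  apply Finset.sum_congr _ (fun _ _ => rfl)
  ext k
  simp

/-- Every homogeneous polynomial is represented by the good components. -/
lemma good_surj {n m r d : ℕ} {rn cn : TP n → Fin n → ℕ} {rm cm : TP m → Fin m → ℕ}
    {σ : Fin d ↪ Fin n} {τ : Fin d ↪ Fin m} (hr : r ≤ min n m)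
    (hn : ∀ l, IsFilling l.1 (rn l) (cn l))
    (hm : ∀ l, IsFilling l.1 (rm l) (cm l))
    {x : KI n m d → MonoidAlgebra ℂ (Gm n m)} (hx : Fam rn cn rm cm σ τ x)
    {K : Type} [Fintype K] (κ : K → KI n m d) (hκ : Function.Injective κ)
    (hgood : ∀ k : KI n m d, k.1.1.1.1.part 0 + d + r ≤ n + m ∧ k.1.1.2.1.part 0 + d + r ≤ n + m →
      ∃ i, κ i = k)
    (f : MvPolynomial (Fin n × Fin m) ℂ) (hf : f.IsHomogeneous d) :
    ∃ v : ∀ k : KI n m d, VV rn cn rm cm k.1.1,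
      f - Th σ τ (∑ k : K, tv rn cn rm cm (κ k).1.1 (v (κ k)) * x (κ k)) ∈ idealInmr n m r := by
  classical
  obtain ⟨y, hy⟩ := homog_range (r := r) σ τ f hf
  obtain ⟨v, hv⟩ := fam_surj hn hm hx y
  refine ⟨v, ?_⟩
  obtain ⟨s, hs, hsplit⟩ := sum_split κ hκ (fun k => tv rn cn rm cm k.1.1 (v k) * x k)
  have hbad : Th σ τ (∑ k ∈ s, tv rn cn rm cm _ (v k) * x k)
      ∈ idealInmr n m r := by
    rw [map_sum]
    apply Ideal.sum_mem
    intro k hk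
    obtain ⟨u, hu⟩ := tnV_mem _ _ _ _ (v k)
    rw [tv, hu]
    apply bad_mem σ τ hr (hn _) (hm _)
    intro hg
    exact hs k hk (hgood k hg)
  rw [← hv, hsplit, map_add] at hy
  have := Ideal.add_mem _ hy hbad
  rwa [sub_add_eq_sub_sub, sub_add_cancel] at this

section fin
variable {n m r d : ℕ}

/-- The target module. -/
abbrev TT (r d : ℕ) (rn cn : TP n → Fin n → ℕ) (rm cm : TP m → Fin m → ℕ) :=
  ⨁ lr : TP n × TP m, (Fin (gradedMult n m r d lr.1.1 lr.2.1) → VV rn cn rm cm lr)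

variable {rn cn : TP n → Fin n → ℕ} {rm cm : TP m → Fin m → ℕ}

/-- The action on the target. -/
noncomputable def actT (g : Equiv.Perm (Fin n)) (h : Equiv.Perm (Fin m)) (w : TT r d rn cn rm cm) :
    TT r d rn cn rm cm :=
  DFinsupp.mapRange
          (fun lr v => (TensorProduct.map
              (spechtAct (rn lr.1) (cn lr.1) g)
              (spechtAct (rm lr.2) (cm lr.2) h)) ∘ v)
          (fun lr => by ext i; simp) w

lemma actT_apply (g : Equiv.Perm (Fin n)) (h : Equiv.Perm (Fin m)) (w : TT r d rn cn rm cm) (lr i) :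
    actT g h w lr i = TensorProduct.map
              (spechtAct (rn lr.1) (cn lr.1) g)
              (spechtAct (rm lr.2) (cm lr.2) h) (w lr i) := rfl

lemma exists_Phi (hr : r ≤ min n m) (hn : ∀ l, IsFilling l.1 (rn l) (cn l))
    (hm : ∀ l, IsFilling l.1 (rm l) (cm l)) :
    ∃ Φ : TT r d rn cn rm cm →ₗ[ℂ] MvPolynomial (Fin n × Fin m) ℂ,
      (∀ w, (Φ w).IsHomogeneous d) ∧ (∀ w w', Φ w - Φ w' ∈ idealInmr n m r → w = w') ∧
      (∀ f : MvPolynomial (Fin n × Fin m) ℂ, f.IsHomogeneous d → ∃ w, f - Φ w ∈ idealInmr n m r) ∧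
      ∀ g h w, Φ (actT g h w) = rename (fun p : Fin n × Fin m => (g p.1, h p.2)) (Φ w) := by
  classical
  choose μ hμi hμ using fun lr : TP n × TP m => mult_idx r d lr.1 lr.2
  by_cases hd : n < d ∨ m < d
  · refine ⟨0, fun w => ?_, fun w w' _ => ?_, fun f hf => ⟨0, ?_⟩, fun g h w => ?_⟩
    · exact isHomogeneous_zero _ _ _
    · apply DFinsupp.ext
      intro lr
      funext i
      exfalso
      have h := (hμ lr (μ lr i)).1 ⟨i, rfl⟩
      have h1 := hs_size_le h.2.1
      have h2 := hs_size_le h.2.2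
      rw [(μ lr i).2, lr.1.2] at h1
      rw [(μ lr i).2, lr.2.2] at h2
      omega
    · simpa using homog_big hd f hf
    · simp
  push Not at hd
  let σ : Fin d ↪ Fin n := Fin.castLEEmb hd.1
  let τ : Fin d ↪ Fin m := Fin.castLEEmb hd.2
  obtain ⟨x, hx⟩ := exists_fam σ τ hn hm
  let K := Σ lr : TP n × TP m, Fin (gradedMult n m r d lr.1.1 lr.2.1)
  let κ : K → KI n m d := fun k => ⟨(k.1, μ k.1 k.2), ((hμ _ _).1 ⟨k.2, rfl⟩).2⟩
  have hκ : Function.Injective κ := by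
    rintro ⟨a, i⟩ ⟨b, j⟩ h
    have h1 : a = b := congrArg (fun z : KI n m d => z.1.1) h
    subst h1
    have h2 : μ a i = μ a j := congrArg (fun z : KI n m d => z.1.2) h
    rw [hμi a h2]
  have hgood : ∀ k : K, k.1.1.1.part 0 + d + r ≤ n + m ∧ k.1.2.1.part 0 + d + r ≤ n + m :=
    fun k => ((hμ _ _).1 ⟨k.2, rfl⟩).1
  let Φ : TT r d rn cn rm cm →ₗ[ℂ] MvPolynomial (Fin n × Fin m) ℂ :=
    Th σ τ ∘ₗ ∑ k : K, (LinearMap.mulRight ℂ (x (κ k))) ∘ₗ tv rn cn rm cm k.1 ∘ₗ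
      LinearMap.proj k.2 ∘ₗ DirectSum.component ℂ _ _ k.1
  have hΦ : ∀ w, Φ w = Th σ τ (∑ k : K, tv rn cn rm cm k.1 (w k.1 k.2) * x (κ k)) := by
    intro w
    simp only [Φ, LinearMap.comp_apply, LinearMap.sum_apply]
    rfl
  refine ⟨Φ, fun w => ?_, fun w w' hw => ?_, fun f hf => ?_, fun g h w => ?_⟩
  · rw [hΦ]; exact Th_homog σ τ _
  · have h0 := fam_inj hn hm hx κ hκ (fun k => w k.1 k.2 - w' k.1 k.2) (by
      intro k z
      rw [hΦ, hΦ, ← map_sub, ← Finset.sum_sub_distrib] at hw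
      simp only [← sub_mul, ← map_sub] at hw
      exact kone hr σ τ (hn _) (hm _) (hgood k).1 (hgood k).2 _ hw z)
    apply DFinsupp.ext
    intro lr
    funext i
    exact sub_eq_zero.1 (h0 ⟨lr, i⟩)
  · obtain ⟨v, hv⟩ := good_surj hr hn hm hx κ hκ (by
      intro k hg
      obtain ⟨i, hi⟩ := (hμ k.1.1 k.1.2).2 ⟨hg, k.2⟩
      exact ⟨⟨k.1.1, i⟩, Subtype.ext (Prod.ext rfl hi)⟩) f hf
    refine ⟨DFinsupp.equivFunOnFintype.symm (fun lr i => v (κ ⟨lr, i⟩)), ?_⟩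
    rw [hΦ]
    exact hv
  · rw [hΦ, hΦ]
    have := Th_act σ τ (g, h) (∑ k : K, tv rn cn rm cm k.1 (w k.1 k.2) * x (κ k))
    refine Eq.trans ?_ this
    rw [Finset.mul_sum]
    congr 1
    apply Finset.sum_congr rfl
    intro k _
    rw [← mul_assoc, actT_apply]
    congr 1
    exact tnV_act _ _ _ _ _ _ _

lemma final (hr : r ≤ min n m) (hn : ∀ l, IsFilling l.1 (rn l) (cn l))
    (hm : ∀ l, IsFilling l.1 (rm l) (cm l)) :
    ∃ e : gradedPiece n m r d ≃ₗ[ℂ] TT r d rn cn rm cm,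
      ∀ (g : Equiv.Perm (Fin n)) (h : Equiv.Perm (Fin m))
        (f : MvPolynomial (Fin n × Fin m) ℂ)
        (hf : f ∈ homogeneousSubmodule (Fin n × Fin m) ℂ d)
        (hf' : rename (fun p : Fin n × Fin m => (g p.1, h p.2)) f ∈
          homogeneousSubmodule (Fin n × Fin m) ℂ d),
        e ⟨Ideal.Quotient.mkₐ ℂ (idealInmr n m r)
              (rename (fun p : Fin n × Fin m => (g p.1, h p.2)) f),
            Submodule.mem_map_of_mem hf'⟩ =
        actT g h (e ⟨Ideal.Quotient.mkₐ ℂ (idealInmr n m r) f,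
            Submodule.mem_map_of_mem hf⟩) := by
  obtain ⟨Φ, h1, h2, h3, h4⟩ := exists_Phi (d := d) hr hn hm
  let Ψ : TT r d rn cn rm cm →ₗ[ℂ] gradedPiece n m r d :=
    LinearMap.codRestrict _ ((Ideal.Quotient.mkₐ ℂ (idealInmr n m r)).toLinearMap ∘ₗ Φ)
      (fun w => Submodule.mem_map_of_mem ((mem_homogeneousSubmodule d _).2 (h1 w)))
  have hΨ : ∀ w (f : MvPolynomial (Fin n × Fin m) ℂ) (hf : f ∈ homogeneousSubmodule (Fin n × Fin m) ℂ d),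
      f - Φ w ∈ idealInmr n m r →
      Ψ w = ⟨Ideal.Quotient.mkₐ ℂ (idealInmr n m r) f, Submodule.mem_map_of_mem hf⟩ := by
    intro w f hf hfw
    apply Subtype.ext
    exact (Ideal.Quotient.eq.2 hfw).symm
  have hbij : Function.Bijective Ψ := by
    constructor
    · intro w w' hw
      exact h2 w w' (Ideal.Quotient.eq.1 (congrArg Subtype.val hw))
    · rintro ⟨_, f, hf, rfl⟩
      obtain ⟨w, hw⟩ := h3 f ((mem_homogeneousSubmodule d _).1 hf)
      exact ⟨w, hΨ w f hf hw⟩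
  let E := LinearEquiv.ofBijective Ψ hbij
  refine ⟨E.symm, ?_⟩
  intro g h f hf hf'
  obtain ⟨w, hw⟩ := h3 f ((mem_homogeneousSubmodule d _).1 hf)
  have e1 : E w = _ := hΨ w f hf hw
  have e2 : E (actT g h w) = _ := hΨ (actT g h w) _ hf' (by
    rw [h4, ← map_sub]
    exact I_act (g, h) hw)
  rw [← e1, ← e2, LinearEquiv.symm_apply_apply, LinearEquiv.symm_apply_apply]

end fin
end GF

open scoped Classical in
/-- for `r ≤ min(n,m)`, the graded Frobenius image of
`ℂ[x_{n×m}]/I_{n,m,r}` is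
`Σ_{d} q^d · {Σ_{μ⊢d}(s_μ·h_{n−d}) ⊗ (s_μ·h_{m−d})}_{λ_1 ≤ n+m−d−r}`: i.e. for
each `d`, the degree-`d` component is `S_n × S_m`-equivariantly isomorphic to
`⊕_{λ⊢n, ρ⊢m} (V^λ ⊗ V^ρ)^{⊕ gradedMult(n,m,r,d,λ,ρ)}`, where the `S_n × S_m`
action on the quotient permutes the row and column indices of the variables. -/
theorem graded_frobenius_quotient (n m r : ℕ) (hr : r ≤ min n m) (d : ℕ)
    (rowfn colfn : {l : Ptn // l.size = n} → Fin n → ℕ)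
    (hfn : ∀ l : {l : Ptn // l.size = n}, IsFilling l.1 (rowfn l) (colfn l))
    (rowfm colfm : {l : Ptn // l.size = m} → Fin m → ℕ)
    (hfm : ∀ l : {l : Ptn // l.size = m}, IsFilling l.1 (rowfm l) (colfm l)) :
    ∃ e : gradedPiece n m r d ≃ₗ[ℂ]
        ⨁ lr : {l : Ptn // l.size = n} × {l : Ptn // l.size = m},
          (Fin (gradedMult n m r d lr.1.1 lr.2.1) →
            ((spechtModule (rowfn lr.1) (colfn lr.1)) ⊗[ℂ]
              (spechtModule (rowfm lr.2) (colfm lr.2)))),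
      ∀ (g : Equiv.Perm (Fin n)) (h : Equiv.Perm (Fin m))
        (f : MvPolynomial (Fin n × Fin m) ℂ)
        (hf : f ∈ homogeneousSubmodule (Fin n × Fin m) ℂ d)
        (hf' : rename (fun p : Fin n × Fin m => (g p.1, h p.2)) f ∈
          homogeneousSubmodule (Fin n × Fin m) ℂ d),
        e ⟨Ideal.Quotient.mkₐ ℂ (idealInmr n m r)
              (rename (fun p : Fin n × Fin m => (g p.1, h p.2)) f),
            Submodule.mem_map_of_mem hf'⟩ =
        DFinsupp.mapRange
          (fun lr v => (TensorProduct.map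
              (spechtAct (rowfn lr.1) (colfn lr.1) g)
              (spechtAct (rowfm lr.2) (colfm lr.2) h)) ∘ v)
          (fun lr => by ext i; simp)
          (e ⟨Ideal.Quotient.mkₐ ℂ (idealInmr n m r) f,
            Submodule.mem_map_of_mem hf⟩) := by
  exact GF.final hr hfn hfm
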